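/- Assume n > 1. There exists a family 𝓕̄ of algebraic subgroups of GL_n(k), each having a triangular representation bounded by n·8^{5.5n³·16^{(2n³)^{149n⁸}}}, such that for every algebraic subgroup H' ⊆ GL_n(k) there exists H̄ ∈ 𝓕̄ with (H̄°)ᵗ normal in (H')° and (H̄°)ᵗ ⊆ (H')° ⊆ H' ⊆ H̄. -/

import Mathlib

open MvPolynomial Matrix Pointwise

section TriSets

variable {k : Type*} [Field k] {σ : Type*} [LinearOrder σ]

noncomputable def leadCoeff (c : σ) (g : MvPolynomial σ k) : MvPolynomial σ k :=
  (g.support.filter fun m => m c = g.degreeOf c).sum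
    fun m => monomial (Finsupp.erase c m) (g.coeff m)

def IsTriangularSet (G : List (MvPolynomial σ k)) : Prop :=
  (∀ g ∈ G, g.vars.Nonempty) ∧
  G.Chain' fun g h => g.vars.max < h.vars.max

def IsPseudoRem (G : List (MvPolynomial σ k)) (f r : MvPolynomial σ k) : Prop :=
  ∃ (c : Fin G.length → σ) (α : Fin G.length → ℕ) (q : Fin G.length → MvPolynomial σ k),
    (∀ i, (G.get i).vars.max = (c i : WithBot σ)) ∧
    (∏ i, leadCoeff (c i) (G.get i) ^ α i) * f = (∑ i, q i * G.get i) + r ∧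
    ∀ i, r.degreeOf (c i) < (G.get i).degreeOf (c i)

def trep (G : List (MvPolynomial σ k)) : Set (MvPolynomial σ k) :=
  {f | IsPseudoRem G f 0}

def HasTriRepBoundedBy (I : Ideal (MvPolynomial σ k)) (D : ℝ) : Prop :=
  ∃ (N : ℕ) (G : Fin (N + 1) → List (MvPolynomial σ k)),
    (∀ i, IsTriangularSet (G i)) ∧
    (∀ i, ∀ g ∈ G i, (g.totalDegree : ℝ) ≤ D) ∧
    (∀ i, ∃ J : Ideal (MvPolynomial σ k), J.IsRadical ∧ (J : Set (MvPolynomial σ k)) = trep (G i)) ∧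
    (I.radical : Set (MvPolynomial σ k)) = ⋂ i, trep (G i)

end TriSets

section GLdefs

variable {k : Type*} [Field k]

noncomputable def evalMat {n : ℕ} (g : GL (Fin n) k) : (Fin n ×ₗ Fin n) → k :=
  fun p => (g : Matrix (Fin n) (Fin n) k) (ofLex p).1 (ofLex p).2

def IsZeroSetOf {n : ℕ} (S : Set (MvPolynomial (Fin n ×ₗ Fin n) k))
    (H : Subgroup (GL (Fin n) k)) : Prop :=
  ∀ g : GL (Fin n) k, g ∈ H ↔ ∀ p ∈ S, eval (evalMat g) p = 0

def IsAlgebraicSubgroup {n : ℕ} (H : Subgroup (GL (Fin n) k)) : Prop :=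
  ∃ S : Finset (MvPolynomial (Fin n ×ₗ Fin n) k), IsZeroSetOf (S : Set _) H

/-- `H` is an algebraic subgroup whose defining ideal has a triangular
representation bounded by `D`. -/
def SubgroupTriRepBoundedBy {n : ℕ} (H : Subgroup (GL (Fin n) k)) (D : ℝ) : Prop :=
  ∃ S : Finset (MvPolynomial (Fin n ×ₗ Fin n) k),
    IsZeroSetOf (S : Set (MvPolynomial (Fin n ×ₗ Fin n) k)) H ∧
    HasTriRepBoundedBy (Ideal.span (S : Set (MvPolynomial (Fin n ×ₗ Fin n) k))) D

def IsUnipotent {n : ℕ} (g : GL (Fin n) k) : Prop :=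
  ((g : Matrix (Fin n) (Fin n) k) - 1) ^ n = 0

/-- The Zariski topology on `GL_n(k)`: closed sets are zero sets of families of
polynomials in the matrix entries. -/
def zariskiGL (n : ℕ) (k : Type*) [Field k] : TopologicalSpace (GL (Fin n) k) :=
  TopologicalSpace.generateFrom
    {U | ∃ S : Set (MvPolynomial (Fin n ×ₗ Fin n) k),
      U = {g | ∃ p ∈ S, eval (evalMat g) p ≠ 0}}

/-- The identity component `H°` of a subgroup `H ⊆ GL_n(k)`: the connected component of
the identity in `H` for the (subspace) Zariski topology, viewed as a subset of `GL_n(k)`. -/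
noncomputable def idComponent {n : ℕ} (H : Subgroup (GL (Fin n) k)) : Set (GL (Fin n) k) :=
  letI := zariskiGL n k
  Subtype.val '' connectedComponent (⟨1, H.one_mem⟩ : H)

end GLdefs

/-- The bound `n·8^(5.5n³·16^((2n³)^(149n⁸)))` (real powers). -/
noncomputable def d3Bound (n : ℕ) : ℝ :=
  (n : ℝ) * (8 : ℝ) ^ (5.5 * (n : ℝ) ^ 3 *
    (16 : ℝ) ^ ((2 * (n : ℝ) ^ 3) ^ (149 * (n : ℝ) ^ 8)))

/-- `χ` restricts to a character of the (sub)group `S ⊆ GL_n(k)`: it is multiplicative,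
nonvanishing, and regular, i.e. given on `S` by `P(g)/det(g)^m`. -/
def IsCharacterOn {k : Type*} [Field k] {n : ℕ} (S : Set (GL (Fin n) k))
    (χ : GL (Fin n) k → k) : Prop :=
  (∀ g ∈ S, χ g ≠ 0) ∧
  (∀ g ∈ S, ∀ h ∈ S, χ (g * h) = χ g * χ h) ∧
  ∃ (P : MvPolynomial (Fin n ×ₗ Fin n) k) (m : ℕ),
    ∀ g ∈ S, χ g = MvPolynomial.eval (evalMat g) P /
      (Matrix.det (g : Matrix (Fin n) (Fin n) k)) ^ m

/-- `Sᵗ`: the intersection of the kernels of all characters of `S`. -/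
def charKernels {k : Type*} [Field k] {n : ℕ} (S : Set (GL (Fin n) k)) :
    Set (GL (Fin n) k) :=
  {g | g ∈ S ∧ ∀ χ : GL (Fin n) k → k, IsCharacterOn S χ → χ g = 1}



open MvPolynomial Matrix Pointwise

set_option linter.unusedSectionVars false
set_option linter.deprecated false

section PsiSec
variable {k : Type*} [Field k] {σ : Type*} [LinearOrder σ]

noncomputable def psi (c : σ) : MvPolynomial σ k →ₐ[k] Polynomial (MvPolynomial σ k) :=
  aeval (fun i => if i = c then Polynomial.X else Polynomial.C (X i))

lemma psi_X_self (c : σ) : psi c (X c : MvPolynomial σ k) = Polynomial.X := by simp [psi]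

lemma psi_C (c : σ) (a : k) : psi c (C a : MvPolynomial σ k) = Polynomial.C (C a) := by
  simp only [psi, algHom_C]; rfl

lemma psi_eq_C {c : σ} {f : MvPolynomial σ k} (h : c ∉ f.vars) : psi c f = Polynomial.C f := by
  have h1 : (psi c f) = aeval (fun i => Polynomial.C (X i : MvPolynomial σ k)) f := by
    unfold psi
    rw [aeval_def, aeval_def]
    apply eval₂Hom_congr' rfl _ rfl
    intro i hi _
    have : i ≠ c := fun e => h (e ▸ hi)
    simp [this]
  rw [h1]
  have h2 : (aeval (fun i => Polynomial.C (X i : MvPolynomial σ k))) =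
    (Polynomial.CAlgHom : MvPolynomial σ k →ₐ[MvPolynomial σ k] _).restrictScalars k := by
    ext i; simp
  rw [h2]; rfl

lemma psi_monomial (c : σ) (m : σ →₀ ℕ) (a : k) :
    psi c (monomial m a) = Polynomial.monomial (m c) (monomial (Finsupp.erase c m) a) := by
  have h : monomial m a = monomial (Finsupp.erase c m) a * (X c) ^ (m c) := by
    rw [X_pow_eq_monomial, monomial_mul, mul_one, Finsupp.erase_add_single]
  have h2 : c ∉ (monomial (Finsupp.erase c m) a).vars := by
    intro hc
    rw [mem_vars] at hc
    obtain ⟨d, hd, hcd⟩ := hc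
    have := support_monomial_subset hd
    simp only [Finset.mem_singleton] at this
    subst this
    simp at hcd
  rw [h, map_mul, map_pow, psi_X_self, psi_eq_C h2, Polynomial.C_mul_X_pow_eq_monomial]

lemma psi_eval (c : σ) (f : MvPolynomial σ k) : (psi c f).eval (X c) = f := by
  have : ((Polynomial.aeval (X c : MvPolynomial σ k)).restrictScalars k).comp (psi c) =
      AlgHom.id k (MvPolynomial σ k) := by
    ext i
    by_cases h : i = c
    · subst h; simp [psi]
    · simp [psi, h]
  have h := DFunLike.congr_fun this f
  simpa [Polynomial.coe_aeval_eq_eval] using h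

lemma psi_coeff (c : σ) (f : MvPolynomial σ k) (d : ℕ) :
    (psi c f).coeff d = (f.support.filter fun m => m c = d).sum
    fun m => monomial (Finsupp.erase c m) (f.coeff m) := by
  conv_lhs => rw [f.as_sum]
  rw [map_sum, Polynomial.finsetSum_coeff, Finset.sum_filter]
  apply Finset.sum_congr rfl
  intro m _
  rw [psi_monomial, Polynomial.coeff_monomial]

lemma leadCoeff_eq_psi (c : σ) (f : MvPolynomial σ k) :
    leadCoeff c f = (psi c f).coeff (f.degreeOf c) := by rw [psi_coeff]; rfl

lemma coeff_psi_coeff (c : σ) (f : MvPolynomial σ k) (d : ℕ) (m : σ →₀ ℕ) (hm : m c = 0) :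
    ((psi c f).coeff d).coeff m = f.coeff (m + Finsupp.single c d) := by
  rw [psi_coeff, coeff_sum]
  have hcm : Finsupp.erase c m = m := by
    apply Finsupp.erase_of_notMem_support; simpa using hm
  by_cases h : m + Finsupp.single c d ∈ f.support
  · rw [Finset.sum_eq_single (m + Finsupp.single c d)]
    · rw [coeff_monomial, Finsupp.erase_add, Finsupp.erase_single, add_zero, hcm, if_pos rfl]
    · intro b hb hne
      rw [coeff_monomial, if_neg]
      intro e
      apply hne
      simp only [Finset.mem_filter] at hb
      rw [← e, ← hb.2, Finsupp.erase_add_single]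
    · intro h'
      exfalso; apply h'; simp [h, hm] at *
  · rw [notMem_support_iff.1 h]
    apply Finset.sum_eq_zero
    intro b hb
    rw [coeff_monomial, if_neg]
    intro e
    apply h
    simp only [Finset.mem_filter] at hb
    rw [← e, ← hb.2, Finsupp.erase_add_single]; exact hb.1

lemma psi_coeff_vars {c : σ} {f : MvPolynomial σ k} {d : ℕ} {i : σ}
    (h : i ∈ ((psi c f).coeff d).vars) : i ≠ c ∧ i ∈ f.vars := by
  rw [psi_coeff] at h
  obtain ⟨m, hm, h⟩ := Finset.mem_biUnion.1 (vars_sum_subset _ _ h)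
  rw [mem_vars] at h
  obtain ⟨e, he, hi⟩ := h
  have := support_monomial_subset he
  simp only [Finset.mem_singleton] at this
  subst this
  simp only [Finsupp.support_erase, Finset.mem_erase] at hi
  refine ⟨hi.1, ?_⟩
  rw [mem_vars]
  exact ⟨m, (Finset.mem_filter.1 hm).1, hi.2⟩

lemma natDegree_psi (c : σ) (f : MvPolynomial σ k) : (psi c f).natDegree = f.degreeOf c := by
  apply le_antisymm
  · rw [Polynomial.natDegree_le_iff_coeff_eq_zero]
    intro N hN
    rw [psi_coeff]
    apply Finset.sum_eq_zero
    intro m hm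
    simp only [Finset.mem_filter] at hm
    have := monomial_le_degreeOf c hm.1
    omega
  · rw [degreeOf_le_iff]
    intro m hm
    by_contra hlt
    push Not at hlt
    have h0 := Polynomial.coeff_eq_zero_of_natDegree_lt hlt
    have := coeff_psi_coeff c f (m c) (Finsupp.erase c m) (by simp)
    rw [h0, Finsupp.erase_add_single] at this
    exact (mem_support_iff.1 hm) (by simpa using this.symm)

lemma psi_injective (c : σ) : Function.Injective (psi (k := k) c) := by
  intro f g h
  rw [← psi_eval c f, h, psi_eval]

end PsiSec

open MvPolynomial Matrix Pointwise

section TrepSec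
variable {k : Type*} [Field k] {σ : Type*} [LinearOrder σ]

lemma vars_max_eq {f : MvPolynomial σ k} {j : σ} (hj : j ∈ f.vars) (h : ∀ i ∈ f.vars, i ≤ j) :
    f.vars.max = (j : WithBot σ) := by
  apply le_antisymm
  · apply Finset.max_le
    intro a ha
    exact_mod_cast h a ha
  · exact Finset.le_max hj

lemma const_mem_prime {P : Ideal (MvPolynomial σ k)} [hP : P.IsPrime] {f : MvPolynomial σ k}
    (hf : f ∈ P) (hv : f.vars = ∅) : f = 0 := by
  by_contra hne
  rw [vars_eq_empty_iff_eq_C] at hv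
  apply hP.ne_top
  rw [hv] at hf hne
  apply Ideal.eq_top_of_isUnit_mem _ hf
  apply IsUnit.map
  rw [isUnit_iff_ne_zero]
  intro h
  exact hne (by rw [h, C_0])

lemma trep_reduction [Finite σ] (P : Ideal (MvPolynomial σ k)) [hP : P.IsPrime]
    (A : Finset σ) (g : σ → MvPolynomial σ k)
    (hgP : ∀ j ∈ A, g j ∈ P) (hgv : ∀ j ∈ A, ∀ i ∈ (g j).vars, i ≤ j)
    (hgd : ∀ j ∈ A, 0 < (g j).degreeOf j)
    (h1 : ∀ j ∈ A, ∀ f ∈ P, (∀ i ∈ f.vars, i ≤ j) → f.degreeOf j < (g j).degreeOf j →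
      ∀ d, (psi j f).coeff d ∈ P)
    (h2 : ∀ j ∉ A, ∀ f ∈ P, (∀ i ∈ f.vars, i ≤ j) → ∀ d, (psi j f).coeff d ∈ P)
    (M : Submonoid (MvPolynomial σ k)) (hM : ∀ j ∈ A, leadCoeff j (g j) ∈ M)
    (I : Ideal (MvPolynomial σ k)) (hI : ∀ j ∈ A, g j ∈ I) :
    ∀ f ∈ P, ∃ m ∈ M, m * f ∈ I := by
  classical
  let J : Ideal (MvPolynomial σ k) :=
    { carrier := {f | ∃ m ∈ M, m * f ∈ I}
      add_mem' := by
        rintro a b ⟨m, hm, ha⟩ ⟨m', hm', hb⟩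
        refine ⟨m * m', M.mul_mem hm hm', ?_⟩
        have : m * m' * (a + b) = m' * (m * a) + m * (m' * b) := by ring
        rw [this]
        exact I.add_mem (I.mul_mem_left _ ha) (I.mul_mem_left _ hb)
      zero_mem' := ⟨1, M.one_mem, by simp⟩
      smul_mem' := by
        rintro c a ⟨m, hm, ha⟩
        refine ⟨m, hm, ?_⟩
        have : m * (c • a) = c * (m * a) := by simp only [smul_eq_mul]; ring
        rw [this]
        exact I.mul_mem_left _ ha }
  have hJ : ∀ m ∈ M, ∀ f, m * f ∈ J → f ∈ J := by
    rintro m hm f ⟨m', hm', h⟩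
    exact ⟨m' * m, M.mul_mem hm' hm, by rwa [mul_assoc]⟩
  have hIJ : ∀ f ∈ I, f ∈ J := fun f hf => ⟨1, M.one_mem, by simpa using hf⟩
  have key : ∀ j : σ, ∀ f ∈ P, (∀ i ∈ f.vars, i ≤ j) → f ∈ J := by
    intro j
    induction j using WellFoundedLT.induction with
    | ind j IH =>
    have IH' : ∀ f ∈ P, (∀ i ∈ f.vars, i < j) → f ∈ J := by
      intro f hf hv
      rcases Finset.eq_empty_or_nonempty f.vars with h | h
      · rw [const_mem_prime hf h]; exact J.zero_mem
      · exact IH (f.vars.max' h) (hv _ (Finset.max'_mem _ h)) f hf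
          (fun i hi => Finset.le_max' _ _ hi)
    have coefs : ∀ f ∈ P, (∀ i ∈ f.vars, i ≤ j) → (∀ d, (psi j f).coeff d ∈ P) → f ∈ J := by
      intro f hf hv hc
      rw [← psi_eval j f, Polynomial.eval_eq_sum_range]
      apply J.sum_mem
      intro d _
      apply J.mul_mem_right
      apply IH' _ (hc d)
      intro i hi
      obtain ⟨h3, h4⟩ := psi_coeff_vars hi
      exact lt_of_le_of_ne (hv i h4) h3
    by_cases hjA : j ∈ A
    swap
    · intro f hf hv
      exact coefs f hf hv (h2 j hjA f hf hv)
    suffices H : ∀ D : ℕ, ∀ f ∈ P, (∀ i ∈ f.vars, i ≤ j) → f.degreeOf j < D → f ∈ J by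
      intro f hf hv
      exact H _ f hf hv (Nat.lt_succ_self _)
    intro D
    induction D with
    | zero => intro f _ _ h; omega
    | succ D ihD =>
    intro f hf hv hD
    rcases lt_or_ge (f.degreeOf j) ((g j).degreeOf j) with hlt | hge
    · exact coefs f hf hv (h1 j hjA f hf hv hlt)
    apply hJ _ (hM j hjA)
    set lc := leadCoeff j (g j) with hlc
    set a := (psi j f).coeff (f.degreeOf j) with ha
    set e := f.degreeOf j - (g j).degreeOf j with he
    set f' := lc * f - a * X j ^ e * g j with hf'
    have hlcv : j ∉ lc.vars := by
      rw [hlc, leadCoeff_eq_psi]; intro h; exact (psi_coeff_vars h).1 rfl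
    have hav : j ∉ a.vars := by intro h; exact (psi_coeff_vars h).1 rfl
    have hfmem : f' ∈ J := by
      apply ihD
      · exact P.sub_mem (P.mul_mem_left _ hf) (P.mul_mem_left _ (hgP j hjA))
      · intro i hi
        have h3 := vars_sub_subset (p := lc * f) (q := a * X j ^ e * g j) hi
        rw [Finset.mem_union] at h3
        rcases h3 with h3 | h3
        · rcases Finset.mem_union.1 (vars_mul _ _ h3) with h4 | h4
          · rw [hlc, leadCoeff_eq_psi] at h4
            exact hgv j hjA i (psi_coeff_vars h4).2
          · exact hv i h4
        · rcases Finset.mem_union.1 (vars_mul _ _ h3) with h4 | h4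
          · rcases Finset.mem_union.1 (vars_mul _ _ h4) with h5 | h5
            · exact hv i (psi_coeff_vars h5).2
            · have h6 := vars_pow _ _ h5
              rw [vars_X, Finset.mem_singleton] at h6
              exact h6.le
          · exact hgv j hjA i h4
      · rw [← natDegree_psi]
        have hp : psi j f' = Polynomial.C lc * psi j f -
            Polynomial.C a * Polynomial.X ^ e * psi j (g j) := by
          rw [hf', map_sub, map_mul, map_mul, map_mul, map_pow, psi_X_self, psi_eq_C hlcv,
            psi_eq_C hav]
        have hd0 : 0 < f.degreeOf j := lt_of_lt_of_le (hgd j hjA) hge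
        have hle : (psi j f').natDegree ≤ f.degreeOf j - 1 := by
          rw [Polynomial.natDegree_le_iff_coeff_eq_zero]
          intro N hN
          rw [hp, Polynomial.coeff_sub, mul_assoc, Polynomial.coeff_C_mul, Polynomial.coeff_C_mul,
            mul_comm (Polynomial.X ^ e), Polynomial.coeff_mul_X_pow', if_pos (by omega)]
          rcases Nat.lt_or_ge (f.degreeOf j) N with h | h
          · rw [Polynomial.coeff_eq_zero_of_natDegree_lt (by rw [natDegree_psi]; exact h),
              Polynomial.coeff_eq_zero_of_natDegree_lt (by rw [natDegree_psi]; omega)]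
            simp
          · have hN' : N = f.degreeOf j := by omega
            have h5 : N - e = (g j).degreeOf j := by omega
            rw [h5, hN', ← ha, ← leadCoeff_eq_psi, ← hlc]
            ring
        omega
    have : lc * f = f' + a * X j ^ e * g j := by rw [hf']; ring
    rw [this]
    exact J.add_mem hfmem (J.mul_mem_left _ (hIJ _ (hI j hjA)))
  intro f hf
  rcases Finset.eq_empty_or_nonempty f.vars with h | h
  · rw [const_mem_prime hf h]; exact J.zero_mem
  · exact key (f.vars.max' h) f hf (fun i hi => Finset.le_max' _ _ hi)

lemma trep_eq_prime [Finite σ] (P : Ideal (MvPolynomial σ k)) [hP : P.IsPrime]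
    (A : Finset σ) (g : σ → MvPolynomial σ k)
    (hgP : ∀ j ∈ A, g j ∈ P) (hgv : ∀ j ∈ A, ∀ i ∈ (g j).vars, i ≤ j)
    (hgd : ∀ j ∈ A, 0 < (g j).degreeOf j) (hlc : ∀ j ∈ A, leadCoeff j (g j) ∉ P)
    (h1 : ∀ j ∈ A, ∀ f ∈ P, (∀ i ∈ f.vars, i ≤ j) → f.degreeOf j < (g j).degreeOf j →
      ∀ d, (psi j f).coeff d ∈ P)
    (h2 : ∀ j ∉ A, ∀ f ∈ P, (∀ i ∈ f.vars, i ≤ j) → ∀ d, (psi j f).coeff d ∈ P) :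
    IsTriangularSet (A.sort.map g) ∧ trep (A.sort.map g) = P := by
  have hvj : ∀ j ∈ A, j ∈ (g j).vars := by
    intro j hj
    rw [mem_vars_iff_degreeOf_ne_zero]
    exact (hgd j hj).ne'
  have hmax : ∀ j ∈ A, (g j).vars.max = (j : WithBot σ) := fun j hj =>
    vars_max_eq (hvj j hj) (hgv j hj)
  refine ⟨⟨?_, ?_⟩, ?_⟩
  · intro f hf
    obtain ⟨j, hj, rfl⟩ := List.mem_map.1 hf
    exact ⟨j, hvj j (by simpa using hj)⟩
  · have hs : A.sort.Pairwise (· < ·) := A.sortedLT_sort.pairwise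
    have : (A.sort.map g).Pairwise fun a b => a.vars.max < b.vars.max := by
      rw [List.pairwise_map]
      apply List.Pairwise.imp_of_mem _ hs
      intro a b ha hb hab
      rw [hmax a (by simpa using ha), hmax b (by simpa using hb)]
      exact_mod_cast hab
    exact this.isChain
  · set G := A.sort.map g with hG
    have hGget : ∀ i : Fin G.length, ∃ j ∈ A, G.get i = g j := by
      intro i
      have : G.get i ∈ G := List.get_mem _ _
      obtain ⟨j, hj, hj'⟩ := List.mem_map.1 this
      exact ⟨j, by simpa using hj, hj'.symm⟩
    choose c hcA hc using hGget
    ext f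
    constructor
    · rintro ⟨c', α, q, hc', heq, -⟩
      have hcc : ∀ i, c' i = c i := by
        intro i
        have := hc' i
        rw [hc i, hmax _ (hcA i)] at this
        exact (WithBot.coe_injective this).symm
      have hmem : (∏ i, leadCoeff (c' i) (G.get i) ^ α i) * f ∈ P := by
        rw [heq, add_zero]
        apply P.sum_mem
        intro i _
        apply P.mul_mem_left
        rw [hc i]; exact hgP _ (hcA i)
      rcases hP.mem_or_mem hmem with h | h
      · exfalso
        rw [hP.prod_mem_iff] at h
        obtain ⟨i, _, hi⟩ := h
        have := hP.mem_of_pow_mem _ hi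
        rw [hcc i, hc i] at this
        exact hlc _ (hcA i) this
      · exact h
    · intro hf
      let M := Submonoid.closure (Set.range fun i => leadCoeff (c i) (G.get i))
      have hidx : ∀ j ∈ A, ∃ i, c i = j ∧ G.get i = g j := by
        intro j hj
        have : g j ∈ G := List.mem_map.2 ⟨j, by simpa using hj, rfl⟩
        obtain ⟨i, hi⟩ := List.mem_iff_get.1 this
        refine ⟨i, ?_, hi⟩
        have h3 := hmax _ (hcA i)
        rw [← hc i, hi, hmax j hj] at h3
        exact (WithBot.coe_injective h3).symm
      obtain ⟨m, hm, hmf⟩ := trep_reduction P A g hgP hgv hgd h1 h2 M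
        (by
          intro j hj
          obtain ⟨i, hi, hi'⟩ := hidx j hj
          apply Submonoid.subset_closure
          exact ⟨i, by simp only [hi, hi']⟩)
        (Ideal.span (Set.range G.get))
        (by
          intro j hj
          obtain ⟨i, hi, hi'⟩ := hidx j hj
          apply Ideal.subset_span
          exact ⟨i, hi'⟩) f hf
      obtain ⟨q, hq⟩ := Ideal.mem_span_range_iff_exists_fun.1 hmf
      obtain ⟨α, hα⟩ := Submonoid.exists_of_mem_closure_range _ _ hm
      refine ⟨c, α, q, ?_, ?_, ?_⟩
      · intro i; rw [hc i]; exact hmax _ (hcA i)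
      · rw [add_zero, hq, hα]
      · intro i
        rw [hc i, degreeOf_zero]
        exact hgd _ (hcA i)

end TrepSec

open MvPolynomial Matrix Pointwise

section TraceSec
variable {k : Type*} [Field k] {τ : Type*} {K L : Type*} [Field K] [Algebra (MvPolynomial τ k) K]
  [IsFractionRing (MvPolynomial τ k) K] [Field L] [Algebra K L] [FiniteDimensional K L]

lemma trace_bounded (θ : L) (F : MvPolynomial (Option τ) k) (hF : F ≠ 0)
    (t : ℕ) (ht : F.totalDegree ≤ t)
    (h0 : Polynomial.aeval θ ((optionEquivLeft k τ F).map (algebraMap (MvPolynomial τ k) K)) = 0) :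
    ∃ a b : MvPolynomial τ k, b ≠ 0 ∧ a.totalDegree ≤ t ∧ b.totalDegree ≤ t ∧
      algebraMap _ K b * Algebra.trace K L θ = algebraMap _ K a := by
  classical
  let _ : NormalizedGCDMonoid (MvPolynomial τ k) := Classical.choice inferInstance
  have hIntg : IsIntegral K θ := Algebra.IsIntegral.isIntegral θ
  set mp := minpoly K θ with hmp
  obtain ⟨b0, hb0, hN⟩ := IsLocalization.integerNormalization_spec
    (nonZeroDivisors (MvPolynomial τ k)) mp
  set N := IsLocalization.integerNormalization (nonZeroDivisors (MvPolynomial τ k)) mp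
  set q := N.primPart with hq
  have hinj : Function.Injective (algebraMap (MvPolynomial τ k) K) :=
    IsFractionRing.injective _ _
  have hb0' : algebraMap (MvPolynomial τ k) K b0 ≠ 0 := by
    rw [Ne, map_eq_zero_iff _ hinj]
    exact nonZeroDivisors.ne_zero hb0
  have hN' : N.map (algebraMap _ K) = Polynomial.C (algebraMap _ K b0) * mp := by
    rw [hN, ← Polynomial.smul_eq_C_mul, algebraMap_smul]
  have hmp0 : mp ≠ 0 := minpoly.ne_zero hIntg
  have hN0 : N ≠ 0 := by
    intro h
    rw [h, Polynomial.map_zero] at hN'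
    exact mul_ne_zero (Polynomial.C_ne_zero.2 hb0') hmp0 hN'.symm
  have hc0 : algebraMap (MvPolynomial τ k) K N.content ≠ 0 := by
    rw [Ne, map_eq_zero_iff _ hinj, Polynomial.content_eq_zero_iff]
    exact hN0
  obtain ⟨u, hu0, hu⟩ : ∃ u : K, u ≠ 0 ∧ q.map (algebraMap _ K) = Polynomial.C u * mp := by
    refine ⟨(algebraMap _ K N.content)⁻¹ * algebraMap _ K b0,
      mul_ne_zero (inv_ne_zero hc0) hb0', ?_⟩
    rw [Polynomial.C_mul, mul_assoc, ← hN']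
    have hNN : N.map (algebraMap _ K) =
        Polynomial.C (algebraMap (MvPolynomial τ k) K N.content) * q.map (algebraMap _ K) := by
      conv_lhs => rw [N.eq_C_content_mul_primPart]
      rw [Polynomial.map_mul, Polynomial.map_C]
    rw [hNN, ← mul_assoc, ← Polynomial.C_mul,
      inv_mul_cancel₀ hc0, Polynomial.C_1, one_mul]
  have hdvd : q ∣ optionEquivLeft k τ F := by
    apply (N.isPrimitive_primPart).dvd_of_fraction_map_dvd_fraction_map (K := K)
    rw [← hq, hu]
    have h1 : mp ∣ (optionEquivLeft k τ F).map (algebraMap (MvPolynomial τ k) K) :=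
      minpoly.dvd _ _ h0
    exact (Polynomial.isUnit_C.2 hu0.isUnit).mul_left_dvd.2 h1
  obtain ⟨r, hr⟩ := hdvd
  have hF' : F = (optionEquivLeft k τ).symm q * (optionEquivLeft k τ).symm r := by
    rw [← map_mul, ← hr, AlgEquiv.symm_apply_apply]
  have hdeg : ((optionEquivLeft k τ).symm q).totalDegree ≤ t := by
    rw [hF'] at hF ht
    rw [totalDegree_mul_of_isDomain (left_ne_zero_of_mul hF) (right_ne_zero_of_mul hF)] at ht
    omega
  have hcd : ∀ i, (q.coeff i).totalDegree ≤ t := by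
    intro i
    have := totalDegree_coeff_optionEquivLeft_le k τ ((optionEquivLeft k τ).symm q) i
    rw [AlgEquiv.apply_symm_apply] at this
    exact this.trans hdeg
  have hcoeff : ∀ i, algebraMap _ K (q.coeff i) = u * mp.coeff i := by
    intro i
    rw [← Polynomial.coeff_map, hu, Polynomial.coeff_C_mul]
  have hpos := minpoly.natDegree_pos hIntg
  refine ⟨-(C (Module.finrank (IntermediateField.adjoin K {θ}) L : k) *
    q.coeff (mp.natDegree - 1)), q.coeff mp.natDegree, ?_, ?_, hcd _, ?_⟩
  · intro h
    have := hcoeff mp.natDegree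
    rw [h, map_zero, Polynomial.coeff_natDegree, (minpoly.monic hIntg).leadingCoeff] at this
    simp at this
    exact hu0 this.symm
  · rw [totalDegree_neg]
    refine (totalDegree_mul _ _).trans ?_
    rw [totalDegree_C, zero_add]
    exact hcd _
  · rw [trace_eq_finrank_mul_minpoly_nextCoeff, hcoeff, Polynomial.coeff_natDegree,
      (minpoly.monic hIntg).leadingCoeff, map_neg, map_mul, hcoeff,
      Polynomial.nextCoeff_of_natDegree_pos hpos]
    simp only [map_natCast]
    ring

lemma totalDegree_det_le {ι : Type*} [Fintype ι] [DecidableEq ι]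
    (Q : Matrix ι ι (MvPolynomial τ k)) (t : ℕ) (h : ∀ i j, (Q i j).totalDegree ≤ t) :
    Q.det.totalDegree ≤ Fintype.card ι * t := by
  rw [Matrix.det_apply]
  apply totalDegree_finsetSum_le
  intro s _
  refine (totalDegree_smul_le _ _).trans ?_
  refine (totalDegree_finsetProd _ _).trans ?_
  refine (Finset.sum_le_sum (fun i _ => h (s i) i)).trans ?_
  simp

lemma cramer_bounded [CharZero K] {ι : Type*} [Fintype ι] (b : Module.Basis ι K L) (x : L) (t : ℕ)
    (h1 : ∀ i j, ∃ a b' : MvPolynomial τ k, b' ≠ 0 ∧ a.totalDegree ≤ t ∧ b'.totalDegree ≤ t ∧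
      algebraMap _ K b' * Algebra.trace K L (b i * b j) = algebraMap _ K a)
    (h2 : ∀ i, ∃ a b' : MvPolynomial τ k, b' ≠ 0 ∧ a.totalDegree ≤ t ∧ b'.totalDegree ≤ t ∧
      algebraMap _ K b' * Algebra.trace K L (b i * x) = algebraMap _ K a) :
    ∃ (D : MvPolynomial τ k) (c : ι → MvPolynomial τ k), D ≠ 0 ∧
      D.totalDegree ≤ Fintype.card ι * ((Fintype.card ι ^ 2 + Fintype.card ι + 1) * t) ∧
      (∀ i, (c i).totalDegree ≤ Fintype.card ι * ((Fintype.card ι ^ 2 + Fintype.card ι + 1) * t)) ∧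
      ∀ i, algebraMap _ K D * b.repr x i = algebraMap _ K (c i) := by
  classical
  choose a d hd0 ha hd had using h1
  choose a' d' hd0' ha' hd' had' using h2
  set E : MvPolynomial τ k := (∏ i, ∏ j, d i j) * ∏ i, d' i with hE
  set m := Fintype.card ι
  have hinj : Function.Injective (algebraMap (MvPolynomial τ k) K) :=
    IsFractionRing.injective _ _
  have hE0 : E ≠ 0 := by
    apply mul_ne_zero
    · exact Finset.prod_ne_zero_iff.2 fun i _ => Finset.prod_ne_zero_iff.2 fun j _ => hd0 i j
    · exact Finset.prod_ne_zero_iff.2 fun i _ => hd0' i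
  have hEd : E.totalDegree ≤ (m ^ 2 + m) * t := by
    refine (totalDegree_mul _ _).trans ?_
    have e1 : (∏ i, ∏ j, d i j).totalDegree ≤ m ^ 2 * t := by
      refine (totalDegree_finsetProd _ _).trans ?_
      refine (Finset.sum_le_sum (g := fun _ => m * t) (fun i _ => ?_)).trans ?_
      · refine (totalDegree_finsetProd _ _).trans ?_
        refine (Finset.sum_le_sum (fun j _ => hd i j)).trans ?_
        simp [m]
      · simp [m, pow_two, mul_assoc]
    have e2 : (∏ i, d' i).totalDegree ≤ m * t := by
      refine (totalDegree_finsetProd _ _).trans ?_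
      refine (Finset.sum_le_sum (fun j _ => hd' j)).trans ?_
      simp [m]
    rw [add_mul]; omega
  have clear : ∀ (a b : MvPolynomial τ k) (z : K), a.totalDegree ≤ t → b ∣ E →
      algebraMap _ K b * z = algebraMap _ K a →
      ∃ e : MvPolynomial τ k, e.totalDegree ≤ (m ^ 2 + m + 1) * t ∧
        algebraMap _ K E * z = algebraMap _ K e := by
    rintro a b z hat ⟨w, hw⟩ hz
    refine ⟨w * a, ?_, ?_⟩
    · refine (totalDegree_mul _ _).trans ?_
      have : w.totalDegree ≤ E.totalDegree := by
        rw [hw] at hE0 ⊢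
        rw [totalDegree_mul_of_isDomain (left_ne_zero_of_mul hE0) (right_ne_zero_of_mul hE0)]
        omega
      rw [add_mul, one_mul]
      omega
    · rw [hw, map_mul, map_mul, mul_right_comm, mul_assoc, ← hz]; ring
  have c1 : ∀ i j, ∃ e : MvPolynomial τ k, e.totalDegree ≤ (m ^ 2 + m + 1) * t ∧
        algebraMap _ K E * Algebra.trace K L (b i * b j) = algebraMap _ K e := by
    intro i j
    refine clear _ _ _ (ha i j) ?_ (had i j)
    apply Dvd.dvd.mul_right
    exact (Finset.dvd_prod_of_mem (fun j => d i j) (Finset.mem_univ j)).trans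
      (Finset.dvd_prod_of_mem (fun i => ∏ j, d i j) (Finset.mem_univ i))
  have c2 : ∀ i, ∃ e : MvPolynomial τ k, e.totalDegree ≤ (m ^ 2 + m + 1) * t ∧
        algebraMap _ K E * Algebra.trace K L (b i * x) = algebraMap _ K e := by
    intro i
    refine clear _ _ _ (ha' i) ?_ (had' i)
    apply Dvd.dvd.mul_left
    exact Finset.dvd_prod_of_mem (fun j => d' j) (Finset.mem_univ i)
  choose Q hQ hQe using c1
  choose v hv hve using c2
  let QM : Matrix ι ι (MvPolynomial τ k) := Matrix.of Q
  have hmapQ : QM.map (algebraMap _ K) = algebraMap _ K E • Algebra.traceMatrix K b := by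
    ext i j
    simp [QM, Algebra.traceMatrix_apply, Algebra.traceForm_apply, hQe]
  have hdetne : (QM.map (algebraMap _ K)).det ≠ 0 := by
    rw [hmapQ, Matrix.det_smul]
    apply mul_ne_zero
    · apply pow_ne_zero
      rwa [Ne, map_eq_zero_iff _ hinj]
    · have h9 := Algebra.discr_not_zero_of_basis K b
      rwa [Algebra.discr_def] at h9
  have hmv : (QM.map (algebraMap _ K)) *ᵥ (b.repr x) = fun i => algebraMap _ K (v i) := by
    ext i
    rw [← hve, hmapQ, Matrix.smul_mulVec, Pi.smul_apply, smul_eq_mul]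
    congr 1
    conv_rhs => rw [← b.sum_repr x]
    simp only [Matrix.mulVec, dotProduct, Algebra.traceMatrix_apply, Algebra.traceForm_apply]
    rw [Finset.mul_sum, map_sum]
    apply Finset.sum_congr rfl
    intro j _
    rw [mul_smul_comm, map_smul, smul_eq_mul, mul_comm]
  refine ⟨QM.det, QM.cramer v, ?_, ?_, ?_, ?_⟩
  · intro h
    apply hdetne
    rw [← RingHom.mapMatrix_apply, ← RingHom.map_det, h, map_zero]
  · exact totalDegree_det_le _ _ (fun i j => hQ i j)
  · intro i
    rw [Matrix.cramer_apply]
    apply totalDegree_det_le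
    intro i' j'
    rw [Matrix.updateCol_apply]
    split_ifs
    · exact hv _
    · exact hQ _ _
  · intro i
    have h3 := Matrix.mulVec_cramer (QM.map (algebraMap _ K)) (fun i => algebraMap _ K (v i))
    have h4 : (QM.map (algebraMap _ K)) *ᵥ ((QM.map (algebraMap _ K)).det • ⇑(b.repr x)) =
        (QM.map (algebraMap _ K)) *ᵥ
          ((QM.map (algebraMap _ K)).cramer (fun i => algebraMap _ K (v i))) := by
      rw [h3, Matrix.mulVec_smul, hmv]
    have hunit : IsUnit (QM.map (algebraMap (MvPolynomial τ k) K)) := by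
      rw [Matrix.isUnit_iff_isUnit_det]; exact hdetne.isUnit
    have h5 := congrFun (Matrix.mulVec_injective_of_isUnit hunit h4) i
    rw [Pi.smul_apply, smul_eq_mul] at h5
    rw [RingHom.map_det, RingHom.mapMatrix_apply, h5, Matrix.cramer_apply, Matrix.cramer_apply,
      RingHom.map_det, RingHom.mapMatrix_apply]
    congr 1
    ext i' j'
    simp only [Matrix.updateCol_apply, Matrix.map_apply]
    split_ifs <;> rfl

end TraceSec

open MvPolynomial Matrix Pointwise

section ElimSec
variable {k : Type*} [Field k] {σ : Type*} [LinearOrder σ]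

/-- the variables that are free modulo `P` -/
def freeVars (P : Ideal (MvPolynomial σ k)) : Set σ :=
  {j | ∀ f ∈ P, (∀ i ∈ f.vars, i ≤ j) → ∀ d, (psi j f).coeff d ∈ P}

lemma freeVars_inj (P : Ideal (MvPolynomial σ k)) [hP : P.IsPrime] :
    ∀ (n : ℕ) (f : MvPolynomial σ k), f.vars.card ≤ n → f ∈ P → (∀ i ∈ f.vars, i ∈ freeVars P) →
      f = 0 := by
  intro n
  induction n with
  | zero =>
    intro f hf hfP _
    have : f.vars = ∅ := by simpa using hf
    obtain ⟨a, rfl⟩ : ∃ a, f = C a := by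
      have := (mem_supported (R := k) (s := (∅ : Set σ)) (p := f)).2 (by rw [this]; simp)
      rw [supported_empty, Algebra.mem_bot] at this
      obtain ⟨a, ha⟩ := this
      exact ⟨a, ha.symm⟩
    by_contra h
    have ha : a ≠ 0 := fun h' => h (by simp [h'])
    apply hP.ne_top
    rw [Ideal.eq_top_iff_one]
    have := P.mul_mem_left (C a⁻¹) hfP
    rwa [← C_mul, inv_mul_cancel₀ ha, C_1] at this
  | succ n ih =>
    intro f hf hfP hfv
    by_cases he : f.vars = ∅
    · exact ih f (by simp [he]) hfP hfv
    obtain ⟨i, hi, hmax⟩ := f.vars.exists_max_image id (Finset.nonempty_iff_ne_empty.2 he)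
    have h1 := hfv i hi f hfP hmax
    apply psi_injective i
    rw [map_zero]
    ext1 d
    rw [Polynomial.coeff_zero]
    apply ih _ _ (h1 d)
    · intro l hl
      exact hfv l (psi_coeff_vars hl).2
    · have : ((psi i f).coeff d).vars ⊆ f.vars.erase i := by
        intro l hl
        rw [Finset.mem_erase]
        exact psi_coeff_vars hl
      have h2 := Finset.card_le_card this
      rw [Finset.card_erase_of_mem hi] at h2
      omega

lemma freeVars_eq_zero (P : Ideal (MvPolynomial σ k)) [hP : P.IsPrime] {f : MvPolynomial σ k}
    (hf : f ∈ P) (h : ∀ i ∈ f.vars, i ∈ freeVars P) : f = 0 :=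
  freeVars_inj P _ f le_rfl hf h

lemma mem_support_psi_coeff {c : σ} {f : MvPolynomial σ k} {d : ℕ} {m : σ →₀ ℕ}
    (hm : m ∈ ((psi c f).coeff d).support) : m c = 0 ∧ m + Finsupp.single c d ∈ f.support := by
  have h0 : m c = 0 := by
    by_contra h
    have : c ∈ ((psi c f).coeff d).vars := by
      rw [mem_vars_iff_mem_support]
      exact ⟨m, hm, by simpa using h⟩
    exact (psi_coeff_vars this).1 rfl
  refine ⟨h0, ?_⟩
  rw [mem_support_iff, coeff_psi_coeff c f d m h0] at hm
  rwa [mem_support_iff]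

lemma psi_coeff_totalDegree (c : σ) (f : MvPolynomial σ k) (d : ℕ) :
    ((psi c f).coeff d).totalDegree ≤ f.totalDegree := by
  apply Finset.sup_le
  intro m hm
  have := le_totalDegree (mem_support_psi_coeff hm).2
  refine le_trans ?_ this
  rw [Finsupp.sum_add_index' (by simp) (by simp)]
  exact Nat.le_add_right _ _

lemma elim_vars (P : Ideal (MvPolynomial σ k)) (j : σ) (δ : ℕ) :
    ∀ (n : ℕ) (G : MvPolynomial σ k), (G.vars.filter (fun i => j < i)).card ≤ n → G ∈ P →
      (∀ i ∈ G.vars, j < i → i ∈ freeVars P) →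
      (∀ m ∈ G.support, m j ≤ δ ∧ (m j = δ → ∀ i, m i ≠ 0 → i = j ∨ i ∈ freeVars P)) →
      (∃ M ∈ G.support, M j = δ) →
      ∃ G' ∈ P, (∀ i ∈ G'.vars, i ≤ j) ∧ G'.totalDegree ≤ G.totalDegree ∧
        (∀ m ∈ G'.support, m j ≤ δ ∧ (m j = δ → ∀ i, m i ≠ 0 → i = j ∨ i ∈ freeVars P)) ∧
        (∃ M ∈ G'.support, M j = δ) := by
  intro n
  induction n with
  | zero =>
    intro G hc hG hv h hM
    refine ⟨G, hG, ?_, le_rfl, h, hM⟩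
    intro i hi
    by_contra hij
    have : i ∈ (G.vars.filter (fun i => j < i)) := by
      rw [Finset.mem_filter]; exact ⟨hi, not_le.1 hij⟩
    rw [Nat.le_zero, Finset.card_eq_zero] at hc
    simp [hc] at this
  | succ n ih =>
    intro G hc hG hv h hM
    by_cases he : (G.vars.filter (fun i => j < i)) = ∅
    · exact ih G (by simp [he]) hG hv h hM
    obtain ⟨i, hi, hmax⟩ := (G.vars.filter (fun i => j < i)).exists_max_image id
      (Finset.nonempty_iff_ne_empty.2 he)
    have hi' := Finset.mem_filter.1 hi
    have hmax' : ∀ l ∈ G.vars, l ≤ i := by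
      intro l hl
      by_cases hjl : j < l
      · exact hmax l (Finset.mem_filter.2 ⟨hl, hjl⟩)
      · exact (not_lt.1 hjl).trans hi'.2.le
    obtain ⟨M, hM, hMj⟩ := hM
    have h1 := hv i hi'.1 hi'.2 G hG hmax' (M i)
    have hij : i ≠ j := hi'.2.ne'
    have b1 : (((psi i G).coeff (M i)).vars.filter (fun i => j < i)).card ≤ n := by
      have : ((psi i G).coeff (M i)).vars.filter (fun i => j < i) ⊆
          (G.vars.filter (fun i => j < i)).erase i := by
        intro l hl
        rw [Finset.mem_filter] at hl
        rw [Finset.mem_erase, Finset.mem_filter]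
        exact ⟨(psi_coeff_vars hl.1).1, (psi_coeff_vars hl.1).2, hl.2⟩
      have h2 := Finset.card_le_card this
      rw [Finset.card_erase_of_mem hi] at h2
      omega
    have b2 : ∀ l ∈ ((psi i G).coeff (M i)).vars, j < l → l ∈ freeVars P := by
      intro l hl
      exact hv l (psi_coeff_vars hl).2
    have b3 : ∀ m ∈ ((psi i G).coeff (M i)).support, m j ≤ δ ∧
        (m j = δ → ∀ i, m i ≠ 0 → i = j ∨ i ∈ freeVars P) := by
      intro m hm
      obtain ⟨e1, e2⟩ := mem_support_psi_coeff hm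
      have e3 := h _ e2
      have e4 : (m + Finsupp.single i (M i)) j = m j := by simp [hij]
      rw [e4] at e3
      refine ⟨e3.1, fun hmj l hl => e3.2 hmj l ?_⟩
      rw [Finsupp.add_apply]
      omega
    have b4 : ∃ M' ∈ ((psi i G).coeff (M i)).support, M' j = δ := by
      refine ⟨M.erase i, ?_, ?_⟩
      · rw [mem_support_iff, coeff_psi_coeff i G _ _ (by simp), Finsupp.erase_add_single]
        exact mem_support_iff.1 hM
      · rw [Finsupp.erase_ne hij.symm, hMj]
    obtain ⟨G', hG', a1, a2, a3, a4⟩ := ih _ b1 h1 b2 b3 b4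
    exact ⟨G', hG', a1, a2.trans (psi_coeff_totalDegree _ _ _), a3, a4⟩

/-- final form of one element of the triangular set -/
lemma elim_final (P : Ideal (MvPolynomial σ k)) [hP : P.IsPrime] (j : σ) (δ : ℕ)
    (G : MvPolynomial σ k) (hG : G ∈ P)
    (h0 : ∀ i ∈ G.vars, j < i → i ∈ freeVars P)
    (h : ∀ m ∈ G.support, m j ≤ δ ∧ (m j = δ → ∀ i, m i ≠ 0 → i = j ∨ i ∈ freeVars P))
    (hM : ∃ M ∈ G.support, M j = δ) :
    ∃ g ∈ P, (∀ i ∈ g.vars, i ≤ j) ∧ g.totalDegree ≤ G.totalDegree ∧ g.degreeOf j = δ ∧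
      leadCoeff j g ∉ P := by
  obtain ⟨g, hg, a1, a2, a3, M, hM, hMj⟩ := elim_vars P j δ _ G le_rfl hG h0 h hM
  have hdeg : g.degreeOf j = δ := by
    apply le_antisymm
    · rw [degreeOf_le_iff]
      exact fun m hm => (a3 m hm).1
    · rw [← hMj]
      exact monomial_le_degreeOf j hM
  refine ⟨g, hg, a1, a2, hdeg, ?_⟩
  intro hl
  rw [leadCoeff_eq_psi, hdeg] at hl
  have := freeVars_eq_zero P hl ?_
  · have h2 : coeff (M.erase j) ((psi j g).coeff δ) = coeff M g := by
      rw [coeff_psi_coeff j g _ _ (by simp), ← hMj, Finsupp.erase_add_single]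
    rw [this, coeff_zero] at h2
    exact mem_support_iff.1 hM h2.symm
  · intro i hi
    have hij := (psi_coeff_vars hi).1
    rw [mem_vars_iff_mem_support] at hi
    obtain ⟨m, hm, hmi⟩ := hi
    obtain ⟨e1, e2⟩ := mem_support_psi_coeff hm
    have := (a3 _ e2).2 (by simp [e1]) i (by
      rw [Finsupp.add_apply]; have := Finsupp.mem_support_iff.1 hmi; omega)
    exact this.resolve_left hij

end ElimSec

open MvPolynomial Matrix Pointwise
set_option linter.unusedSectionVars false
set_option linter.deprecated false

section SpanSec
variable {σ : Type*} [LinearOrder σ] {K L : Type*} [Field K] [Field L] [Algebra K L]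
  (ξ : σ → L)

noncomputable def mon (m : σ →₀ ℕ) : L := m.prod fun i e => ξ i ^ e

lemma mon_zero : mon ξ 0 = 1 := by simp [mon]

lemma mon_add (m m' : σ →₀ ℕ) : mon ξ (m + m') = mon ξ m * mon ξ m' := by
  unfold mon
  rw [Finsupp.prod_add_index'] <;> simp [pow_add]

lemma mon_single (i : σ) (e : ℕ) : mon ξ (Finsupp.single i e) = ξ i ^ e := by
  simp [mon]

def monSet (b : σ → ℕ) : Set L := {x | ∃ m : σ →₀ ℕ, (∀ i, m i < b i) ∧ x = mon ξ m}

lemma monSet_mono {b b' : σ → ℕ} (h : ∀ i, b i ≤ b' i) : monSet ξ b ⊆ monSet ξ b' := by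
  rintro x ⟨m, hm, rfl⟩
  exact ⟨m, fun i => (hm i).trans_le (h i), rfl⟩

lemma monSet_finite [Fintype σ] (b : σ → ℕ) : (monSet ξ b).Finite := by
  have : monSet ξ b ⊆ Set.range (fun m : (∀ i, Fin (b i)) =>
      mon ξ (Finsupp.equivFunOnFinite.symm fun i => (m i : ℕ))) := by
    rintro x ⟨m, hm, rfl⟩
    refine ⟨fun i => ⟨m i, hm i⟩, ?_⟩
    simp only
    congr 1
    ext i
    simp
  exact (Set.finite_range _).subset this

lemma monSet_ncard [Fintype σ] (t : ℕ) :
    (monSet ξ (fun _ => t)).ncard ≤ t ^ Fintype.card σ := by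
  have : monSet ξ (fun _ => t) ⊆ Set.range (fun m : (σ → Fin t) =>
      mon ξ (Finsupp.equivFunOnFinite.symm fun i => (m i : ℕ))) := by
    rintro x ⟨m, hm, rfl⟩
    refine ⟨fun i => ⟨m i, hm i⟩, ?_⟩
    simp only
    congr 1
    ext i
    simp
  refine (Set.ncard_le_ncard this (Set.finite_range _)).trans ?_
  rw [← Set.image_univ]
  refine (Set.ncard_image_le Set.finite_univ).trans ?_
  rw [Set.ncard_univ, Nat.card_eq_fintype_card, Fintype.card_fun, Fintype.card_fin]

lemma pow_mem_span_of_minpoly {x : L} (hx : IsIntegral K x) {t : ℕ}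
    (ht : (minpoly K x).natDegree ≤ t) :
    x ^ t ∈ Submodule.span K {y | ∃ e < t, y = x ^ e} := by
  set p := minpoly K x * Polynomial.X ^ (t - (minpoly K x).natDegree) with hp
  have hm : p.Monic := (minpoly.monic hx).mul (Polynomial.monic_X_pow _)
  have hd : p.natDegree = t := by
    rw [hp, (minpoly.monic hx).natDegree_mul (Polynomial.monic_X_pow _), Polynomial.natDegree_X_pow]
    omega
  have h0 : Polynomial.aeval x p = 0 := by rw [hp, map_mul, minpoly.aeval, zero_mul]
  have h1 := hm.as_sum
  rw [h1, hd, map_add, map_pow, Polynomial.aeval_X, map_sum] at h0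
  rw [eq_neg_of_add_eq_zero_left h0]
  apply Submodule.neg_mem
  apply Submodule.sum_mem
  intro i hi
  rw [map_mul, Polynomial.aeval_C, map_pow, Polynomial.aeval_X, ← Algebra.smul_def]
  apply Submodule.smul_mem
  exact Submodule.subset_span ⟨i, Finset.mem_range.1 hi, rfl⟩

lemma mul_mem_span_monSet {b : σ → ℕ} {i : σ} (hi : IsIntegral K (ξ i))
    (hb : (minpoly K (ξ i)).natDegree ≤ b i) {x : L} (hx : x ∈ Submodule.span K (monSet ξ b)) :
    ξ i * x ∈ Submodule.span K (monSet ξ b) := by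
  induction hx using Submodule.span_induction with
  | zero => simp
  | add x y _ _ h1 h2 => rw [mul_add]; exact Submodule.add_mem _ h1 h2
  | smul a x _ h => rw [mul_smul_comm]; exact Submodule.smul_mem _ _ h
  | mem x hx =>
    obtain ⟨m, hm, rfl⟩ := hx
    have key : ∀ e, ξ i ^ e * mon ξ (m.erase i) = mon ξ (m.erase i + Finsupp.single i e) := by
      intro e
      rw [mon_add, mon_single, mul_comm]
    have key2 : ∀ e, e < b i → ξ i ^ e * mon ξ (m.erase i) ∈ Submodule.span K (monSet ξ b) := by
      intro e he
      rw [key]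
      apply Submodule.subset_span
      refine ⟨_, fun l => ?_, rfl⟩
      by_cases h : l = i
      · subst h; simpa using he
      · simpa [Finsupp.single_apply, Finsupp.erase_ne h, Ne.symm h] using hm l
    have e1 : ξ i * mon ξ m = ξ i ^ (m i + 1) * mon ξ (m.erase i) := by
      rw [pow_succ', mul_assoc, key, Finsupp.erase_add_single]
    rw [e1]
    by_cases h : m i + 1 < b i
    · exact key2 _ h
    · have hbi : m i + 1 = b i := by have := hm i; omega
      rw [hbi]
      have h3 := pow_mem_span_of_minpoly hi hb
      have h4 : ∀ y ∈ Submodule.span K {y | ∃ e < b i, y = ξ i ^ e},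
          y * mon ξ (m.erase i) ∈ Submodule.span K (monSet ξ b) := by
        intro y hy
        induction hy using Submodule.span_induction with
        | zero => simp
        | add x y _ _ h1 h2 => rw [add_mul]; exact Submodule.add_mem _ h1 h2
        | smul a x _ h => rw [smul_mul_assoc]; exact Submodule.smul_mem _ _ h
        | mem y hy => obtain ⟨e, he, rfl⟩ := hy; exact key2 e he
      exact h4 _ h3

lemma adjoin_le_span_monSet {b : σ → ℕ} {s : Set σ} (hi : ∀ i ∈ s, IsIntegral K (ξ i))
    (hb : ∀ i ∈ s, (minpoly K (ξ i)).natDegree ≤ b i) (hb1 : ∀ i, 0 < b i) :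
    Subalgebra.toSubmodule (Algebra.adjoin K (ξ '' s)) ≤ Submodule.span K (monSet ξ b) := by
  intro x hx
  have h : ∀ y ∈ Submodule.span K (monSet ξ b), x * y ∈ Submodule.span K (monSet ξ b) := by
    rw [Subalgebra.mem_toSubmodule] at hx
    induction hx using Algebra.adjoin_induction with
    | mem x hx =>
      obtain ⟨i, his, rfl⟩ := hx
      intro y hy
      exact mul_mem_span_monSet ξ (hi i his) (hb i his) hy
    | algebraMap r =>
      intro y hy
      rw [← Algebra.smul_def]; exact Submodule.smul_mem _ _ hy
    | add x y _ _ h1 h2 =>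
      intro z hz
      rw [add_mul]; exact Submodule.add_mem _ (h1 z hz) (h2 z hz)
    | mul x y _ _ h1 h2 =>
      intro z hz
      rw [mul_assoc]; exact h1 _ (h2 z hz)
  have := h 1 (Submodule.subset_span ⟨0, fun i => hb1 i, (mon_zero ξ).symm⟩)
  rwa [mul_one] at this

/-- the exponent bounds -/
def bd (j : σ) (t d : ℕ) (i : σ) : ℕ := if i < j then t else if i = j then d else 1

lemma pow_mul_mem_span_bd {j : σ} {t d e : ℕ} (he : e < d) {x : L}
    (hx : x ∈ Submodule.span K (monSet ξ (bd j t 1))) :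
    x * ξ j ^ e ∈ Submodule.span K (monSet ξ (bd j t d)) := by
  induction hx using Submodule.span_induction with
  | zero => simp
  | add x y _ _ h1 h2 => rw [add_mul]; exact Submodule.add_mem _ h1 h2
  | smul a x _ h => rw [smul_mul_assoc]; exact Submodule.smul_mem _ _ h
  | mem y hy =>
    obtain ⟨m, hm, rfl⟩ := hy
    rw [← mon_single, ← mon_add]
    apply Submodule.subset_span
    refine ⟨_, fun l => ?_, rfl⟩
    have := hm l
    unfold bd at this ⊢
    rcases lt_trichotomy l j with h | h | h
    · simpa [h, h.ne', Finsupp.single_apply] using this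
    · subst h; simp at this; simp [this]; exact he
    · simpa [h.not_gt, h.ne, h.ne', Finsupp.single_apply] using this

lemma exists_delta (j : σ) (t : ℕ) (ht0 : 0 < t) (hi : ∀ i, IsIntegral K (ξ i))
    (ht : ∀ i, (minpoly K (ξ i)).natDegree ≤ t) :
    ∃ δ, 0 < δ ∧ δ ≤ t ∧ ξ j ^ δ ∈ Submodule.span K (monSet ξ (bd j t δ)) ∧
      ∀ d < δ, ξ j ^ d ∉ Submodule.span K (monSet ξ (bd j t d)) := by
  classical
  have hex : ∃ d, ξ j ^ d ∈ Submodule.span K (monSet ξ (bd j t d)) := by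
    refine ⟨t, ?_⟩
    apply adjoin_le_span_monSet (s := {j}) (b := bd j t t) ξ (fun i _ => hi i)
    · intro i h
      rw [Set.mem_singleton_iff] at h
      subst h
      simpa [bd] using ht i
    · intro i
      unfold bd; split_ifs <;> omega
    · exact Subalgebra.pow_mem _ (Algebra.subset_adjoin (by simp)) _
  have htm : ξ j ^ t ∈ Submodule.span K (monSet ξ (bd j t t)) := by
    apply adjoin_le_span_monSet (s := {j}) (b := bd j t t) ξ (fun i _ => hi i)
    · intro i h
      rw [Set.mem_singleton_iff] at h
      subst h
      simpa [bd] using ht i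
    · intro i
      unfold bd; split_ifs <;> omega
    · exact Subalgebra.pow_mem _ (Algebra.subset_adjoin (by simp)) _
  refine ⟨Nat.find hex, ?_, Nat.find_min' hex htm, Nat.find_spec hex, fun d hd => Nat.find_min hex hd⟩
  rw [Nat.pos_iff_ne_zero]
  intro h
  have h1 := Nat.find_spec hex
  rw [h] at h1
  have : monSet ξ (bd j t 0) = ∅ := by
    ext x
    simp only [Set.mem_empty_iff_false, iff_false]
    rintro ⟨m, hm, -⟩
    have := hm j
    simp [bd] at this
  rw [this] at h1
  simp at h1

end SpanSec

section MinSec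
variable {k : Type*} [Field k] {σ : Type*} [LinearOrder σ] {K L : Type*} [Field K] [Field L]
  [Algebra K L] [Algebra k K] [Algebra k L] [IsScalarTower k K L]
  (ξ : σ → L)

lemma aeval_mem_adjoin {s : Set σ} {f : MvPolynomial σ k} (hf : ∀ i ∈ f.vars, i ∈ s) :
    aeval ξ f ∈ Algebra.adjoin K (ξ '' s) := by
  rw [f.as_sum, map_sum]
  apply Subalgebra.sum_mem
  intro m hm
  rw [aeval_monomial, IsScalarTower.algebraMap_apply k K L]
  apply Subalgebra.mul_mem _ (Subalgebra.algebraMap_mem _ _)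
  apply Subalgebra.prod_mem
  intro i hi
  apply Subalgebra.pow_mem
  apply Algebra.subset_adjoin
  refine ⟨i, hf i ?_, rfl⟩
  rw [mem_vars_iff_mem_support]
  exact ⟨m, hm, hi⟩

lemma min_h1 (j : σ) (t : ℕ) (ht0 : 0 < t) (hi : ∀ i, IsIntegral K (ξ i))
    (ht : ∀ i, (minpoly K (ξ i)).natDegree ≤ t) (δ : ℕ)
    (hδ : ∀ d < δ, ξ j ^ d ∉ Submodule.span K (monSet ξ (bd j t d)))
    (f : MvPolynomial σ k) (hf : aeval ξ f = 0) (hv : ∀ i ∈ f.vars, i ≤ j)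
    (hd : f.degreeOf j < δ) (d : ℕ) : aeval ξ ((psi j f).coeff d) = 0 := by
  set g : Polynomial L := (psi j f).map (aeval ξ : MvPolynomial σ k →ₐ[k] L).toRingHom with hg
  have hgc : ∀ d, g.coeff d = aeval ξ ((psi j f).coeff d) := by
    intro d; rw [hg, Polynomial.coeff_map]; rfl
  rw [← hgc]
  suffices g = 0 by rw [this, Polynomial.coeff_zero]
  by_contra hg0
  have hgd : g.natDegree < δ := by
    refine lt_of_le_of_lt (Polynomial.natDegree_map_le) ?_
    rwa [natDegree_psi]
  have hev : g.eval (ξ j) = 0 := by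
    have h1 : ξ j = (aeval ξ : MvPolynomial σ k →ₐ[k] L).toRingHom (X j) := by simp
    rw [hg, Polynomial.eval_map]
    conv_lhs => rw [h1]
    rw [Polynomial.eval₂_at_apply, psi_eval]
    exact hf
  have hmem : ∀ d, g.coeff d ∈ Algebra.adjoin K (ξ '' Set.Iio j) := by
    intro d
    rw [hgc]
    apply aeval_mem_adjoin
    intro i hi
    exact lt_of_le_of_ne (hv i (psi_coeff_vars hi).2) (psi_coeff_vars hi).1
  have hlc : g.leadingCoeff ≠ 0 := Polynomial.leadingCoeff_ne_zero.2 hg0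
  have hIntg : ∀ x ∈ Algebra.adjoin K (ξ '' Set.Iio j), IsIntegral K x := by
    intro x hx
    have h1 : Algebra.adjoin K (ξ '' Set.Iio j) ≤ integralClosure K L := by
      rw [Algebra.adjoin_le_iff]
      rintro _ ⟨i, -, rfl⟩
      exact hi i
    exact h1 hx
  have hinv : (g.leadingCoeff)⁻¹ ∈ Algebra.adjoin K (ξ '' Set.Iio j) :=
    Subalgebra.inv_mem_of_algebraic (Algebra.adjoin K (ξ '' Set.Iio j)) (x := ⟨g.leadingCoeff, hmem _⟩)
      ((hIntg _ (hmem _)).isAlgebraic)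
  have hmem2 : ∀ d, (g.leadingCoeff)⁻¹ * g.coeff d ∈ Submodule.span K (monSet ξ (bd j t 1)) := by
    intro d
    apply adjoin_le_span_monSet (s := Set.Iio j) ξ (fun i _ => hi i)
    · intro i h
      simpa [bd, Set.mem_Iio.1 h] using ht i
    · intro i
      unfold bd; split_ifs <;> omega
    · exact Subalgebra.mul_mem _ hinv (hmem d)
  apply hδ _ hgd
  rw [Polynomial.eval_eq_sum_range, Finset.sum_range_succ] at hev
  have h2 : ξ j ^ g.natDegree = - ∑ x ∈ Finset.range g.natDegree,
      ((g.leadingCoeff)⁻¹ * g.coeff x) * ξ j ^ x := by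
    have h3 : g.leadingCoeff * ξ j ^ g.natDegree = - ∑ x ∈ Finset.range g.natDegree,
      (g.coeff x) * ξ j ^ x := by rw [Polynomial.leadingCoeff]; linear_combination hev
    have h4 : ξ j ^ g.natDegree = (g.leadingCoeff)⁻¹ * (g.leadingCoeff * ξ j ^ g.natDegree) := by
      rw [inv_mul_cancel_left₀ hlc]
    rw [h4, h3, mul_neg, Finset.mul_sum]
    simp only [mul_assoc]
  rw [h2]
  apply Submodule.neg_mem
  apply Submodule.sum_mem
  intro x hx
  exact pow_mul_mem_span_bd ξ (Finset.mem_range.1 hx) (hmem2 x)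

end MinSec

open MvPolynomial Matrix Pointwise
set_option linter.unusedSectionVars false
set_option linter.deprecated false

section ExSec
variable {k : Type*} [Field k] {σ : Type*} [LinearOrder σ] [Fintype σ]

lemma mem_support_mul_monomial {σ : Type*} {p : MvPolynomial σ k} {s m : σ →₀ ℕ}
    (hm : m ∈ (p * monomial s 1).support) : ∃ m0 ∈ p.support, m = m0 + s := by
  classical
  rw [mem_support_iff, coeff_mul_monomial'] at hm
  split_ifs at hm with h
  · refine ⟨m - s, ?_, (tsub_add_cancel_of_le h).symm⟩
    rw [mem_support_iff]
    simpa using hm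
  · exact absurd rfl hm

lemma aeval_monomial_one {L : Type*} [Field L] [Algebra k L] (ξ : σ → L) (m : σ →₀ ℕ) :
    aeval ξ (monomial m (1 : k)) = mon ξ m := by
  rw [aeval_monomial, map_one, one_mul, mon]

lemma vars_rename_sub {Y : Set σ} (p : MvPolynomial Y k) {i : σ}
    (hi : i ∈ (rename (Subtype.val : Y → σ) p).vars) : i ∈ Y := by
  classical
  have := vars_rename (Subtype.val : Y → σ) p hi
  rw [Finset.mem_image] at this
  obtain ⟨a, -, rfl⟩ := this
  exact a.2

lemma support_rename_sub {Y : Set σ} (p : MvPolynomial Y k) {m : σ →₀ ℕ}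
    (hm : m ∈ (rename (Subtype.val : Y → σ) p).support) {i : σ} (hi : m i ≠ 0) : i ∈ Y :=
  vars_rename_sub p (i := i) (by rw [mem_vars_iff_mem_support]; exact ⟨m, hm, by simpa using hi⟩)

lemma combine_G (P : Ideal (MvPolynomial σ k)) [hP : P.IsPrime] (j : σ) (hj : j ∉ freeVars P)
    (δ t U : ℕ) (hδt : δ ≤ t) (ι : Type*) (s : Finset ι) (M : ι → σ →₀ ℕ)
    (hM : ∀ b ∈ s, ∀ i, M b i < bd j t δ i) (hMt : ∀ b i, M b i ≤ t)
    (D : MvPolynomial (freeVars P) k) (hD : D ≠ 0) (c : ι → MvPolynomial (freeVars P) k)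
    (hDU : D.totalDegree ≤ U) (hcU : ∀ b, (c b).totalDegree ≤ U)
    (hG : rename (Subtype.val : freeVars P → σ) D * monomial (Finsupp.single j δ) 1
      - ∑ b ∈ s, rename (Subtype.val : freeVars P → σ) (c b) * monomial (M b) 1 ∈ P) :
    ∃ g ∈ P, (∀ i ∈ g.vars, i ≤ j) ∧ g.totalDegree ≤ U + (Fintype.card σ + 1) * t ∧
      g.degreeOf j = δ ∧ leadCoeff j g ∉ P := by
  classical
  set G1 := rename (Subtype.val : freeVars P → σ) D * monomial (Finsupp.single j δ) (1 : k) with hG1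
  set G2 := ∑ b ∈ s, rename (Subtype.val : freeVars P → σ) (c b) * monomial (M b) (1 : k) with hG2
  have s1 : ∀ m ∈ G1.support, ∃ m0 : σ →₀ ℕ, (∀ i, m0 i ≠ 0 → i ∈ freeVars P) ∧
      m = m0 + Finsupp.single j δ := by
    intro m hm
    obtain ⟨m0, h0, rfl⟩ := mem_support_mul_monomial hm
    exact ⟨m0, fun i hi => support_rename_sub D h0 hi, rfl⟩
  have s2 : ∀ m ∈ G2.support, ∃ b ∈ s, ∃ m0 : σ →₀ ℕ, (∀ i, m0 i ≠ 0 → i ∈ freeVars P) ∧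
      m = m0 + M b := by
    intro m hm
    have := support_sum hm
    rw [Finset.mem_biUnion] at this
    obtain ⟨b, hb, hm⟩ := this
    obtain ⟨m0, h0, rfl⟩ := mem_support_mul_monomial hm
    exact ⟨b, hb, m0, fun i hi => support_rename_sub (c b) h0 hi, rfl⟩
  have hz : ∀ m0 : σ →₀ ℕ, (∀ i, m0 i ≠ 0 → i ∈ freeVars P) → m0 j = 0 := by
    intro m0 h
    by_contra h'
    exact hj (h j h')
  have s2j : ∀ m ∈ G2.support, m j < δ := by
    intro m hm
    obtain ⟨b, hb, m0, h0, rfl⟩ := s2 m hm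
    rw [Finsupp.add_apply, hz m0 h0]
    have := hM b hb j
    simpa [bd] using this
  have s2i : ∀ m ∈ G2.support, ∀ i, j < i → m i ≠ 0 → i ∈ freeVars P := by
    intro m hm i hji hmi
    obtain ⟨b, hb, m0, h0, rfl⟩ := s2 m hm
    have := hM b hb i
    simp only [bd, hji.not_gt, hji.ne', if_false, Nat.lt_one_iff] at this
    rw [Finsupp.add_apply, this] at hmi
    exact h0 i hmi
  have s1j : ∀ m ∈ G1.support, m j = δ ∧ ∀ i, m i ≠ 0 → i = j ∨ i ∈ freeVars P := by
    intro m hm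
    obtain ⟨m0, h0, rfl⟩ := s1 m hm
    refine ⟨by simp [hz m0 h0], ?_⟩
    intro i hi
    by_cases h : i = j
    · exact Or.inl h
    · rw [Finsupp.add_apply, Finsupp.single_apply, if_neg (Ne.symm h)] at hi
      exact Or.inr (h0 i hi)
  have hor : ∀ m ∈ (G1 - G2).support, m ∈ G1.support ∨ m ∈ G2.support := by
    intro m hm
    have := support_sub σ G1 G2 hm
    exact Finset.mem_union.1 this
  obtain ⟨g, hgP, a1, a2, a3, a4⟩ := elim_final P j δ (G1 - G2) hG (by
      intro i hi hji
      rw [mem_vars_iff_mem_support] at hi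
      obtain ⟨m, hm, hmi⟩ := hi
      rw [Finsupp.mem_support_iff] at hmi
      rcases hor m hm with h | h
      · exact ((s1j m h).2 i hmi).resolve_left hji.ne'
      · exact s2i m h i hji hmi) (by
      intro m hm
      rcases hor m hm with h | h
      · exact ⟨(s1j m h).1.le, fun _ => (s1j m h).2⟩
      · exact ⟨(s2j m h).le, fun h' => absurd h' (s2j m h).ne⟩) (by
      have hD' : rename (Subtype.val : freeVars P → σ) D ≠ 0 := by
        intro h
        apply hD
        apply rename_injective _ Subtype.val_injective
        rw [h, map_zero]
      obtain ⟨m0, hm0⟩ := support_nonempty.2 hD'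
      refine ⟨m0 + Finsupp.single j δ, ?_, ?_⟩
      · rw [mem_support_iff, coeff_sub, hG1, coeff_mul_monomial, mul_one]
        have : coeff (m0 + Finsupp.single j δ) G2 = 0 := by
          by_contra h
          have := s2j _ (mem_support_iff.2 h)
          simp at this
        rw [this, sub_zero]
        exact mem_support_iff.1 hm0
      · have := hz m0 (fun i hi => support_rename_sub D hm0 hi)
        simp [this])
  refine ⟨g, hgP, a1, a2.trans ?_, a3, a4⟩
  refine (totalDegree_sub _ _).trans (max_le ?_ ?_)
  · refine (totalDegree_mul _ _).trans ?_
    have e1 := (totalDegree_rename_le (Subtype.val : freeVars P → σ) D).trans hDU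
    have e2 := totalDegree_monomial_le (Finsupp.single j δ) (1 : k)
    rw [Finsupp.sum_single_index (by simp)] at e2; simp only [id] at e2
    have : t ≤ (Fintype.card σ + 1) * t := Nat.le_mul_of_pos_left _ (Nat.succ_pos _)
    omega
  · apply totalDegree_finsetSum_le
    intro b hb
    refine (totalDegree_mul _ _).trans ?_
    have e1 := (totalDegree_rename_le (Subtype.val : freeVars P → σ) (c b)).trans (hcU b)
    have e2 : (monomial (M b) (1 : k)).totalDegree ≤ (Fintype.card σ + 1) * t := by
      refine (totalDegree_monomial_le (M b) (1 : k)).trans ?_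
      first
        | rw [Finsupp.sum_fintype _ _ (by simp)]
        | rw [Finsupp.degree_eq_sum]
      refine (Finset.sum_le_sum (fun i _ => hMt b i)).trans ?_
      rw [Finset.sum_const, Finset.card_univ, smul_eq_mul]
      exact Nat.mul_le_mul_right _ (Nat.le_succ _)
    omega

lemma exists_g [CharZero k] (P : Ideal (MvPolynomial σ k)) [hP : P.IsPrime]
    {K L : Type*} [Field K] [Field L]
    [Algebra (MvPolynomial (freeVars P) k) K] [IsFractionRing (MvPolynomial (freeVars P) k) K]
    [Algebra K L] [FiniteDimensional K L] [Algebra k K] [Algebra k L] [IsScalarTower k K L]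
    (ξ : σ → L) (hker : ∀ f : MvPolynomial σ k, aeval ξ f = 0 ↔ f ∈ P)
    (hcomp : ∀ p : MvPolynomial (freeVars P) k,
      algebraMap K L (algebraMap _ K p) = aeval ξ (rename (Subtype.val : freeVars P → σ) p))
    (htop : Algebra.adjoin K (Set.range ξ) = ⊤) (t t2 : ℕ) (ht0 : 0 < t)
    (ht : ∀ i, (minpoly K (ξ i)).natDegree ≤ t)
    (htr : ∀ m : σ →₀ ℕ, (∀ i, m i ≤ 2 * t) → ∃ a b : MvPolynomial (freeVars P) k, b ≠ 0 ∧
      a.totalDegree ≤ t2 ∧ b.totalDegree ≤ t2 ∧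
      algebraMap _ K b * Algebra.trace K L (mon ξ m) = algebraMap _ K a)
    (j : σ) (hj : j ∉ freeVars P) :
    ∃ g ∈ P, (∀ i ∈ g.vars, i ≤ j) ∧
      g.totalDegree ≤ t ^ Fintype.card σ * (((t ^ Fintype.card σ) ^ 2 + t ^ Fintype.card σ + 1) * t2)
        + (Fintype.card σ + 1) * t ∧
      0 < g.degreeOf j ∧ leadCoeff j g ∉ P ∧
      ∀ f ∈ P, (∀ i ∈ f.vars, i ≤ j) → f.degreeOf j < g.degreeOf j →
      ∀ d, (psi j f).coeff d ∈ P := by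
  classical
  have hIntg : ∀ i, IsIntegral K (ξ i) := fun i => Algebra.IsIntegral.isIntegral _
  have : CharZero K := charZero_of_injective_algebraMap (algebraMap k K).injective
  obtain ⟨δ, hδ0, hδt, hδ, hmin⟩ := exists_delta ξ j t ht0 hIntg ht
  have hsub : monSet ξ (bd j t δ) ⊆ monSet ξ (fun _ => t) := by
    apply monSet_mono
    intro i
    unfold bd; split_ifs <;> omega
  obtain ⟨B0, hB0, hspan, hli⟩ := exists_linearIndependent K (monSet ξ (bd j t δ))
  have hli' : LinearIndepOn K id B0 := hli
  have hT : ⊤ ≤ Submodule.span K (monSet ξ (fun _ => t)) := by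
    have h1 := adjoin_le_span_monSet (K := K) (s := Set.univ) (b := fun _ => t) ξ
      (fun i _ => hIntg i) (fun i _ => ht i) (fun _ => ht0)
    rw [Set.image_univ, htop] at h1
    simpa using h1
  obtain ⟨ι, b, hbv, hιsub, hB0ι⟩ : ∃ (ι : Set L) (b : Module.Basis ι K L), (∀ i, b i = i.1) ∧
      ι ⊆ monSet ξ (fun _ => t) ∧ B0 ⊆ ι :=
    ⟨hli'.extend (hB0.trans hsub), Module.Basis.extendLe hli' (hB0.trans hsub) hT,
      fun i => by simp [Module.Basis.extendLe], hli'.extend_subset (hB0.trans hsub),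
      hli'.subset_extend (hB0.trans hsub)⟩
  have hfin : ι.Finite := (monSet_finite ξ _).subset hιsub
  let _ : Fintype ι := hfin.fintype
  have hcard : Fintype.card ι ≤ t ^ Fintype.card σ := by
    rw [← Nat.card_eq_fintype_card]
    exact (Set.ncard_le_ncard hιsub (monSet_finite ξ _)).trans (monSet_ncard ξ t)
  have hMex : ∀ i : ι, ∃ m : σ →₀ ℕ, (∀ l, m l < t) ∧ i.1 = mon ξ m ∧
      (i.1 ∈ B0 → ∀ l, m l < bd j t δ l) := by
    intro i
    by_cases h : i.1 ∈ B0
    · obtain ⟨m, hm, hm'⟩ := hB0 h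
      refine ⟨m, fun l => (hm l).trans_le ?_, hm', fun _ => hm⟩
      unfold bd; split_ifs <;> omega
    · obtain ⟨m, hm, hm'⟩ := hιsub i.2
      exact ⟨m, hm, hm', fun h' => absurd h' h⟩
  choose M hMt hMm hMB using hMex
  obtain ⟨D, c, hD0, hDU, hcU, hDc⟩ := cramer_bounded (k := k) (τ := freeVars P) b (ξ j ^ δ) t2 (by
      intro i i'
      rw [hbv, hbv, hMm, hMm, ← mon_add]
      apply htr
      intro l
      have := hMt i l
      have := hMt i' l
      rw [Finsupp.add_apply]; omega) (by
      intro i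
      rw [hbv, hMm, ← mon_single, ← mon_add]
      apply htr
      intro l
      have := hMt i l
      have : Finsupp.single j δ l ≤ t := by
        rw [Finsupp.single_apply]; split_ifs <;> omega
      rw [Finsupp.add_apply]; omega)
  have hinjK : Function.Injective (algebraMap (MvPolynomial (freeVars P) k) K) :=
    IsFractionRing.injective _ _
  have hc0 : ∀ i : ι, i.1 ∉ B0 → c i = 0 := by
    intro i hi
    have h1 : (ξ j ^ δ) ∈ Submodule.span K (b '' {i | i.1 ∈ B0}) := by
      have : b '' {i | i.1 ∈ B0} = B0 := by
        ext x
        constructor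
        · rintro ⟨i, hi, rfl⟩; rw [hbv]; exact hi
        · intro hx
          exact ⟨⟨x, hB0ι hx⟩, hx, hbv _⟩
      rw [this, hspan]
      exact hδ
    have h2 := b.repr_support_subset_of_mem_span _ h1
    have h3 : b.repr (ξ j ^ δ) i = 0 := by
      by_contra h
      exact hi (h2 (Finsupp.mem_support_iff.2 h))
    have h4 := hDc i
    rw [h3, mul_zero] at h4
    exact hinjK (by rw [← h4, map_zero])
  set U := t ^ Fintype.card σ * (((t ^ Fintype.card σ) ^ 2 + t ^ Fintype.card σ + 1) * t2) with hU
  have hUle : Fintype.card ι * ((Fintype.card ι ^ 2 + Fintype.card ι + 1) * t2) ≤ U := by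
    rw [hU]; gcongr
  obtain ⟨g, hgP, a1, a2, a3, a4⟩ := combine_G P j hj δ t U hδt ι
    (Finset.univ.filter fun i => i.1 ∈ B0) M
    (fun i hi => hMB i (Finset.mem_filter.1 hi).2) (fun i l => (hMt i l).le) D hD0 c
    (hDU.trans hUle) (fun i => (hcU i).trans hUle) (by
      rw [← hker, map_sub, map_mul, map_sum, ← hcomp, aeval_monomial_one, mon_single, sub_eq_zero]
      have h1 : algebraMap K L (algebraMap _ K D) * ξ j ^ δ = ∑ i, algebraMap K L (algebraMap _ K (c i)) * b i := by
        conv_lhs => rw [← b.sum_repr (ξ j ^ δ)]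
        rw [Finset.mul_sum]
        apply Finset.sum_congr rfl
        intro i _
        rw [← hDc, map_mul, Algebra.smul_def, mul_assoc]
      rw [h1, Finset.sum_filter]
      apply Finset.sum_congr rfl
      intro i _
      split_ifs with h
      · rw [map_mul, ← hcomp, aeval_monomial_one, hbv, hMm]
      · rw [hc0 i h]; simp)
  refine ⟨g, hgP, a1, a2, by omega, a4, ?_⟩
  intro f hf hfv hfd d
  rw [a3] at hfd
  rw [← hker] at hf ⊢
  exact min_h1 ξ j t ht0 hIntg ht δ hmin f hf hfv hfd d

end ExSec

open MvPolynomial Matrix Pointwise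
set_option linter.unusedSectionVars false
set_option linter.deprecated false

section HFSec
variable {k : Type*} [Field k] {σ : Type*} [Fintype σ]

/-- the affine Hilbert function -/
noncomputable def HF (P : Ideal (MvPolynomial σ k)) (s : ℕ) : ℕ :=
  Module.finrank k ((restrictTotalDegree σ k s).map (Ideal.Quotient.mkₐ k P).toLinearMap)

lemma HF_relation (P : Ideal (MvPolynomial σ k)) {Y : Type*} [Fintype Y] (v : Y → σ)
    (hcard : Fintype.card Y ≤ Fintype.card σ) (r : ℕ) (hr : r ≤ Fintype.card Y) (B : ℕ) (hB : 0 < B)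
    (hHF : ∀ s, 1 ≤ s → HF P s ≤ B * s ^ r) (d0 : ℕ) (hd0 : 1 ≤ d0) (h : MvPolynomial σ k)
    (hh : h.totalDegree ≤ d0) :
    ∃ F : MvPolynomial (Option Y) k, F ≠ 0 ∧
      F.totalDegree ≤ (B * (Fintype.card σ + d0) ^ Fintype.card σ) * (Fintype.card σ + 1) ∧
      aeval (fun o : Option Y => o.elim h (fun i => X (v i))) F ∈ P := by
  classical
  set N := Fintype.card σ with hN
  set q := B * (N + d0) ^ N with hq
  have hq1 : 1 ≤ q := Nat.mul_pos hB (pow_pos (by omega) _)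
  set mexp : (Option Y → Fin (q + 1)) → (Option Y →₀ ℕ) := fun e =>
    Finsupp.equivFunOnFinite.symm (fun o => (e o : ℕ)) with hmexp
  have hminj : Function.Injective mexp := by
    intro e e' he
    ext o
    have := DFunLike.congr_fun he o
    simpa [hmexp] using this
  let E : ((Option Y → Fin (q + 1)) → k) →ₗ[k] MvPolynomial (Option Y) k :=
    ∑ e, (monomial (mexp e)).comp (LinearMap.proj e)
  have hE : ∀ c, E c = ∑ e, monomial (mexp e) (c e) := by
    intro c; simp [E, LinearMap.sum_apply]
  have hEdeg : ∀ c, (E c).totalDegree ≤ q * (N + 1) := by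
    intro c
    rw [hE]
    apply totalDegree_finsetSum_le
    intro e _
    refine (totalDegree_monomial_le _ _).trans ?_
    rw [Finsupp.sum_fintype _ _ (by simp)]
    refine (Finset.sum_le_sum (g := fun _ => q) (fun o _ => ?_)).trans ?_
    · simp only [hmexp, Finsupp.equivFunOnFinite_symm_apply_apply, id]
      have := (e o).2; omega
    · rw [Finset.sum_const, Finset.card_univ, Fintype.card_option, smul_eq_mul, mul_comm]
      gcongr
  have hEinj : ∀ c, E c = 0 → c = 0 := by
    intro c hc
    ext e
    have := congrArg (coeff (mexp e)) hc
    rw [hE, coeff_sum] at this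
    simp only [coeff_monomial, coeff_zero, hminj.eq_iff] at this
    simpa using this
  set ρ := aeval (R := k) (fun o : Option Y => o.elim h (fun i => (X (v i) : MvPolynomial σ k))) with hρ
  set s := q * (N + d0) with hs
  have hs1 : 1 ≤ s := Nat.mul_pos hq1 (by omega)
  have hρdeg : ∀ c, (ρ (E c)).totalDegree ≤ s := by
    intro c
    rw [hE, map_sum]
    apply totalDegree_finsetSum_le
    intro e _
    rw [hρ, aeval_monomial]
    refine (totalDegree_mul _ _).trans ?_
    rw [algebraMap_eq, totalDegree_C, zero_add, Finsupp.prod_fintype _ _ (by simp)]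
    refine (totalDegree_finsetProd _ _).trans ?_
    rw [Fintype.sum_option]
    have e1 : ∀ o, mexp e o ≤ q := by
      intro o
      simp only [hmexp, Finsupp.equivFunOnFinite_symm_apply_apply]
      have := (e o).2; omega
    have e2 : (h ^ mexp e none).totalDegree ≤ q * d0 :=
      (totalDegree_pow _ _).trans (Nat.mul_le_mul (e1 _) hh)
    have e3 : ∑ i : Y, ((X (v i) : MvPolynomial σ k) ^ mexp e (some i)).totalDegree ≤ q * N := by
      refine (Finset.sum_le_sum (g := fun _ => q) (fun i _ => ?_)).trans ?_
      · rw [totalDegree_X_pow]; exact e1 _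
      · rw [Finset.sum_const, Finset.card_univ, smul_eq_mul, mul_comm]
        gcongr
    simp only [Option.elim]
    rw [hs]
    nlinarith
  set W := (restrictTotalDegree σ k s).map (Ideal.Quotient.mkₐ k P).toLinearMap with hW
  let Φ : ((Option Y → Fin (q + 1)) → k) →ₗ[k] W :=
    LinearMap.codRestrict W ((Ideal.Quotient.mkₐ k P).toLinearMap ∘ₗ ρ.toLinearMap ∘ₗ E) (by
      intro c
      refine ⟨ρ (E c), ?_, rfl⟩
      exact (mem_restrictTotalDegree _ _ _).2 (hρdeg c))
  have hlt : Module.finrank k W < Module.finrank k ((Option Y → Fin (q + 1)) → k) := by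
    have e1 : Module.finrank k W ≤ B * s ^ r := hHF s hs1
    rw [Module.finrank_fintype_fun_eq_card, Fintype.card_fun, Fintype.card_option, Fintype.card_fin]
    set y := Fintype.card Y
    calc Module.finrank k W ≤ B * s ^ r := e1
      _ ≤ B * (q * (N + d0)) ^ y := by
        rw [← hs]; exact Nat.mul_le_mul_left _ (Nat.pow_le_pow_right hs1 hr)
      _ = B * (N + d0) ^ y * q ^ y := by rw [mul_pow]; ring
      _ ≤ q * q ^ y := by
        rw [hq]
        apply Nat.mul_le_mul_right
        apply Nat.mul_le_mul_left
        exact Nat.pow_le_pow_right (by omega) hcard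
      _ = q ^ (y + 1) := by ring
      _ < (q + 1) ^ (y + 1) := Nat.pow_lt_pow_left (Nat.lt_succ_self _) (Nat.succ_ne_zero _)
  have hker := LinearMap.ker_ne_bot_of_finrank_lt (f := Φ) hlt
  obtain ⟨c, hc, hc0⟩ := Submodule.exists_mem_ne_zero_of_ne_bot hker
  refine ⟨E c, fun h => hc0 (hEinj c h), hEdeg c, ?_⟩
  have := congrArg Subtype.val (LinearMap.mem_ker.1 hc)
  have h3 : Ideal.Quotient.mk P (ρ (E c)) = 0 := this
  exact Ideal.Quotient.eq_zero_iff_mem.1 h3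

end HFSec

section AlgSec
variable {k : Type*} [Field k] {σ : Type*} [LinearOrder σ] [Fintype σ]

lemma free_algebraic (P : Ideal (MvPolynomial σ k)) {L : Type*} [Field L] [Algebra k L] (ξ : σ → L)
    (hker : ∀ f : MvPolynomial σ k, aeval ξ f = 0 ↔ f ∈ P)
    {A : Type*} [CommRing A] [IsDomain A] [Algebra A L] [Algebra k A] [IsScalarTower k A L]
    (hA : ∀ i ∈ freeVars P, ξ i ∈ Set.range (algebraMap A L)) (i : σ) : IsAlgebraic A (ξ i) := by
  induction i using WellFoundedLT.induction with
  | ind i ih =>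
  by_cases hi : i ∈ freeVars P
  · obtain ⟨a, ha⟩ := hA i hi
    rw [← ha]
    exact isAlgebraic_algebraMap a
  · have hi' : ∃ f ∈ P, (∀ l ∈ f.vars, l ≤ i) ∧ ∃ d, (psi i f).coeff d ∉ P := by
      by_contra h
      apply hi
      intro f hf hv d
      by_contra h'
      exact h ⟨f, hf, hv, d, h'⟩
    obtain ⟨f, hf, hv, d, hd⟩ := hi'
    set g : Polynomial L := (psi i f).map (aeval ξ : MvPolynomial σ k →ₐ[k] L).toRingHom with hg
    have hgc : ∀ d, g.coeff d = aeval ξ ((psi i f).coeff d) := by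
      intro d; rw [hg, Polynomial.coeff_map]; rfl
    have hg0 : g ≠ 0 := by
      intro h
      apply hd
      rw [← hker, ← hgc, h, Polynomial.coeff_zero]
    have hev : g.eval (ξ i) = 0 := by
      have h1 : ξ i = (aeval ξ : MvPolynomial σ k →ₐ[k] L).toRingHom (X i) := by simp
      rw [hg, Polynomial.eval_map]
      conv_lhs => rw [h1]
      rw [Polynomial.eval₂_at_apply, psi_eval]
      exact (hker f).2 hf
    have hlift : g ∈ Polynomial.lifts (algebraMap (Subalgebra.algebraicClosure A L) L) := by
      rw [Polynomial.lifts_iff_coeff_lifts]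
      intro d
      have : g.coeff d ∈ Subalgebra.algebraicClosure A L := by
        rw [hgc]
        generalize hp : (psi i f).coeff d = p
        have hpv : ∀ l ∈ p.vars, l < i := by
          intro l hl
          rw [← hp] at hl
          exact lt_of_le_of_ne (hv l (psi_coeff_vars hl).2) (psi_coeff_vars hl).1
        rw [p.as_sum, map_sum]
        apply Subalgebra.sum_mem
        intro m hm
        rw [aeval_monomial, IsScalarTower.algebraMap_apply k A L]
        apply Subalgebra.mul_mem _ (Subalgebra.algebraMap_mem _ _)
        apply Subalgebra.prod_mem
        intro l hl
        apply Subalgebra.pow_mem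
        rw [Subalgebra.mem_algebraicClosure]
        apply ih l (hpv l _)
        rw [mem_vars_iff_mem_support]
        exact ⟨m, hm, hl⟩
      exact ⟨⟨_, this⟩, rfl⟩
    obtain ⟨g', hg'⟩ := hlift
    have hg' : g'.map (algebraMap (Subalgebra.algebraicClosure A L) L) = g := hg'
    apply IsAlgebraic.restrictScalars A (S := Subalgebra.algebraicClosure A L)
    refine ⟨g', ?_, ?_⟩
    · rintro rfl
      exact hg0 (by rw [← hg', Polynomial.map_zero])
    · rw [Polynomial.aeval_def, ← Polynomial.eval_map, hg', hev]

lemma free_algebraic_all (P : Ideal (MvPolynomial σ k)) {L : Type*} [Field L] [Algebra k L] (ξ : σ → L)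
    (hker : ∀ f : MvPolynomial σ k, aeval ξ f = 0 ↔ f ∈ P)
    (hfrac : ∀ x : L, ∃ f g : MvPolynomial σ k, x = aeval ξ f * (aeval ξ g)⁻¹)
    {A : Type*} [CommRing A] [IsDomain A] [Algebra A L] [Algebra k A] [IsScalarTower k A L]
    (hA : ∀ i ∈ freeVars P, ξ i ∈ Set.range (algebraMap A L)) : Algebra.IsAlgebraic A L := by
  have key : ∀ f : MvPolynomial σ k, IsAlgebraic A (aeval ξ f) := by
    intro p
    rw [← Subalgebra.mem_algebraicClosure]
    rw [p.as_sum, map_sum]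
    apply Subalgebra.sum_mem
    intro m hm
    rw [aeval_monomial, IsScalarTower.algebraMap_apply k A L]
    apply Subalgebra.mul_mem _ (Subalgebra.algebraMap_mem _ _)
    apply Subalgebra.prod_mem
    intro l hl
    apply Subalgebra.pow_mem
    rw [Subalgebra.mem_algebraicClosure]
    exact free_algebraic P ξ hker hA l
  constructor
  intro x
  obtain ⟨f, g, rfl⟩ := hfrac x
  exact (key f).mul (key g).inv

lemma card_free_ge (P : Ideal (MvPolynomial σ k)) {L : Type*} [Field L] [Algebra k L] (ξ : σ → L)
    (hker : ∀ f : MvPolynomial σ k, aeval ξ f = 0 ↔ f ∈ P)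
    (hfrac : ∀ x : L, ∃ f g : MvPolynomial σ k, x = aeval ξ f * (aeval ξ g)⁻¹)
    (r : ℕ) (y : Fin r → L) (hy : AlgebraicIndependent k y) : r ≤ Nat.card (freeVars P) := by
  set s : Set L := ξ '' (freeVars P) with hs
  have : Algebra.IsAlgebraic (Algebra.adjoin k s) L := by
    apply free_algebraic_all P ξ hker hfrac
    intro i hi
    exact ⟨⟨ξ i, Algebra.subset_adjoin ⟨i, hi, rfl⟩⟩, rfl⟩
  have h1 : Algebra.trdeg k L ≤ Cardinal.mk s := Algebra.IsAlgebraic.trdeg_le_cardinalMk k s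
  have h2 := hy.lift_cardinalMk_le_trdeg
  have h3 : Cardinal.mk s ≤ (Nat.card (freeVars P) : ℕ) := by
    have e1 : Cardinal.mk s = (Nat.card s : ℕ) := (Nat.cast_card (α := s)).symm
    rw [e1]
    exact_mod_cast Set.ncard_image_le (Set.toFinite _)
  have h4 := Cardinal.lift_le.{0}.2 (h1.trans h3)
  have h5 := h2.trans h4
  simpa using h5

end AlgSec

open MvPolynomial Matrix Pointwise
set_option linter.unusedSectionVars false
set_option linter.deprecated false

def tB (B N : ℕ) : ℕ := B * (N + 1) ^ N * (N + 1)
def t2B (B N : ℕ) : ℕ := B * (N + (2 * tB B N * N + 1)) ^ N * (N + 1)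
def TB (B N : ℕ) : ℕ :=
  (tB B N) ^ N * ((((tB B N) ^ N) ^ 2 + (tB B N) ^ N + 1) * t2B B N) + (N + 1) * tB B N

section ThmB
variable {k : Type*} [Field k] {σ : Type*} [LinearOrder σ] [Fintype σ]

lemma rel_to_poly {τ : Type*} {K L : Type*} [Field K] [Field L] [Algebra (MvPolynomial τ k) K]
    [Algebra K L] [Algebra k L] (η : τ → L) (θ : L)
    (hcomp : ∀ p : MvPolynomial τ k, algebraMap K L (algebraMap _ K p) = aeval η p)
    (F : MvPolynomial (Option τ) k) :
    Polynomial.aeval θ ((optionEquivLeft k τ F).map (algebraMap (MvPolynomial τ k) K)) =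
      aeval (fun o : Option τ => o.elim θ η) F := by
  induction F using MvPolynomial.induction_on with
  | C a =>
    rw [optionEquivLeft_C]
    simp [hcomp]
  | add p q hp hq => simp only [map_add, Polynomial.map_add, hp, hq]
  | mul_X p o hp =>
    rw [map_mul, Polynomial.map_mul, map_mul, hp, map_mul, aeval_X]
    cases o with
    | none => simp
    | some i => simp [hcomp]

lemma thmB_aux [CharZero k] (P : Ideal (MvPolynomial σ k)) [hP : P.IsPrime] {K L : Type*} [Field K]
    [Field L]
    [Algebra (MvPolynomial (freeVars P) k) K] [IsFractionRing (MvPolynomial (freeVars P) k) K]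
    [Algebra K L] [Algebra k K] [Algebra k L] [IsScalarTower k K L]
    (ξ : σ → L) (hker : ∀ f : MvPolynomial σ k, aeval ξ f = 0 ↔ f ∈ P)
    (hfrac : ∀ x : L, ∃ f g : MvPolynomial σ k, x = aeval ξ f * (aeval ξ g)⁻¹)
    (hcomp : ∀ p : MvPolynomial (freeVars P) k,
      algebraMap K L (algebraMap _ K p) = aeval ξ (rename (Subtype.val : freeVars P → σ) p))
    (r B : ℕ) (hB : 0 < B) (hHF : ∀ s, 1 ≤ s → HF P s ≤ B * s ^ r)
    (y : Fin r → L) (hy : AlgebraicIndependent k y) :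
    ∃ (A : Finset σ) (g : σ → MvPolynomial σ k), IsTriangularSet (A.sort.map g) ∧
      trep (A.sort.map g) = P ∧
      ∀ j ∈ A, g j ∈ P ∧ (g j).totalDegree ≤ TB B (Fintype.card σ) ∧ (g j).vars.max = (j : WithBot σ) ∧
        leadCoeff j (g j) ∉ P := by
  classical
  let _ : Fintype (freeVars P) := Fintype.ofFinite _
  set N := Fintype.card σ with hN
  have hcard : Fintype.card (freeVars P) ≤ N := Fintype.card_le_of_injective _ Subtype.val_injective
  have hr : r ≤ Fintype.card (freeVars P) := by
    rw [← Nat.card_eq_fintype_card]; exact card_free_ge P ξ hker hfrac r y hy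
  have halg : Algebra.IsAlgebraic K L := by
    apply free_algebraic_all P ξ hker hfrac
    intro i hi
    refine ⟨algebraMap (MvPolynomial (freeVars P) k) K (X ⟨i, hi⟩), ?_⟩
    rw [hcomp]; simp
  have hIntg : ∀ x : L, IsIntegral K x := fun x => (halg.isAlgebraic x).isIntegral
  have hmem : ∀ f : MvPolynomial σ k, aeval ξ f ∈ Algebra.adjoin K (Set.range ξ) := by
    intro f
    have := aeval_mem_adjoin (K := K) ξ (s := Set.univ) (f := f) (fun _ _ => trivial)
    rwa [Set.image_univ] at this
  have htop : Algebra.adjoin K (Set.range ξ) = ⊤ := by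
    rw [eq_top_iff]
    intro x _
    obtain ⟨f, g, rfl⟩ := hfrac x
    exact Subalgebra.mul_mem _ (hmem f)
      (Subalgebra.inv_mem_of_algebraic (Algebra.adjoin K (Set.range ξ)) (x := ⟨_, hmem g⟩)
        (halg.isAlgebraic _))
  have hfd : FiniteDimensional K L := by
    have := fg_adjoin_of_finite (R := K) (Set.finite_range ξ) (fun x _ => hIntg x)
    rw [htop] at this
    exact Module.Finite.of_fg_top (by simpa using this)
  have hcomp' : ∀ p : MvPolynomial (freeVars P) k,
      algebraMap K L (algebraMap _ K p) = aeval (fun i : freeVars P => ξ i) p := by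
    intro p
    rw [hcomp, aeval_rename]; rfl
  have hrel : ∀ (d0 : ℕ) (_ : 1 ≤ d0) (h : MvPolynomial σ k) (_ : h.totalDegree ≤ d0),
      ∃ F : MvPolynomial (Option (freeVars P)) k, F ≠ 0 ∧
      F.totalDegree ≤ (B * (N + d0) ^ N) * (N + 1) ∧
      Polynomial.aeval (aeval ξ h) ((optionEquivLeft k (freeVars P) F).map
        (algebraMap (MvPolynomial (freeVars P) k) K)) = 0 := by
    intro d0 hd0 h hh
    obtain ⟨F, hF0, hFd, hFP⟩ := HF_relation P (Subtype.val : freeVars P → σ) hcard r hr B hB hHF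
      d0 hd0 h hh
    refine ⟨F, hF0, hFd, ?_⟩
    rw [rel_to_poly (fun i : freeVars P => ξ i) _ hcomp']
    rw [← hker] at hFP
    rw [← hFP, comp_aeval_apply]
    congr 2
    ext o
    cases o <;> simp
  have hinjK : Function.Injective (algebraMap (MvPolynomial (freeVars P) k) K) :=
    IsFractionRing.injective _ _
  have ht0 : 0 < tB B N := by unfold tB; positivity
  have ht : ∀ i, (minpoly K (ξ i)).natDegree ≤ tB B N := by
    intro i
    obtain ⟨F, hF0, hFd, hFr⟩ := hrel 1 le_rfl (X i) (by rw [totalDegree_X])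
    rw [aeval_X] at hFr
    have h1 := minpoly.dvd K _ hFr
    have h2 : ((optionEquivLeft k (freeVars P) F).map
        (algebraMap (MvPolynomial (freeVars P) k) K)) ≠ 0 := by
      rw [Ne, Polynomial.map_eq_zero_iff hinjK]
      simpa using hF0
    refine (Polynomial.natDegree_le_of_dvd h1 h2).trans ?_
    refine (Polynomial.natDegree_map_le).trans ?_
    rw [natDegree_optionEquivLeft]
    exact (degreeOf_le_totalDegree _ _).trans hFd
  have htr : ∀ m : σ →₀ ℕ, (∀ i, m i ≤ 2 * tB B N) → ∃ a b : MvPolynomial (freeVars P) k, b ≠ 0 ∧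
      a.totalDegree ≤ t2B B N ∧ b.totalDegree ≤ t2B B N ∧
      algebraMap _ K b * Algebra.trace K L (mon ξ m) = algebraMap _ K a := by
    intro m hm
    obtain ⟨F, hF0, hFd, hFr⟩ := hrel (2 * tB B N * N + 1) (by omega) (monomial m 1) (by
      refine (totalDegree_monomial_le _ _).trans ?_
      rw [Finsupp.sum_fintype _ _ (by simp)]
      refine (Finset.sum_le_sum (fun i _ => hm i)).trans ?_
      rw [Finset.sum_const, Finset.card_univ, smul_eq_mul, ← hN, mul_comm]
      exact Nat.le_succ _)
    rw [aeval_monomial_one] at hFr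
    exact trace_bounded _ F hF0 _ hFd hFr
  have hg := fun (j : σ) (hj : j ∉ freeVars P) => exists_g P ξ hker hcomp htop (tB B N) (t2B B N) ht0 ht htr j hj
  choose! g g1 g2 g3 g4 g5 g6 using hg
  set A : Finset σ := Finset.univ.filter (fun j => j ∉ freeVars P) with hA
  have hAm : ∀ j, j ∈ A ↔ j ∉ freeVars P := by intro j; simp [hA]
  obtain ⟨r1, r2⟩ := trep_eq_prime P A g (fun j hj => g1 j ((hAm j).1 hj))
    (fun j hj => g2 j ((hAm j).1 hj)) (fun j hj => g4 j ((hAm j).1 hj))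
    (fun j hj => g5 j ((hAm j).1 hj)) (fun j hj => g6 j ((hAm j).1 hj))
    (fun j hj => by
      have : j ∈ freeVars P := by rw [hAm] at hj; exact not_not.1 hj
      exact this)
  refine ⟨A, g, r1, r2, fun j hj => ?_⟩
  have hj' := (hAm j).1 hj
  refine ⟨g1 j hj', g3 j hj', vars_max_eq ?_ (g2 j hj'), g5 j hj'⟩
  rw [mem_vars_iff_degreeOf_ne_zero]
  exact (g4 j hj').ne'

theorem thmB [CharZero k] (P : Ideal (MvPolynomial σ k)) [hP : P.IsPrime]
    (r B : ℕ) (hB : 0 < B) (hHF : ∀ s, 1 ≤ s → HF P s ≤ B * s ^ r)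
    (y : Fin r → (MvPolynomial σ k ⧸ P)) (hy : AlgebraicIndependent k y) :
    ∃ (A : Finset σ) (g : σ → MvPolynomial σ k), IsTriangularSet (A.sort.map g) ∧
      trep (A.sort.map g) = P ∧
      ∀ j ∈ A, g j ∈ P ∧ (g j).totalDegree ≤ TB B (Fintype.card σ) ∧ (g j).vars.max = (j : WithBot σ) ∧
        leadCoeff j (g j) ∉ P := by
  classical
  let S := MvPolynomial σ k ⧸ P
  let L := FractionRing S
  let ξ : σ → L := fun i => algebraMap S L (Ideal.Quotient.mk P (X i))
  have hae : ∀ f : MvPolynomial σ k, aeval ξ f = algebraMap S L (Ideal.Quotient.mk P f) := by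
    intro f
    have : aeval ξ = (IsScalarTower.toAlgHom k S L).comp (Ideal.Quotient.mkₐ k P) := by
      ext i; simp [ξ]; rfl
    rw [this]; rfl
  have hinj : Function.Injective (algebraMap S L) := IsFractionRing.injective _ _
  have hker : ∀ f : MvPolynomial σ k, aeval ξ f = 0 ↔ f ∈ P := by
    intro f
    rw [hae, map_eq_zero_iff _ hinj, Ideal.Quotient.eq_zero_iff_mem]
  have hfrac : ∀ x : L, ∃ f g : MvPolynomial σ k, x = aeval ξ f * (aeval ξ g)⁻¹ := by
    intro x
    obtain ⟨a, b, hb, rfl⟩ := IsFractionRing.div_surjective (A := S) x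
    obtain ⟨f, rfl⟩ := Ideal.Quotient.mk_surjective a
    obtain ⟨g, rfl⟩ := Ideal.Quotient.mk_surjective b
    exact ⟨f, g, by rw [hae, hae, div_eq_mul_inv]⟩
  let K := FractionRing (MvPolynomial (freeVars P) k)
  let φ : MvPolynomial (freeVars P) k →ₐ[k] L :=
    (aeval ξ).comp (rename (Subtype.val : freeVars P → σ))
  have hφ : Function.Injective φ.toRingHom := by
    rw [injective_iff_map_eq_zero]
    intro p hp
    have h1 : aeval ξ (rename (Subtype.val : freeVars P → σ) p) = 0 := hp
    rw [hker] at h1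
    have h2 := freeVars_eq_zero P h1 (fun i hi => vars_rename_sub p hi)
    exact rename_injective _ Subtype.val_injective (by rw [h2, map_zero])
  let _ : Algebra K L := (IsFractionRing.lift (K := K) hφ).toAlgebra
  have hcomp : ∀ p : MvPolynomial (freeVars P) k,
      algebraMap K L (algebraMap _ K p) = aeval ξ (rename (Subtype.val : freeVars P → σ) p) := by
    intro p
    exact IsFractionRing.lift_algebraMap hφ p
  have : IsScalarTower k K L := by
    apply IsScalarTower.of_algebraMap_eq
    intro a
    have h1 : algebraMap k K a = algebraMap (MvPolynomial (freeVars P) k) K (C a) :=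
      IsScalarTower.algebraMap_apply k (MvPolynomial (freeVars P) k) K a
    rw [h1, hcomp]; simp
  refine thmB_aux P (K := K) (L := L) ξ hker hfrac hcomp r B hB hHF (fun i => algebraMap S L (y i)) ?_
  exact hy.map' (f := IsScalarTower.toAlgHom k S L) hinj

end ThmB

open MvPolynomial Matrix Pointwise
set_option linter.unusedSectionVars false
set_option linter.deprecated false

section HF2
variable {k : Type*} [Field k] {σ : Type*} [Fintype σ]

lemma HF_step (Q Q' : Ideal (MvPolynomial σ k)) [hQ : Q.IsPrime] (hle : Q ≤ Q')
    (f : MvPolynomial σ k) (hf : f ∈ Q') (hfQ : f ∉ Q) (e : ℕ) (he : f.totalDegree ≤ e) (s : ℕ) :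
    HF Q' (s + e) + HF Q s ≤ HF Q (s + e) := by
  set W := (restrictTotalDegree σ k (s + e)).map (Ideal.Quotient.mkₐ k Q).toLinearMap with hW
  set W0 := (restrictTotalDegree σ k s).map (Ideal.Quotient.mkₐ k Q).toLinearMap with hW0
  set W' := (restrictTotalDegree σ k (s + e)).map (Ideal.Quotient.mkₐ k Q').toLinearMap with hW'
  let π : (MvPolynomial σ k ⧸ Q) →ₐ[k] (MvPolynomial σ k ⧸ Q') := Ideal.Quotient.factorₐ k hle
  have hπ : ∀ p, π (Ideal.Quotient.mk Q p) = Ideal.Quotient.mk Q' p := fun p => rfl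
  let Pi0 : W →ₗ[k] W' := (π.toLinearMap).restrict (by
    rintro _ ⟨p, hp, rfl⟩
    exact ⟨p, hp, rfl⟩)
  have hsurj : LinearMap.range Pi0 = ⊤ := by
    rw [LinearMap.range_eq_top]
    rintro ⟨_, p, hp, rfl⟩
    exact ⟨⟨_, p, hp, rfl⟩, rfl⟩
  let μ : W0 →ₗ[k] LinearMap.ker Pi0 := LinearMap.codRestrict _
    (LinearMap.codRestrict W
      ((LinearMap.mulLeft k (Ideal.Quotient.mk Q f)).comp W0.subtype) (by
        rintro ⟨_, p, hp, rfl⟩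
        refine ⟨f * p, ?_, ?_⟩
        · have hp' := (mem_restrictTotalDegree _ _ _).1 hp
          refine (mem_restrictTotalDegree _ _ _).2 ((totalDegree_mul _ _).trans ?_)
          omega
        · simp)) (by
      rintro ⟨_, p, hp, rfl⟩
      rw [LinearMap.mem_ker]
      apply Subtype.ext
      change π (Ideal.Quotient.mk Q f * Ideal.Quotient.mk Q p) = 0
      rw [map_mul, hπ, Ideal.Quotient.eq_zero_iff_mem.2 hf, zero_mul])
  have hμ : Function.Injective μ := by
    rintro ⟨x, hx⟩ ⟨y, hy⟩ h
    have h1 : Ideal.Quotient.mk Q f * x = Ideal.Quotient.mk Q f * y :=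
      congrArg (fun z => (z.1.1)) h
    have h2 : Ideal.Quotient.mk Q f ≠ 0 := fun h => hfQ (Ideal.Quotient.eq_zero_iff_mem.1 h)
    exact Subtype.ext (mul_left_cancel₀ h2 h1)
  have h1 := LinearMap.finrank_range_add_finrank_ker Pi0
  have h2 := LinearMap.finrank_le_finrank_of_injective hμ
  rw [hsurj, finrank_top] at h1
  unfold HF
  rw [← hW, ← hW', ← hW0]
  omega

lemma HF_mono (Q : Ideal (MvPolynomial σ k)) {s s' : ℕ} (h : s ≤ s') : HF Q s ≤ HF Q s' := by
  apply Submodule.finrank_mono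
  apply Submodule.map_mono
  intro p hp
  rw [mem_restrictTotalDegree] at hp ⊢
  omega

lemma HF_sum (Q Q' : Ideal (MvPolynomial σ k)) [hQ : Q.IsPrime] (hle : Q ≤ Q')
    (f : MvPolynomial σ k) (hf : f ∈ Q') (hfQ : f ∉ Q) (e : ℕ) (he : f.totalDegree ≤ e) (s m : ℕ) :
    m * HF Q' s ≤ HF Q (s + m * e) := by
  induction m with
  | zero => simp
  | succ m ih =>
    have h1 := HF_step Q Q' hle f hf hfQ e he (s + m * e)
    have h2 : HF Q' s ≤ HF Q' (s + m * e + e) := HF_mono _ (by omega)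
    have h3 : s + (m + 1) * e = s + m * e + e := by ring
    rw [h3, add_mul, one_mul]
    omega

lemma HF_pos (Q : Ideal (MvPolynomial σ k)) (hQ : Q ≠ ⊤) (s : ℕ) : 1 ≤ HF Q s := by
  unfold HF
  rw [Nat.one_le_iff_ne_zero]
  intro h
  rw [Submodule.finrank_eq_zero] at h
  have : Ideal.Quotient.mk Q 1 ∈ (restrictTotalDegree σ k s).map (Ideal.Quotient.mkₐ k Q).toLinearMap :=
    ⟨1, by simp [mem_restrictTotalDegree], rfl⟩
  rw [h, Submodule.mem_bot, Ideal.Quotient.eq_zero_iff_mem] at this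
  exact hQ ((Ideal.eq_top_iff_one _).2 this)

lemma HF_le_monomials (Q : Ideal (MvPolynomial σ k)) (s : ℕ) : HF Q s ≤ (s + 1) ^ Fintype.card σ := by
  classical
  let T : Finset (MvPolynomial σ k ⧸ Q) := Finset.univ.image (fun m : σ → Fin (s + 1) =>
      Ideal.Quotient.mk Q (monomial (Finsupp.equivFunOnFinite.symm fun i => (m i : ℕ)) (1 : k)))
  have hsub : (restrictTotalDegree σ k s).map (Ideal.Quotient.mkₐ k Q).toLinearMap ≤
      Submodule.span k (T : Set _) := by
    rintro _ ⟨p, hp, rfl⟩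
    have hp' := (mem_restrictTotalDegree _ _ _).1 hp
    rw [p.as_sum, map_sum]
    apply Submodule.sum_mem
    intro m hm
    have h1 : monomial m (coeff m p) = coeff m p • monomial m (1 : k) := by
      rw [smul_monomial, smul_eq_mul, mul_one]
    rw [h1, map_smul]
    apply Submodule.smul_mem
    apply Submodule.subset_span
    rw [Finset.mem_coe, Finset.mem_image]
    refine ⟨fun i => ⟨m i, ?_⟩, Finset.mem_univ _, ?_⟩
    · have h2 := (monomial_le_degreeOf i hm).trans ((degreeOf_le_totalDegree p i).trans hp')
      omega
    · have : (Finsupp.equivFunOnFinite.symm fun i => m i) = m := by ext; simp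
      simp only [this]; rfl
  unfold HF
  refine (Submodule.finrank_mono hsub).trans ((finrank_span_finset_le_card T).trans ?_)
  refine Finset.card_image_le.trans ?_
  rw [Finset.card_univ, Fintype.card_fun, Fintype.card_fin]

/-- trdeg of the quotient by `Q` is at least `r` -/
def TrGe (Q : Ideal (MvPolynomial σ k)) (r : ℕ) : Prop :=
  ∃ y : Fin r → MvPolynomial σ k, ∀ h : MvPolynomial (Fin r) k, aeval y h ∈ Q → h = 0

lemma TrGe.indep {Q : Ideal (MvPolynomial σ k)} {r : ℕ} (h : TrGe Q r) :
    ∃ y : Fin r → (MvPolynomial σ k ⧸ Q), AlgebraicIndependent k y := by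
  obtain ⟨y, hy⟩ := h
  refine ⟨fun i => Ideal.Quotient.mkₐ k Q (y i), ?_⟩
  rw [algebraicIndependent_iff]
  intro p hp
  apply hy
  rw [← comp_aeval_apply] at hp
  exact Ideal.Quotient.eq_zero_iff_mem.1 hp

end HF2

open MvPolynomial Matrix Pointwise
set_option linter.unusedSectionVars false
set_option linter.deprecated false

section Drop
variable {k : Type*} [Field k]

lemma card_le_of_integral {D : Type*} [CommRing D] [IsDomain D] [Algebra k D] {s r : ℕ}
    (g : MvPolynomial (Fin s) k →ₐ[k] D) (hgi : g.IsIntegral)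
    (x : Fin r → D) (hx : AlgebraicIndependent k x) : r ≤ s := by
  set T : Set D := Set.range (fun i => g (X i)) with hT
  have hmem : ∀ p, g p ∈ Algebra.adjoin k T := by
    intro p
    rw [hT, Algebra.adjoin_range_eq_range_aeval]
    refine ⟨p, ?_⟩
    exact (DFunLike.congr_fun (aeval_unique g) p).symm
  have halg : Algebra.IsAlgebraic (Algebra.adjoin k T) D := by
    have : Algebra.IsIntegral (Algebra.adjoin k T) D := by
      refine ⟨fun d => ?_⟩
      have h := hgi d
      exact RingHom.IsIntegralElem.of_comp (f := (g.codRestrict (Algebra.adjoin k T) hmem).toRingHom)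
        (g := (algebraMap (Algebra.adjoin k T) D)) h
    infer_instance
  have h1 := Algebra.IsAlgebraic.trdeg_le_cardinalMk k T
  have h2 := hx.lift_cardinalMk_le_trdeg
  have h3 : Cardinal.mk T ≤ (s : Cardinal) := by
    have := Cardinal.mk_range_le_lift (f := fun i : Fin s => g (X i))
    simpa using this
  have h4 := h1.trans h3
  have h5 : (r : Cardinal) ≤ s := by
    simp only [Cardinal.mk_fin, Cardinal.lift_natCast, Cardinal.lift_uzero] at h2
    exact h2.trans h4
  exact_mod_cast h5

lemma omit_var {s : ℕ} (q : MvPolynomial (Fin (s + 1)) k) (hq0 : q ≠ 0) (i : Fin (s + 1))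
    (hi : i ∈ q.vars) (h : MvPolynomial (Fin s) k)
    (hd : rename i.succAbove h ∈ Ideal.span {q}) : h = 0 := by
  by_contra hne
  obtain ⟨c, hc⟩ := Ideal.mem_span_singleton'.1 hd
  have hrn : rename i.succAbove h ≠ 0 := by
    intro h0
    exact hne (rename_injective _ (Fin.succAbove_right_injective) (by simpa using h0))
  have hc0 : c ≠ 0 := by rintro rfl; apply hrn; rw [← hc, zero_mul]
  have h1 := degreeOf_mul_eq (n := i) hc0 hq0
  rw [hc] at h1
  have h2 : degreeOf i (rename i.succAbove h) = 0 := by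
    classical
    by_contra h0
    have : i ∈ (rename i.succAbove h).vars := by
      exact mem_vars_iff_degreeOf_ne_zero.2 h0
    have := vars_rename _ _ this
    rw [Finset.mem_image] at this
    obtain ⟨j, _, hj⟩ := this
    exact Fin.succAbove_ne i j hj
  have h3 : 0 < degreeOf i q := Nat.pos_of_ne_zero (mem_vars_iff_degreeOf_ne_zero.1 hi)
  omega

lemma drop_alg {D : Type*} [CommRing D] [IsDomain D] [Algebra k D] [Algebra.FiniteType k D]
    {r : ℕ} (x : Fin (r + 1) → D) (hx : AlgebraicIndependent k x) (f : D) (hf : f ≠ 0)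
    (p : Ideal D) (hp : p ∈ (Ideal.span {f}).minimalPrimes) :
    ∃ y : Fin r → D, ∀ h : MvPolynomial (Fin r) k, aeval y h ∈ p → h = 0 := by
  have hpp : p.IsPrime := hp.1.1
  have hfp : f ∈ p := hp.1.2 (Ideal.mem_span_singleton_self f)
  obtain ⟨s, g, hginj, hgi⟩ := exists_integral_inj_algHom_of_fg k D
  have hs := card_le_of_integral g hgi x hx
  obtain ⟨s, rfl⟩ : ∃ s', s = s' + 1 := ⟨s - 1, by omega⟩
  let _ : Algebra (MvPolynomial (Fin (s+1)) k) D := g.toRingHom.toAlgebra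
  have hmap : ∀ z, algebraMap (MvPolynomial (Fin (s+1)) k) D z = g z := fun z => rfl
  have hfaith : FaithfulSMul (MvPolynomial (Fin (s+1)) k) D :=
    (faithfulSMul_iff_algebraMap_injective _ _).2 hginj
  have hIntg : Algebra.IsIntegral (MvPolynomial (Fin (s+1)) k) D := ⟨hgi⟩
  have : IsNoetherianRing D := Algebra.FiniteType.isNoetherianRing k D
  have hq := Ideal.comap_ne_bot_of_integral_mem (R := MvPolynomial (Fin (s+1)) k) hf hfp
    (hIntg.isIntegral f)
  set 𝔮 := p.comap (algebraMap (MvPolynomial (Fin (s+1)) k) D) with h𝔮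
  have hqp : 𝔮.IsPrime := Ideal.IsPrime.comap _
  obtain ⟨q, hqm, hqprime⟩ := hqp.exists_mem_prime_of_ne_bot hq
  have hspan : (Ideal.span {q}).IsPrime := (Ideal.span_singleton_prime hqprime.ne_zero).2 hqprime
  have hle : Ideal.span {q} ≤ 𝔮 := by rwa [Ideal.span_singleton_le_iff_mem]
  have hlo : p.LiesOver 𝔮 := ⟨rfl⟩
  obtain ⟨P0, hP0, hP0p, hP0l⟩ := Ideal.exists_ideal_le_liesOver_of_le p hle
  have hP0e : P0 = p := by
    by_contra hne
    have h1 := Ideal.height_add_one_le_of_lt_of_isPrime (lt_of_le_of_ne hP0 hne)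
    have h2 := Ideal.height_le_one_of_isPrincipal_of_mem_minimalPrimes _ p hp
    have h3 : P0.height = 0 := by
      have h4 := h1.trans h2
      by_contra h0
      have : 1 ≤ P0.height := Order.one_le_iff_ne_zero.2 h0
      have h5 : (1 : ℕ∞) + 1 ≤ 1 := (add_le_add_left this 1).trans h4
      exact absurd h5 (by decide)
    rw [Ideal.height_eq_zero_iff_eq_bot] at h3
    have h5 : q ∈ P0.under _ := by rw [← hP0l.over]; exact Ideal.mem_span_singleton_self q
    rw [h3, Ideal.mem_comap, Ideal.mem_bot, hmap] at h5
    exact hqprime.ne_zero (hginj (by rw [h5, map_zero]))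
  have h𝔮q : 𝔮 = Ideal.span {q} := by rw [hP0l.over, hP0e]
  obtain ⟨i, hi⟩ : q.vars.Nonempty := by
    rw [Finset.nonempty_iff_ne_empty]
    intro h0
    obtain ⟨a, rfl⟩ : ∃ a, q = C a := ⟨_, vars_eq_empty_iff_eq_C.1 h0⟩
    apply hqprime.not_unit
    apply IsUnit.map
    rw [isUnit_iff_ne_zero]
    rintro rfl
    exact hqprime.ne_zero (map_zero _)
  refine ⟨fun j => g (X (i.succAbove (Fin.castLE (by omega) j))), fun h hh => ?_⟩
  have h1 : rename (i.succAbove) (rename (Fin.castLE (show r ≤ s by omega)) h) ∈ 𝔮 := by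
    rw [h𝔮, Ideal.mem_comap, hmap, rename_rename]
    rw [DFunLike.congr_fun (aeval_unique g) _, aeval_rename]
    exact hh
  rw [h𝔮q] at h1
  have h2 := omit_var q hqprime.ne_zero i hi _ h1
  exact rename_injective _ (Fin.castLE_injective _) (by simpa using h2)

variable {σ : Type*} [Fintype σ]

lemma TrGe_drop (Q Q' : Ideal (MvPolynomial σ k)) [Q.IsPrime] (f : MvPolynomial σ k)
    (hf : f ∉ Q) (hQ' : Q' ∈ (Q ⊔ Ideal.span {f}).minimalPrimes) (r : ℕ) (h : TrGe Q (r + 1)) :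
    TrGe Q' r := by
  obtain ⟨x, hx⟩ := h.indep
  have h1 : (Ideal.span {Ideal.Quotient.mk Q f}).comap (Ideal.Quotient.mk Q)
      = Q ⊔ Ideal.span {f} := by
    rw [← Set.image_singleton, ← Ideal.map_span,
      Ideal.comap_map_of_surjective _ Ideal.Quotient.mk_surjective, sup_comm]
    congr 1
    exact Ideal.mk_ker
  rw [← h1, Ideal.comap_minimalPrimes_eq_of_surjective Ideal.Quotient.mk_surjective] at hQ'
  obtain ⟨p, hp, rfl⟩ := hQ'
  obtain ⟨y, hy⟩ := drop_alg x hx (Ideal.Quotient.mk Q f)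
    (fun h => hf (Ideal.Quotient.eq_zero_iff_mem.1 h)) p hp
  choose Y hY using fun j => Ideal.Quotient.mk_surjective (y j)
  refine ⟨Y, fun h hh => hy h ?_⟩
  rw [Ideal.mem_comap] at hh
  have : y = fun j => Ideal.Quotient.mkₐ k Q (Y j) := by funext j; exact (hY j).symm
  rw [this, ← comp_aeval_apply]
  exact hh

end Drop

open MvPolynomial Matrix Pointwise
set_option linter.unusedSectionVars false
set_option linter.deprecated false

section Bezout
variable {k : Type*} [Field k] {σ : Type*} [Fintype σ]

lemma bezout_aux (I : Set (MvPolynomial σ k)) (e : ℕ) (hI : ∀ f ∈ I, f.totalDegree ≤ e)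
    (P : Ideal (MvPolynomial σ k)) [hP : P.IsPrime] (hIP : I ⊆ P)
    (hmin : ∀ Q : Ideal (MvPolynomial σ k), Q.IsPrime → I ⊆ Q → Q ≤ P → Q = P) :
    ∀ (r b : ℕ) (Q : Ideal (MvPolynomial σ k)), Q.IsPrime → Q ≤ P → TrGe Q r →
      (∀ s, 1 ≤ s → HF Q s ≤ b * s ^ r) →
      ∃ r' ≤ r, TrGe P r' ∧ ∀ s, 1 ≤ s → HF P s ≤ b * (1 + e) ^ (r * r) * s ^ r' := by
  intro r
  induction r with
  | zero =>
    intro b Q hQ hQP hTr hHF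
    by_cases hIQ : I ⊆ Q
    · have := hmin Q hQ hIQ hQP
      subst this
      exact ⟨0, le_rfl, hTr, by simpa using hHF⟩
    · exfalso
      obtain ⟨f, hfI, hfQ⟩ := Set.not_subset.1 hIQ
      have h1 := HF_sum Q P hQP f (hIP hfI) hfQ e (hI f hfI) (b + 1) (b + 1)
      have h2 := hHF (b + 1 + (b + 1) * e) (by omega)
      have h3 := HF_pos P hP.ne_top (b + 1)
      have h4 : b + 1 ≤ (b + 1) * HF P (b + 1) := Nat.le_mul_of_pos_right _ h3
      simp at h2
      omega
  | succ r ih =>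
    intro b Q hQ hQP hTr hHF
    by_cases hIQ : I ⊆ Q
    · have := hmin Q hQ hIQ hQP
      subst this
      refine ⟨r + 1, le_rfl, hTr, fun s hs => (hHF s hs).trans ?_⟩
      apply Nat.mul_le_mul_right
      exact Nat.le_mul_of_pos_right _ (by positivity)
    · obtain ⟨f, hfI, hfQ⟩ := Set.not_subset.1 hIQ
      obtain ⟨Q', hQ'm, hQ'P⟩ := Ideal.exists_minimalPrimes_le (I := Q ⊔ Ideal.span {f}) (J := P)
        (sup_le hQP (by rw [Ideal.span_singleton_le_iff_mem]; exact hIP hfI))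
      have hle : Q ⊔ Ideal.span {f} ≤ Q' := hQ'm.1.2
      have hfQ' : f ∈ Q' := hle (Ideal.mem_sup_right (Ideal.mem_span_singleton_self f))
      have hb : ∀ s, 1 ≤ s → HF Q' s ≤ (b * (1 + e) ^ (r + 1)) * s ^ r := by
        intro s hs
        have h1 := HF_sum Q Q' (le_sup_left.trans hle) f hfQ' hfQ e (hI f hfI) s s
        have h2 := hHF (s + s * e) (by omega)
        have h3 : b * (s + s * e) ^ (r + 1) = s * ((b * (1 + e) ^ (r + 1)) * s ^ r) := by
          have : s + s * e = s * (1 + e) := by ring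
          rw [this, mul_pow]; ring
        exact Nat.le_of_mul_le_mul_left ((h1.trans h2).trans h3.le) hs
      obtain ⟨r', hr', hT, hH⟩ := ih _ Q' hQ'm.1.1 hQ'P (TrGe_drop Q Q' f hfQ hQ'm r hTr) hb
      refine ⟨r', by omega, hT, fun s hs => (hH s hs).trans ?_⟩
      apply Nat.mul_le_mul_right
      rw [mul_assoc, ← pow_add]
      apply Nat.mul_le_mul_left
      apply Nat.pow_le_pow_right (by omega)
      nlinarith

lemma bezout (I : Set (MvPolynomial σ k)) (e : ℕ) (hI : ∀ f ∈ I, f.totalDegree ≤ e)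
    (P : Ideal (MvPolynomial σ k)) [hP : P.IsPrime] (hIP : I ⊆ P)
    (hmin : ∀ Q : Ideal (MvPolynomial σ k), Q.IsPrime → I ⊆ Q → Q ≤ P → Q = P) :
    ∃ r, TrGe P r ∧ ∀ s, 1 ≤ s → HF P s ≤
      2 ^ Fintype.card σ * (1 + e) ^ (Fintype.card σ * Fintype.card σ) * s ^ r := by
  have hA : TrGe (⊥ : Ideal (MvPolynomial σ k)) (Fintype.card σ) := by
    let E := (Fintype.equivFin σ).symm
    refine ⟨fun i => X (E i), fun h hh => ?_⟩
    rw [Ideal.mem_bot] at hh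
    have : rename E h = 0 := by rw [← hh, DFunLike.congr_fun (aeval_unique (rename (R := k) E)) h]; congr 2; funext i; simp
    exact rename_injective _ E.injective (by simpa using this)
  have hB : ∀ s, 1 ≤ s → HF (⊥ : Ideal (MvPolynomial σ k)) s ≤
      2 ^ Fintype.card σ * s ^ Fintype.card σ := by
    intro s hs
    refine (HF_le_monomials ⊥ s).trans ?_
    rw [← mul_pow]
    exact Nat.pow_le_pow_left (by omega) _
  obtain ⟨r', -, h1, h2⟩ := bezout_aux I e hI P hIP hmin (Fintype.card σ) (2 ^ Fintype.card σ) ⊥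
    Ideal.isPrime_bot bot_le hA hB
  exact ⟨r', h1, h2⟩

end Bezout

open MvPolynomial Matrix Pointwise
set_option linter.unusedSectionVars false
set_option linter.deprecated false
set_option linter.unusedSimpArgs false

section GLbasic
variable {k : Type*} [Field k] {n : ℕ}

abbrev Rn (n : ℕ) (k : Type*) [Field k] := MvPolynomial (Fin n ×ₗ Fin n) k
abbrev Mn (n : ℕ) (k : Type*) := Matrix (Fin n) (Fin n) k

/-- evaluation of a polynomial at a matrix -/
noncomputable def evm (A : Mn n k) : Rn n k →ₐ[k] k :=
  aeval (fun p => A (ofLex p).1 (ofLex p).2)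

lemma evalMat_eq (g : GL (Fin n) k) (f : Rn n k) :
    eval (evalMat g) f = evm (g : Mn n k) f := by
  simp only [evm, aeval_eq_eval]
  rfl

/-- the variable `x_{ij}` -/
noncomputable def xv (i j : Fin n) : Rn n k := X (toLex (i, j))

@[simp] lemma evm_xv (A : Mn n k) (i j : Fin n) : evm A (xv i j) = A i j := by
  simp [evm, xv]

/-- the generic matrix -/
noncomputable def xm (n : ℕ) (k : Type*) [Field k] : Matrix (Fin n) (Fin n) (Rn n k) :=
  Matrix.of fun i j => xv i j

/-- substitution of a matrix of polynomials -/
noncomputable def subst {S : Type*} [CommRing S] [Algebra k S]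
    (Y : Matrix (Fin n) (Fin n) S) : Rn n k →ₐ[k] S :=
  aeval (fun p => Y (ofLex p).1 (ofLex p).2)

@[simp] lemma subst_xv {S : Type*} [CommRing S] [Algebra k S]
    (Y : Matrix (Fin n) (Fin n) S) (i j : Fin n) : subst Y (xv i j : Rn n k) = Y i j := by
  simp [subst, xv]

lemma Rn_algHom_ext {S : Type*} [CommSemiring S] [Algebra k S] {φ ψ : Rn n k →ₐ[k] S}
    (h : ∀ i j, φ (xv i j) = ψ (xv i j)) : φ = ψ := by
  apply MvPolynomial.algHom_ext
  intro p
  exact h (ofLex p).1 (ofLex p).2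

lemma algHom_comp_subst {S T : Type*} [CommRing S] [Algebra k S] [CommRing T] [Algebra k T]
    (φ : S →ₐ[k] T) (Y : Matrix (Fin n) (Fin n) S) (f : Rn n k) :
    φ (subst Y f) = subst (Y.map φ) f := by
  have : φ.comp (subst Y) = subst (Y.map φ) := Rn_algHom_ext (by intro i j; simp)
  exact DFunLike.congr_fun this f

lemma evm_eq_subst (A : Mn n k) : (evm A : Rn n k →ₐ[k] k) = subst A := rfl

/-- right translation -/
noncomputable def rho (g : Mn n k) : Rn n k →ₐ[k] Rn n k :=
  subst (xm n k * g.map C)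

/-- left translation -/
noncomputable def lam (g : Mn n k) : Rn n k →ₐ[k] Rn n k :=
  subst (g.map C * xm n k)

@[simp] lemma rho_xv (g : Mn n k) (i j : Fin n) :
    rho g (xv i j) = ∑ l, xv i l * C (g l j) := by
  simp [rho, xm, Matrix.mul_apply]

@[simp] lemma lam_xv (g : Mn n k) (i j : Fin n) :
    lam g (xv i j) = ∑ l, C (g i l) * xv l j := by
  simp [lam, xm, Matrix.mul_apply]

lemma evm_C (A : Mn n k) (c : k) : evm A (C c : Rn n k) = c := by
  simp [evm]

@[simp] lemma evm_rho (A g : Mn n k) (f : Rn n k) : evm A (rho g f) = evm (A * g) f := by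
  have : (evm A).comp (rho g) = evm (A * g) := Rn_algHom_ext (by
    intro i j; simp [Matrix.mul_apply, evm_C])
  exact DFunLike.congr_fun this f

@[simp] lemma evm_lam (A g : Mn n k) (f : Rn n k) : evm A (lam g f) = evm (g * A) f := by
  have : (evm A).comp (lam g) = evm (g * A) := Rn_algHom_ext (by
    intro i j; simp [Matrix.mul_apply, evm_C])
  exact DFunLike.congr_fun this f

lemma evm_ext [Infinite k] {f g : Rn n k} (h : ∀ A : Mn n k, evm A f = evm A g) : f = g := by
  apply MvPolynomial.funext
  intro x
  have := h (Matrix.of fun i j => x (toLex (i, j)))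
  simpa [evm, aeval_eq_eval] using this

noncomputable def dt (n : ℕ) (k : Type*) [Field k] : Rn n k := (xm n k).det

@[simp] lemma evm_dt (A : Mn n k) : evm A (dt n k) = A.det := by
  rw [dt, AlgHom.map_det]
  congr 1
  ext i j
  simp [xm]

lemma dt_ne_zero : dt n k ≠ 0 := by
  intro h
  have := evm_dt (1 : Mn n k)
  rw [h] at this
  simp at this

lemma evm_ext_GL [Infinite k] {f g : Rn n k} (h : ∀ A : GL (Fin n) k, evm (A : Mn n k) f
    = evm (A : Mn n k) g) : f = g := by
  have : dt n k * f = dt n k * g := by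
    apply evm_ext
    intro A
    rw [map_mul, map_mul, evm_dt]
    by_cases hA : A.det = 0
    · rw [hA, zero_mul, zero_mul]
    · have := h (Matrix.GeneralLinearGroup.mkOfDetNeZero A hA)
      congr 1
  exact mul_left_cancel₀ dt_ne_zero this

lemma rho_rho [Infinite k] (g h : Mn n k) (f : Rn n k) : rho g (rho h f) = rho (g * h) f :=
  evm_ext (by intro A; simp [mul_assoc])

lemma lam_lam [Infinite k] (g h : Mn n k) (f : Rn n k) : lam g (lam h f) = lam (h * g) f :=
  evm_ext (by intro A; simp [mul_assoc])

lemma rho_lam [Infinite k] (g h : Mn n k) (f : Rn n k) : rho g (lam h f) = lam h (rho g f) :=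
  evm_ext (by intro A; simp [mul_assoc])

@[simp] lemma rho_one [Infinite k] (f : Rn n k) : rho 1 f = f := evm_ext (by simp)
@[simp] lemma lam_one [Infinite k] (f : Rn n k) : lam 1 f = f := evm_ext (by simp)

lemma totalDegree_subst_le (Y : Matrix (Fin n) (Fin n) (Rn n k))
    (hY : ∀ i j, (Y i j).totalDegree ≤ 1) (f : Rn n k) :
    (subst Y f).totalDegree ≤ f.totalDegree := by
  rw [subst, aeval_def, eval₂_eq]
  apply totalDegree_finsetSum_le
  intro d hd
  refine (totalDegree_mul _ _).trans ?_
  rw [algebraMap_eq, totalDegree_C, zero_add]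
  refine (totalDegree_finset_prod _ _).trans ?_
  refine (Finset.sum_le_sum (g := fun i => d i) ?_).trans ?_
  · intro i _
    refine (totalDegree_pow _ _).trans ?_
    calc _ ≤ d i * 1 := Nat.mul_le_mul_left _ (hY _ _)
      _ = d i := mul_one _
  · exact le_totalDegree hd

lemma xv_deg (i j : Fin n) : (xv i j : Rn n k).totalDegree ≤ 1 := by
  unfold xv; exact (totalDegree_X _).le

lemma totalDegree_rho_le (g : Mn n k) (f : Rn n k) : (rho g f).totalDegree ≤ f.totalDegree := by
  apply totalDegree_subst_le
  intro i j
  rw [Matrix.mul_apply]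
  apply totalDegree_finsetSum_le
  intro l _
  refine (totalDegree_mul _ _).trans ?_
  rw [Matrix.map_apply, totalDegree_C]
  exact xv_deg _ _

lemma totalDegree_lam_le (g : Mn n k) (f : Rn n k) : (lam g f).totalDegree ≤ f.totalDegree := by
  apply totalDegree_subst_le
  intro i j
  rw [Matrix.mul_apply]
  apply totalDegree_finsetSum_le
  intro l _
  refine (totalDegree_mul _ _).trans ?_
  rw [Matrix.map_apply, totalDegree_C, zero_add]
  exact xv_deg _ _

/-- vanishing ideal of a subset of `GL_n` -/
noncomputable def vI (Y : Set (GL (Fin n) k)) : Ideal (Rn n k) where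
  carrier := {f | ∀ g ∈ Y, evm (g : Mn n k) f = 0}
  add_mem' := by
    intro a b ha hb g hg
    rw [map_add, ha g hg, hb g hg, add_zero]
  zero_mem' := by intro g _; exact map_zero _
  smul_mem' := by
    intro c a ha g hg
    rw [smul_eq_mul, map_mul, ha g hg, mul_zero]

lemma mem_vI {Y : Set (GL (Fin n) k)} {f : Rn n k} :
    f ∈ vI Y ↔ ∀ g ∈ Y, evm (g : Mn n k) f = 0 := Iff.rfl

lemma vI_anti {Y Z : Set (GL (Fin n) k)} (h : Y ⊆ Z) : vI Z ≤ vI Y :=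
  fun _ hf g hg => hf g (h hg)

/-- Zariski closed -/
def ZC (Y : Set (GL (Fin n) k)) : Prop :=
  ∀ g : GL (Fin n) k, (∀ f ∈ vI Y, evm (g : Mn n k) f = 0) → g ∈ Y

lemma ZC_of (Y : Set (GL (Fin n) k)) (S : Set (Rn n k))
    (h : ∀ g, g ∈ Y ↔ ∀ f ∈ S, evm (g : Mn n k) f = 0) : ZC Y := by
  intro g hg
  rw [h]
  intro f hf
  apply hg
  intro x hx
  exact (h x).1 hx f hf

lemma ZC_union {Y Z : Set (GL (Fin n) k)} (hY : ZC Y) (hZ : ZC Z) : ZC (Y ∪ Z) := by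
  intro g hg
  by_contra hne
  rw [Set.mem_union, not_or] at hne
  have h1 : ∃ f ∈ vI Y, evm (g : Mn n k) f ≠ 0 := by
    by_contra h; push Not at h; exact hne.1 (hY g h)
  have h2 : ∃ f ∈ vI Z, evm (g : Mn n k) f ≠ 0 := by
    by_contra h; push Not at h; exact hne.2 (hZ g h)
  obtain ⟨f, hf, hf0⟩ := h1
  obtain ⟨f', hf', hf0'⟩ := h2
  have := hg (f * f') (by
    rintro x (hx | hx)
    · rw [map_mul, hf x hx, zero_mul]
    · rw [map_mul, hf' x hx, mul_zero])
  rw [map_mul] at this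
  exact mul_ne_zero hf0 hf0' this

lemma ZC_empty : ZC (∅ : Set (GL (Fin n) k)) := by
  intro g hg
  have := hg 1 (by intro x hx; exact hx.elim)
  simp at this

lemma ZC_biUnion {ι : Type*} (t : Finset ι) (Y : ι → Set (GL (Fin n) k))
    (h : ∀ i ∈ t, ZC (Y i)) : ZC (⋃ i ∈ t, Y i) := by
  classical
  induction t using Finset.induction_on with
  | empty => simpa using ZC_empty
  | insert a t ha ih =>
    rw [Finset.set_biUnion_insert]
    exact ZC_union (h a (Finset.mem_insert_self _ _))
      (ih fun i hi => h i (Finset.mem_insert_of_mem hi))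

lemma irr_union {Y : Set (GL (Fin n) k)} (hY : (vI Y).IsPrime) {ι : Type*} (t : Finset ι)
    (Z : ι → Set (GL (Fin n) k)) (hZ : ∀ i ∈ t, ZC (Z i)) (hsub : Y ⊆ ⋃ i ∈ t, Z i) :
    ∃ i ∈ t, Y ⊆ Z i := by
  classical
  by_contra hne
  push Not at hne
  have h1 : ∀ i ∈ t, ∃ f ∈ vI (Z i), f ∉ vI Y := by
    intro i hi
    by_contra h
    push Not at h
    exact hne i hi fun y hy => hZ i hi y fun f hf => h f hf y hy
  choose! f hf hfY using h1
  have h2 : ∏ i ∈ t, f i ∈ vI Y := by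
    intro y hy
    have := hsub hy
    rw [Set.mem_iUnion₂] at this
    obtain ⟨i, hi, hyi⟩ := this
    rw [map_prod]
    exact Finset.prod_eq_zero hi (hf i hi y hyi)
  rw [hY.prod_mem_iff] at h2
  obtain ⟨i, hi, h3⟩ := h2
  exact hfY i hi h3

/-- left translate -/
def ltr (g : GL (Fin n) k) (Y : Set (GL (Fin n) k)) : Set (GL (Fin n) k) := {x | g⁻¹ * x ∈ Y}
/-- right translate -/
def rtr (g : GL (Fin n) k) (Y : Set (GL (Fin n) k)) : Set (GL (Fin n) k) := {x | x * g⁻¹ ∈ Y}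

lemma vI_ltr (g : GL (Fin n) k) (Y : Set (GL (Fin n) k)) :
    vI (ltr g Y) = (vI Y).comap (lam (g : Mn n k)) := by
  ext f
  rw [Ideal.mem_comap, mem_vI, mem_vI]
  constructor
  · intro h x hx
    rw [evm_lam]
    have := h (g * x) (by simpa [ltr] using hx)
    simpa using this
  · intro h x hx
    have := h _ hx
    rw [evm_lam] at this
    simpa using this

lemma vI_rtr (g : GL (Fin n) k) (Y : Set (GL (Fin n) k)) :
    vI (rtr g Y) = (vI Y).comap (rho (g : Mn n k)) := by
  ext f
  rw [Ideal.mem_comap, mem_vI, mem_vI]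
  constructor
  · intro h x hx
    rw [evm_rho]
    have := h (x * g) (by simpa [rtr] using hx)
    simpa using this
  · intro h x hx
    have := h _ hx
    rw [evm_rho] at this
    simpa [mul_assoc] using this

lemma ZC_ltr (g : GL (Fin n) k) {Y : Set (GL (Fin n) k)} (h : ZC Y) : ZC (ltr g Y) := by
  intro x hx
  apply h
  intro f hf
  have := hx (lam ((g⁻¹ : GL (Fin n) k) : Mn n k) f) (by
    intro y hy
    rw [evm_lam]
    have := hf _ hy
    simpa using this)
  rw [evm_lam] at this
  simpa using this

lemma ZC_rtr (g : GL (Fin n) k) {Y : Set (GL (Fin n) k)} (h : ZC Y) : ZC (rtr g Y) := by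
  intro x hx
  apply h
  intro f hf
  have := hx (rho ((g⁻¹ : GL (Fin n) k) : Mn n k) f) (by
    intro y hy
    rw [evm_rho]
    have := hf _ hy
    simpa using this)
  rw [evm_rho] at this
  simpa using this

end GLbasic

open MvPolynomial Matrix Pointwise
set_option linter.unusedSectionVars false
set_option linter.deprecated false

section Topo
variable {k : Type*} [Field k] {n : ℕ}

lemma zariski_open_iff (U : Set (GL (Fin n) k)) :
    @IsOpen _ (zariskiGL n k) U ↔ ∃ S : Set (Rn n k), U = {g | ∃ p ∈ S, eval (evalMat g) p ≠ 0} := by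
  constructor
  · intro h
    change TopologicalSpace.GenerateOpen _ U at h
    induction h with
    | basic s hs => exact hs
    | univ =>
      refine ⟨{1}, ?_⟩
      ext g; simp
    | inter s t _ _ h1 h2 =>
      obtain ⟨S, rfl⟩ := h1
      obtain ⟨T, rfl⟩ := h2
      refine ⟨{p | ∃ a ∈ S, ∃ b ∈ T, p = a * b}, ?_⟩
      ext g
      constructor
      · rintro ⟨⟨a, ha, ha0⟩, ⟨b, hb, hb0⟩⟩
        exact ⟨a * b, ⟨a, ha, b, hb, rfl⟩, by rw [map_mul]; exact mul_ne_zero ha0 hb0⟩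
      · rintro ⟨_, ⟨a, ha, b, hb, rfl⟩, h⟩
        rw [map_mul] at h
        exact ⟨⟨a, ha, left_ne_zero_of_mul h⟩, ⟨b, hb, right_ne_zero_of_mul h⟩⟩
    | sUnion 𝒮 _ ih =>
      refine ⟨{p | ∃ s ∈ 𝒮, ∀ g, eval (evalMat g) p ≠ 0 → g ∈ s}, ?_⟩
      ext g
      constructor
      · rintro ⟨s, hs, hg⟩
        obtain ⟨S, rfl⟩ := ih s hs
        obtain ⟨p, hp, hp0⟩ := hg
        exact ⟨p, ⟨_, hs, fun g hg => ⟨p, hp, hg⟩⟩, hp0⟩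
      · rintro ⟨p, ⟨s, hs, h⟩, hp0⟩
        exact ⟨s, hs, h g hp0⟩
  · rintro ⟨S, rfl⟩
    exact TopologicalSpace.GenerateOpen.basic _ ⟨S, rfl⟩

lemma zariski_closed_iff (Y : Set (GL (Fin n) k)) : @IsClosed _ (zariskiGL n k) Y ↔ ZC Y := by
  rw [← @isOpen_compl_iff _ _ (zariskiGL n k), zariski_open_iff]
  constructor
  · rintro ⟨S, hS⟩
    apply ZC_of Y S
    intro g
    rw [← not_iff_not, ← Set.mem_compl_iff, hS]
    simp [evalMat_eq]
  · intro h
    refine ⟨vI Y, ?_⟩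
    ext g
    rw [Set.mem_compl_iff, not_iff_comm]
    constructor
    · intro h0
      apply h
      intro f hf
      by_contra h1
      exact h0 ⟨f, hf, by rwa [evalMat_eq]⟩
    · rintro hg ⟨f, hf, h1⟩
      rw [evalMat_eq] at h1
      exact h1 (hf g hg)

/-- finite index -/
def FinIdx (C H : Set (GL (Fin n) k)) : Prop :=
  ∃ t : Finset (GL (Fin n) k), (∀ x ∈ t, x ∈ H) ∧ ∀ h ∈ H, ∃ x ∈ t, x⁻¹ * h ∈ C

lemma idComponent_eq (C H : Subgroup (GL (Fin n) k)) (hCH : C ≤ H)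
    (hC : ZC (C : Set (GL (Fin n) k))) (hP : (vI (C : Set (GL (Fin n) k))).IsPrime)
    (hfi : FinIdx (C : Set (GL (Fin n) k)) H) : idComponent H = C := by
  classical
  let _ := zariskiGL n k
  let C' : Set H := Subtype.val ⁻¹' (C : Set (GL (Fin n) k))
  have h1C : (⟨1, H.one_mem⟩ : H) ∈ C' := C.one_mem
  have himg : (Subtype.val : H → GL (Fin n) k) '' C' = (C : Set (GL (Fin n) k)) := by
    ext x
    constructor
    · rintro ⟨y, hy, rfl⟩
      exact hy
    · intro hx
      exact ⟨⟨x, hCH hx⟩, hx, rfl⟩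
  have hclosed : IsClosed C' := by
    apply IsClosed.preimage continuous_subtype_val
    exact (zariski_closed_iff _).2 hC
  have hopen : IsOpen C' := by
    obtain ⟨t, htH, ht⟩ := hfi
    rw [← isClosed_compl_iff]
    have : C'ᶜ = Subtype.val ⁻¹' (⋃ x ∈ t.filter (fun x => x ∉ C), ltr x (C : Set (GL (Fin n) k))) := by
      ext ⟨h, hh⟩
      simp only [Set.mem_compl_iff, Set.mem_preimage, Set.mem_iUnion, Finset.mem_filter, C', ltr,
        SetLike.mem_coe, Set.mem_setOf_eq]
      constructor
      · intro h0
        obtain ⟨x, hx, hxc⟩ := ht h hh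
        refine ⟨x, ⟨hx, fun h1 => h0 ?_⟩, hxc⟩
        have := C.mul_mem h1 hxc
        simpa using this
      · rintro ⟨x, ⟨hx, hxC⟩, h1⟩ h0
        apply hxC
        have := C.mul_mem h0 (C.inv_mem h1)
        simpa using this
    rw [this]
    apply IsClosed.preimage continuous_subtype_val
    exact (zariski_closed_iff _).2 (ZC_biUnion _ _ fun i _ => ZC_ltr i hC)
  have hconn : IsPreconnected C' := by
    have hi : Topology.IsInducing (Subtype.val : H → GL (Fin n) k) := Topology.IsInducing.subtypeVal
    rw [← hi.isPreconnected_image, himg]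
    apply IsPreirreducible.isPreconnected
    rw [isPreirreducible_iff_isClosed_union_isClosed]
    intro Z1 Z2 h1 h2 hsub
    rw [zariski_closed_iff] at h1 h2
    obtain ⟨i, _, hi⟩ := irr_union hP (Finset.univ : Finset Bool) (fun b => cond b Z1 Z2)
      (by rintro (_|_) _ <;> assumption)
      (by
        intro x hx
        rw [Set.mem_iUnion₂]
        rcases hsub hx with h | h
        · exact ⟨true, Finset.mem_univ _, h⟩
        · exact ⟨false, Finset.mem_univ _, h⟩)
    cases i
    · right; exact hi
    · left; exact hi
  have : connectedComponent (⟨1, H.one_mem⟩ : H) = C' :=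
    Set.Subset.antisymm (IsClopen.connectedComponent_subset ⟨hclosed, hopen⟩ h1C)
      (hconn.subset_connectedComponent h1C)
  unfold idComponent
  rw [this, himg]

end Topo

open MvPolynomial Matrix Pointwise
set_option linter.unusedSectionVars false
set_option linter.deprecated false

section Comp
variable {k : Type*} [Field k] [Infinite k] {n : ℕ}

lemma comap_rho_rho (a b : Mn n k) (P : Ideal (Rn n k)) :
    (P.comap (rho b)).comap (rho a) = P.comap (rho (b * a)) := by
  ext f
  simp only [Ideal.mem_comap, rho_rho]

lemma comap_rho_one (P : Ideal (Rn n k)) : P.comap (rho (1 : Mn n k)) = P := by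
  ext f
  simp only [Ideal.mem_comap, rho_one]

lemma vI_subgroup_comap (H : Subgroup (GL (Fin n) k)) {h : GL (Fin n) k} (hh : h ∈ H) :
    (vI (H : Set (GL (Fin n) k))).comap (rho (h : Mn n k)) = vI (H : Set (GL (Fin n) k)) := by
  rw [← vI_rtr]
  congr 1
  ext x
  constructor
  · intro hx
    have := H.mul_mem hx hh
    simpa using this
  · intro hx
    exact H.mul_mem hx (H.inv_mem hh)

lemma comap_min (H : Subgroup (GL (Fin n) k)) {h : GL (Fin n) k} (hh : h ∈ H)
    {P : Ideal (Rn n k)} (hP : P ∈ (vI (H : Set (GL (Fin n) k))).minimalPrimes) :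
    P.comap (rho (h : Mn n k)) ∈ (vI (H : Set (GL (Fin n) k))).minimalPrimes := by
  have hPp : P.IsPrime := hP.1.1
  have hinv : ((h⁻¹ : GL (Fin n) k) : Mn n k) * h = 1 := by rw [← Units.val_mul]; simp
  have hinv' : (h : Mn n k) * ((h⁻¹ : GL (Fin n) k) : Mn n k) = 1 := by rw [← Units.val_mul]; simp
  refine ⟨⟨Ideal.IsPrime.comap _, ?_⟩, ?_⟩
  · have := Ideal.comap_mono (f := rho (h : Mn n k)) hP.1.2
    rwa [vI_subgroup_comap H hh] at this
  · rintro Q ⟨hQp, hQ⟩ hle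
    have h1 := Ideal.comap_mono (f := rho ((h⁻¹ : GL (Fin n) k) : Mn n k)) hle
    rw [comap_rho_rho, hinv', comap_rho_one] at h1
    have h2 := Ideal.comap_mono (f := rho ((h⁻¹ : GL (Fin n) k) : Mn n k)) hQ
    rw [vI_subgroup_comap H (H.inv_mem hh)] at h2
    have h3 := hP.2 ⟨Ideal.IsPrime.comap _, h2⟩ h1
    have h4 := Ideal.comap_mono (f := rho (h : Mn n k)) h3
    rwa [comap_rho_rho, hinv, comap_rho_one] at h4

lemma vI_ZP (Y : Set (GL (Fin n) k))
    {P : Ideal (Rn n k)} (hP : P ∈ (vI Y).minimalPrimes) :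
    vI {h | h ∈ Y ∧ ∀ f ∈ P, evm (h : Mn n k) f = 0} = P := by
  classical
  have hPp : P.IsPrime := hP.1.1
  apply le_antisymm
  · intro f hf
    have hfin := Ideal.finite_minimalPrimes_of_isNoetherianRing (Rn n k) (vI Y)
    have h1 : ∀ Q ∈ hfin.toFinset.erase P, ∃ d ∈ Q, d ∉ P := by
      intro Q hQ
      rw [Finset.mem_erase, Set.Finite.mem_toFinset] at hQ
      by_contra h
      push Not at h
      exact hQ.1 (le_antisymm h (hP.2 hQ.2.1 h))
    choose! d hd hdP using h1
    have h2 : f * ∏ Q ∈ hfin.toFinset.erase P, d Q ∈ vI Y := by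
      intro h hh
      have hker : (RingHom.ker (evm (h : Mn n k))).IsPrime := RingHom.ker_isPrime _
      obtain ⟨Q, hQm, hQ⟩ := Ideal.exists_minimalPrimes_le (I := vI Y)
        (J := RingHom.ker (evm (h : Mn n k))) (fun g hg => hg h hh)
      rw [map_mul, map_prod]
      by_cases hQP : Q = P
      · subst hQP
        rw [hf h ⟨hh, fun g hg => hQ hg⟩, zero_mul]
      · have hmem : Q ∈ hfin.toFinset.erase P := by
          rw [Finset.mem_erase, Set.Finite.mem_toFinset]; exact ⟨hQP, hQm⟩
        rw [Finset.prod_eq_zero hmem ((RingHom.mem_ker).1 (hQ (hd Q hmem))), mul_zero]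
    have h3 := hP.1.2 h2
    rcases hPp.mem_or_mem h3 with h | h
    · exact h
    · rw [hPp.prod_mem_iff] at h
      obtain ⟨Q, hQ, h4⟩ := h
      exact absurd h4 (hdP Q hQ)
  · intro f hf h hh
    exact hh.2 f hf

lemma exists_comp (H : Subgroup (GL (Fin n) k)) (hH : ZC (H : Set (GL (Fin n) k))) :
    ∃ C : Subgroup (GL (Fin n) k), C ≤ H ∧ ZC (C : Set (GL (Fin n) k)) ∧
      (vI (C : Set (GL (Fin n) k))).IsPrime ∧ FinIdx (C : Set (GL (Fin n) k)) H := by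
  classical
  set I := vI (H : Set (GL (Fin n) k)) with hI
  have hfin := Ideal.finite_minimalPrimes_of_isNoetherianRing (Rn n k) I
  let C : Subgroup (GL (Fin n) k) :=
    { carrier := {h | h ∈ H ∧ ∀ P ∈ I.minimalPrimes, P.comap (rho (h : Mn n k)) = P}
      one_mem' := ⟨H.one_mem, fun P _ => comap_rho_one P⟩
      mul_mem' := by
        rintro a b ⟨ha, ha'⟩ ⟨hb, hb'⟩
        refine ⟨H.mul_mem ha hb, fun P hP => ?_⟩
        rw [Units.val_mul, ← comap_rho_rho, ha' P hP, hb' P hP]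
      inv_mem' := by
        rintro a ⟨ha, ha'⟩
        refine ⟨H.inv_mem ha, fun P hP => ?_⟩
        conv_lhs => rw [← ha' P hP]
        rw [comap_rho_rho, ← Units.val_mul]
        simpa using comap_rho_one P }
  have memC : ∀ h, h ∈ C ↔ h ∈ H ∧ ∀ P ∈ I.minimalPrimes, P.comap (rho (h : Mn n k)) = P :=
    fun h => Iff.rfl
  have hCH : C ≤ H := fun h hh => hh.1
  have hZC : ZC (C : Set (GL (Fin n) k)) := by
    intro g hg
    have hgH : g ∈ H := hH g fun f hf => hg f (vI_anti hCH hf)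
    refine (memC g).2 ⟨hgH, fun P hP => ?_⟩
    have h1 : P ≤ P.comap (rho (g : Mn n k)) := by
      intro f hf
      rw [Ideal.mem_comap]
      have h2 : rho (g : Mn n k) f ∈ vI {h | h ∈ (H : Set (GL (Fin n) k)) ∧
          ∀ f ∈ P, evm (h : Mn n k) f = 0} := by
        rintro a ⟨haH, haP⟩
        rw [evm_rho]
        have := hg (lam (a : Mn n k) f) (by
          intro c hc
          rw [evm_lam, ← evm_rho]
          apply haP
          rw [← Ideal.mem_comap, ((memC c).1 hc).2 P hP]
          exact hf)
        rwa [evm_lam] at this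
      rwa [vI_ZP _ hP] at h2
    exact le_antisymm ((comap_min H hgH hP).2 hP.1 h1) h1
  have hfi : ∃ t : Finset (GL (Fin n) k), (∀ x ∈ t, x ∈ H) ∧ ∀ h ∈ H, ∃ x ∈ t, h * x⁻¹ ∈ C := by
    have : Finite I.minimalPrimes := hfin
    let φ : H → (I.minimalPrimes → I.minimalPrimes) := fun h P =>
      ⟨P.1.comap (rho (h.1 : Mn n k)), comap_min H h.2 P.2⟩
    have hr : (Set.range φ).Finite := Set.toFinite _
    choose s hs using fun y : Set.range φ => y.2
    have : Fintype (Set.range φ) := hr.fintype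
    refine ⟨Finset.univ.image fun y => (s y).1, ?_, ?_⟩
    · intro x hx
      rw [Finset.mem_image] at hx
      obtain ⟨y, _, rfl⟩ := hx
      exact (s y).2
    · intro h hh
      refine ⟨(s ⟨φ ⟨h, hh⟩, ⟨h, hh⟩, rfl⟩).1, Finset.mem_image_of_mem _ (Finset.mem_univ _), ?_⟩
      have h1 := hs ⟨φ ⟨h, hh⟩, ⟨h, hh⟩, rfl⟩
      generalize s ⟨φ ⟨h, hh⟩, ⟨h, hh⟩, rfl⟩ = x at h1 ⊢
      refine (memC _).2 ⟨H.mul_mem hh (H.inv_mem x.2), fun P hP => ?_⟩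
      have h2 : P.comap (rho (x.1 : Mn n k)) = P.comap (rho (h : Mn n k)) :=
        congrArg Subtype.val (congrFun h1 ⟨P, hP⟩)
      rw [Units.val_mul, ← comap_rho_rho, ← h2, comap_rho_rho, ← Units.val_mul]
      simpa using comap_rho_one P
  refine ⟨C, hCH, hZC, ?_, ?_⟩
  · have hker : (RingHom.ker (evm ((1 : GL (Fin n) k) : Mn n k))).IsPrime := RingHom.ker_isPrime _
    obtain ⟨P, hPm, hP1⟩ := Ideal.exists_minimalPrimes_le (I := I)
      (J := RingHom.ker (evm ((1 : GL (Fin n) k) : Mn n k))) (fun g hg => hg 1 H.one_mem)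
    have hPp : P.IsPrime := hPm.1.1
    have hZP := vI_ZP _ hPm
    set Z := {h | h ∈ (H : Set (GL (Fin n) k)) ∧ ∀ f ∈ P, evm (h : Mn n k) f = 0} with hZ
    have h1 : (C : Set (GL (Fin n) k)) ⊆ Z := by
      intro c hc
      refine ⟨hCH hc, fun f hf => ?_⟩
      rw [← ((memC c).1 hc).2 P hPm, Ideal.mem_comap] at hf
      have := hP1 hf
      rw [RingHom.mem_ker, evm_rho] at this
      simpa using this
    obtain ⟨t, htH, ht⟩ := hfi
    have hPZ : (vI Z).IsPrime := by rw [hZP]; exact hPp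
    obtain ⟨x, hx, hxs⟩ := irr_union hPZ t (fun x => rtr x (C : Set (GL (Fin n) k)))
      (fun i _ => ZC_rtr i hZC) (by
        intro z hz
        rw [Set.mem_iUnion₂]
        obtain ⟨x, hx, h2⟩ := ht z hz.1
        exact ⟨x, hx, h2⟩)
    have h1Z : (1 : GL (Fin n) k) ∈ Z := h1 C.one_mem
    have hxC : (1 : GL (Fin n) k) * x⁻¹ ∈ C := hxs h1Z
    have h2 : Z ⊆ C := by
      intro z hz
      have h3 : z * x⁻¹ ∈ C := hxs hz
      have := C.mul_mem h3 (C.inv_mem hxC)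
      simpa using this
    rw [Set.Subset.antisymm h1 h2]
    exact hPZ
  · obtain ⟨t, htH, ht⟩ := hfi
    refine ⟨t.image fun x => x⁻¹, ?_, ?_⟩
    · intro x hx
      rw [Finset.mem_image] at hx
      obtain ⟨y, hy, rfl⟩ := hx
      exact H.inv_mem (htH y hy)
    · intro h hh
      obtain ⟨x, hx, h1⟩ := ht h⁻¹ (H.inv_mem hh)
      refine ⟨x⁻¹, Finset.mem_image_of_mem _ hx, ?_⟩
      have := C.inv_mem h1
      simpa using this

/-- conjugation stability of the identity component -/
lemma comp_conj (C H : Subgroup (GL (Fin n) k)) (hCH : C ≤ H)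
    (hC : ZC (C : Set (GL (Fin n) k))) (hP : (vI (C : Set (GL (Fin n) k))).IsPrime)
    (hfi : FinIdx (C : Set (GL (Fin n) k)) H) (g : GL (Fin n) k)
    (hg : ∀ h, h ∈ H → g * h * g⁻¹ ∈ H) (hg' : ∀ h, h ∈ H → g⁻¹ * h * g ∈ H) :
    ∀ c ∈ C, g * c * g⁻¹ ∈ C := by
  classical
  let C' : Subgroup (GL (Fin n) k) := C.map (MulAut.conj g).toMonoidHom
  have memC' : ∀ x, x ∈ C' ↔ g⁻¹ * x * g ∈ C := by
    intro x
    constructor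
    · rintro ⟨c, hc, rfl⟩
      simpa [mul_assoc] using hc
    · intro h
      exact ⟨_, h, by simp [mul_assoc]⟩
  have hset : (C' : Set (GL (Fin n) k)) = ltr g (rtr g⁻¹ (C : Set (GL (Fin n) k))) := by
    ext x
    rw [SetLike.mem_coe, memC']
    simp [ltr, rtr]
  have h1 := idComponent_eq C H hCH hC hP hfi
  have h2 := idComponent_eq C' H (by
      intro x hx
      have := hg _ (hCH ((memC' x).1 hx))
      simpa [mul_assoc] using this) (by
      rw [hset]; exact ZC_ltr _ (ZC_rtr _ hC)) (by
      rw [hset, vI_ltr, vI_rtr]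
      exact Ideal.IsPrime.comap _ (hK := Ideal.IsPrime.comap _)) (by
      obtain ⟨t, htH, ht⟩ := hfi
      refine ⟨t.image fun x => g * x * g⁻¹, ?_, ?_⟩
      · intro x hx
        rw [Finset.mem_image] at hx
        obtain ⟨y, hy, rfl⟩ := hx
        exact hg _ (htH y hy)
      · intro h hh
        obtain ⟨x, hx, hxc⟩ := ht _ (hg' h hh)
        refine ⟨_, Finset.mem_image_of_mem _ hx, ?_⟩
        rw [SetLike.mem_coe, memC']
        simpa [mul_assoc] using hxc)
  intro c hc
  have : g * c * g⁻¹ ∈ (C' : Set (GL (Fin n) k)) := by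
    rw [SetLike.mem_coe, memC']; simpa [mul_assoc] using hc
  rw [← h2, h1] at this
  exact this

end Comp

open MvPolynomial Matrix Pointwise
set_option linter.unusedSectionVars false
set_option linter.deprecated false

section LemS
variable {k : Type*} [Field k] {σ : Type*} [Fintype σ]

lemma TrGe_le_card {Q : Ideal (MvPolynomial σ k)} {m : ℕ} (h : TrGe Q m) :
    m ≤ Fintype.card σ := by
  obtain ⟨y, hy⟩ := h
  let e := renameEquiv k (Fintype.equivFin σ).symm
  refine card_le_of_integral (s := Fintype.card σ) (e : _ →ₐ[k] MvPolynomial σ k) ?_ y ?_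
  · apply RingHom.isIntegral_of_surjective
    exact e.surjective
  · rw [algebraicIndependent_iff]
    intro p hp
    apply hy
    rw [hp]
    exact Q.zero_mem

lemma TrGe_succ_of_lt {Q Q' : Ideal (MvPolynomial σ k)} (hQ' : Q'.IsPrime) (hlt : Q' < Q)
    {m : ℕ} (h : TrGe Q m) : TrGe Q' (m + 1) := by
  obtain ⟨y, hy⟩ := h
  obtain ⟨f, hfQ, hfQ'⟩ := Set.exists_of_ssubset hlt
  have key : ∀ (d : ℕ) (H : Polynomial (MvPolynomial (Fin m) k)), H.natDegree ≤ d →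
      Polynomial.eval₂ (aeval y : MvPolynomial (Fin m) k →ₐ[k] MvPolynomial σ k).toRingHom f H ∈ Q'
      → H = 0 := by
    have h0 : ∀ H : Polynomial (MvPolynomial (Fin m) k),
      Polynomial.eval₂ (aeval y : MvPolynomial (Fin m) k →ₐ[k] MvPolynomial σ k).toRingHom f H ∈ Q'
      → H.coeff 0 = 0 ∧ Polynomial.eval₂
        (aeval y : MvPolynomial (Fin m) k →ₐ[k] MvPolynomial σ k).toRingHom f H.divX ∈ Q' := by
      intro H hH
      rw [← Polynomial.divX_mul_X_add H, Polynomial.eval₂_add, Polynomial.eval₂_mul,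
        Polynomial.eval₂_X, Polynomial.eval₂_C] at hH
      have h1 := hlt.le hH
      have h2 : aeval y (H.coeff 0) ∈ Q := by
        have := Q.sub_mem h1 (Q.mul_mem_left (Polynomial.eval₂
          (aeval y : MvPolynomial (Fin m) k →ₐ[k] MvPolynomial σ k).toRingHom f H.divX) hfQ)
        rwa [add_sub_cancel_left] at this
      have h3 := hy _ h2
      refine ⟨h3, ?_⟩
      rw [h3, map_zero, add_zero] at hH
      exact (hQ'.mem_or_mem hH).resolve_right hfQ'
    intro d
    induction d with
    | zero =>
      intro H hd hH
      rw [Polynomial.eq_C_of_natDegree_le_zero hd, (h0 H hH).1, map_zero]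
    | succ d ih =>
      intro H hd hH
      obtain ⟨h1, h2⟩ := h0 H hH
      have h3 := ih H.divX (by rw [Polynomial.natDegree_divX_eq_natDegree_tsub_one]; omega) h2
      rw [← Polynomial.divX_mul_X_add H, h1, h3]; simp
  refine ⟨Fin.cons f y, fun h hh => ?_⟩
  have h1 : (aeval (Fin.cons f y : Fin (m + 1) → MvPolynomial σ k) h) = Polynomial.eval₂
      (aeval y : MvPolynomial (Fin m) k →ₐ[k] MvPolynomial σ k).toRingHom f (finSuccEquiv k m h) := by
    let ψ : Polynomial (MvPolynomial (Fin m) k) →ₐ[k] MvPolynomial σ k :=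
      { Polynomial.eval₂RingHom (aeval y : MvPolynomial (Fin m) k →ₐ[k] MvPolynomial σ k).toRingHom f with
        commutes' := by
          intro r
          simp [Polynomial.algebraMap_apply] }
    have : aeval (Fin.cons f y : Fin (m + 1) → MvPolynomial σ k)
        = ψ.comp (finSuccEquiv k m : _ →ₐ[k] _) := by
      apply MvPolynomial.algHom_ext
      intro i
      refine Fin.cases ?_ (fun j => ?_) i
      · simp [ψ, finSuccEquiv_X_zero]
      · simp [ψ, finSuccEquiv_X_succ]
    rw [this]; rfl
  rw [h1] at hh
  have := key _ _ le_rfl hh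
  exact (finSuccEquiv k m).injective (by rw [this, map_zero])

/-- Hilbert function bound from a parametrization -/
lemma HF_param (Q : Ideal (MvPolynomial σ k)) (φ : MvPolynomial σ k →ₐ[k] MvPolynomial ℕ k)
    (hQ : Q = RingHom.ker φ) (m n : ℕ)
    (hφ : ∀ p l, degreeOf l (φ p) ≤ if l < m then n * p.totalDegree else 0) (s : ℕ) :
    HF Q s ≤ (n * s + 1) ^ m := by
  classical
  let T : Finset (MvPolynomial ℕ k) := Finset.univ.image
    (fun c : Fin m → Fin (n * s + 1) =>
      monomial (∑ i : Fin m, Finsupp.single (i : ℕ) ((c i : ℕ))) (1 : k))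
  subst hQ
  let ψ : (MvPolynomial σ k ⧸ RingHom.ker φ) →ₗ[k] MvPolynomial ℕ k :=
    (Ideal.kerLiftAlg φ).toLinearMap
  have hψ : Function.Injective ψ := Ideal.kerLiftAlg_injective φ
  have hsub : ((restrictTotalDegree σ k s).map
      (Ideal.Quotient.mkₐ k (RingHom.ker φ)).toLinearMap).map ψ ≤ Submodule.span k (T : Set _) := by
    rintro _ ⟨_, ⟨p, hp, rfl⟩, rfl⟩
    change φ p ∈ _
    have hp' := (mem_restrictTotalDegree _ _ _).1 hp
    rw [(φ p).as_sum]
    apply Submodule.sum_mem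
    intro d hd
    have h1 : monomial d (coeff d (φ p)) = coeff d (φ p) • monomial d (1 : k) := by
      rw [smul_monomial, smul_eq_mul, mul_one]
    rw [h1]
    apply Submodule.smul_mem
    apply Submodule.subset_span
    rw [Finset.mem_coe, Finset.mem_image]
    have h2 : ∀ l, d l ≤ if l < m then n * s else 0 := by
      intro l
      have := (monomial_le_degreeOf l hd).trans (hφ p l)
      split_ifs at this ⊢ with h
      · exact this.trans (Nat.mul_le_mul_left _ hp')
      · exact this
    refine ⟨fun i => ⟨d i, ?_⟩, Finset.mem_univ _, ?_⟩
    · have := h2 i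
      rw [if_pos i.2] at this
      omega
    · refine congrArg (fun z => monomial z (1 : k)) ?_
      ext l
      rw [Finsupp.finsetSum_apply]
      by_cases hl : l < m
      · rw [Finset.sum_eq_single (⟨l, hl⟩ : Fin m)]
        · simp
        · intro b _ hb
          rw [Finsupp.single_eq_of_ne]
          intro h; apply hb; ext; exact h.symm
        · intro h; exact absurd (Finset.mem_univ _) h
      · have h3 := h2 l
        rw [if_neg hl] at h3
        rw [Finset.sum_eq_zero]
        · omega
        · intro b _
          rw [Finsupp.single_eq_of_ne]
          have := b.2
          omega
  have h3 : HF (RingHom.ker φ) s = Module.finrank k (((restrictTotalDegree σ k s).map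
      (Ideal.Quotient.mkₐ k (RingHom.ker φ)).toLinearMap).map ψ) := by
    unfold HF
    exact (LinearEquiv.finrank_eq (Submodule.equivMapOfInjective ψ hψ _))
  rw [h3]
  refine (Submodule.finrank_mono hsub).trans ((finrank_span_finset_le_card T).trans ?_)
  refine Finset.card_image_le.trans ?_
  rw [Finset.card_univ, Fintype.card_fun, Fintype.card_fin, Fintype.card_fin]

end LemS

open MvPolynomial Matrix Pointwise
set_option linter.unusedSectionVars false
set_option linter.deprecated false

section Pw
variable {k : Type*} [Field k] [CharZero k] {n : ℕ}

/-- the one-parameter group of a unipotent -/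
noncomputable def pwP (u : Mn n k) : Matrix (Fin n) (Fin n) (Polynomial k) :=
  ∑ i ∈ Finset.range n, (Polynomial.C ((i.factorial : k)⁻¹) * descPochhammer k i) •
    ((u - 1) ^ i).map Polynomial.C

noncomputable def pwE (u : Mn n k) (τ : k) : Mn n k := (pwP u).map (Polynomial.aeval τ)

lemma pwE_nat (u : Mn n k) (hu : (u - 1) ^ n = 0) (j : ℕ) : pwE u (j : k) = u ^ j := by
  have h1 : pwE u (j : k) = ∑ i ∈ Finset.range n, (j.choose i : k) • (u - 1) ^ i := by
    ext a b
    simp only [pwE, pwP, Matrix.map_apply, Matrix.sum_apply, Matrix.smul_apply, map_sum,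
      smul_eq_mul, map_mul, Polynomial.aeval_C, Algebra.algebraMap_self, RingHom.id_apply]
    refine Finset.sum_congr rfl fun i _ => ?_
    congr 1
    rw [Polynomial.coe_aeval_eq_eval, descPochhammer_eval_eq_descFactorial,
      Nat.descFactorial_eq_factorial_mul_choose, Nat.cast_mul, ← mul_assoc, inv_mul_cancel₀,
      one_mul]
    exact_mod_cast Nat.factorial_ne_zero i
  have h2 : u ^ j = ∑ i ∈ Finset.range (j + 1), (j.choose i : k) • (u - 1) ^ i := by
    conv_lhs => rw [← sub_add_cancel u 1]
    rw [(Commute.one_right (u - 1)).add_pow]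
    refine Finset.sum_congr rfl fun i _ => ?_
    rw [one_pow, mul_one, ← nsmul_eq_mul', Nat.cast_smul_eq_nsmul]
  rw [h1, h2]
  rw [Finset.sum_subset (Finset.range_subset_range.2 (show n ≤ n + (j + 1) by omega)),
    Finset.sum_subset (Finset.range_subset_range.2 (show j + 1 ≤ n + (j + 1) by omega))]
  · intro i _ hi
    rw [Finset.mem_range] at hi
    rw [Nat.choose_eq_zero_of_lt (by omega), Nat.cast_zero, zero_smul]
  · intro i _ hi
    rw [Finset.mem_range] at hi
    rw [show i = n + (i - n) by omega, pow_add, hu, zero_mul, smul_zero]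

lemma poly_zero_of_nat (q : Polynomial k) (h : ∀ j : ℕ, q.eval (j : k) = 0) : q = 0 := by
  apply Polynomial.eq_zero_of_infinite_isRoot
  apply Set.infinite_of_injective_forall_mem (f := fun j : ℕ => (j : k)) Nat.cast_injective
  intro j
  exact h j

lemma pw_dens (u : Mn n k) (hu : (u - 1) ^ n = 0) (f : Rn n k)
    (hf : ∀ j : ℕ, evm (u ^ j) f = 0) (τ : k) : evm (pwE u τ) f = 0 := by
  have h1 : ∀ τ : k, evm (pwE u τ) f = Polynomial.aeval τ (subst (pwP u) f) := by
    intro τ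
    rw [algHom_comp_subst]; rfl
  have h2 : subst (pwP u) f = 0 := by
    apply poly_zero_of_nat
    intro j
    have := h1 (j : k)
    rw [pwE_nat u hu, hf j] at this
    rw [← Polynomial.coe_aeval_eq_eval]
    exact this.symm
  rw [h1, h2, map_zero]

lemma unip_pow (u : Mn n k) (hu : (u - 1) ^ n = 0) (j : ℕ) : (u ^ j - 1) ^ n = 0 := by
  rw [← mul_geom_sum]
  have hc : Commute (u - 1) (∑ i ∈ Finset.range j, u ^ i) := by
    apply Commute.sum_right
    intro i _
    exact ((Commute.refl u).sub_left (Commute.one_left u)).pow_right i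
  rw [hc.mul_pow, hu, zero_mul]

lemma evm_unip (A : Mn n k) (i j : Fin n) :
    evm A (((xm n k - 1) ^ n) i j) = ((A - 1) ^ n) i j := by
  have h1 : (xm n k).map (evm A) = A := by ext i j; simp [xm]
  have h2 : ((xm n k - 1) ^ n).map (evm A) = (A - 1) ^ n := by
    have : ((evm A : Rn n k →ₐ[k] k) : Rn n k →+* k).mapMatrix ((xm n k - 1) ^ n) = (A - 1) ^ n := by
      rw [map_pow, map_sub, map_one]
      congr 2
    exact this
  rw [← h2]; rfl

lemma pw_unip (u : Mn n k) (hu : (u - 1) ^ n = 0) (τ : k) : (pwE u τ - 1) ^ n = 0 := by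
  ext i j
  rw [← evm_unip]
  apply pw_dens u hu
  intro m
  rw [evm_unip, unip_pow u hu]; rfl

lemma unip_isUnit (u : Mn n k) (hu : (u - 1) ^ n = 0) : IsUnit u := by
  have h : IsNilpotent (u - 1) := ⟨n, hu⟩
  have := h.isUnit_one_add
  rwa [add_sub_cancel] at this

lemma pw_mem (C : Subgroup (GL (Fin n) k)) (hC : ZC (C : Set (GL (Fin n) k)))
    (u : GL (Fin n) k) (huC : u ∈ C) (hu : IsUnipotent u) (τ : k) :
    ∃ g ∈ C, IsUnipotent g ∧ (g : Mn n k) = pwE (u : Mn n k) τ := by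
  obtain ⟨g, hg⟩ := unip_isUnit _ (pw_unip (u : Mn n k) hu τ)
  refine ⟨g, ?_, ?_, hg⟩
  · apply hC
    intro f hf
    rw [hg]
    apply pw_dens _ hu
    intro j
    have := hf (u ^ j) (C.pow_mem huC j)
    simpa using this
  · unfold IsUnipotent
    rw [hg]
    exact pw_unip _ hu τ

lemma degreeOf_aeval_X (q : Polynomial k) (m l : ℕ) :
    degreeOf l (Polynomial.aeval (X m : MvPolynomial ℕ k) q) ≤ if l = m then q.natDegree else 0 := by
  rw [Polynomial.aeval_eq_sum_range]
  refine (degreeOf_sum_le _ _ _).trans ?_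
  apply Finset.sup_le
  intro i hi
  rw [Finset.mem_range] at hi
  rw [smul_eq_C_mul]
  refine (degreeOf_C_mul_le _ _ _).trans ?_
  refine (degreeOf_pow_le _ _ _).trans ?_
  rw [degreeOf_X]
  split_ifs with h1 <;> simp <;> omega

lemma pwP_deg (u : Mn n k) (i j : Fin n) : (pwP u i j).natDegree ≤ n := by
  rw [pwP, Matrix.sum_apply]
  apply Polynomial.natDegree_sum_le_of_forall_le
  intro a ha
  rw [Finset.mem_range] at ha
  rw [Matrix.smul_apply, Matrix.map_apply, smul_eq_mul]
  refine (Polynomial.natDegree_mul_C_le _ _).trans ?_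
  refine (Polynomial.natDegree_C_mul_le _ _).trans ?_
  rw [descPochhammer_natDegree]
  exact ha.le

end Pw

section Param
variable {k : Type*} [Field k] [CharZero k] {n : ℕ}

lemma degreeOf_subst (M : Matrix (Fin n) (Fin n) (MvPolynomial ℕ k)) (l b : ℕ)
    (hM : ∀ i j, degreeOf l (M i j) ≤ b) (f : Rn n k) :
    degreeOf l (subst M f) ≤ b * f.totalDegree := by
  rw [subst, aeval_def, eval₂_eq]
  refine (degreeOf_sum_le _ _ _).trans ?_
  apply Finset.sup_le
  intro d hd
  rw [algebraMap_eq]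
  refine (degreeOf_C_mul_le _ _ _).trans ?_
  refine (degreeOf_prod_le _ _ _).trans ?_
  refine (Finset.sum_le_sum (g := fun i => b * d i) ?_).trans ?_
  · intro i _
    refine (degreeOf_pow_le _ _ _).trans ?_
    rw [mul_comm]
    exact Nat.mul_le_mul_right _ (hM _ _)
  · rw [← Finset.mul_sum]
    exact Nat.mul_le_mul_left _ (le_totalDegree hd)

lemma eval_update_of_degreeOf (p : MvPolynomial ℕ k) (m : ℕ) (h : degreeOf m p = 0) (t : ℕ → k)
    (τ : k) : eval (Function.update t m τ) p = eval t p := by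
  apply eval₂Hom_congr' rfl _ rfl
  intro i hi _
  rw [Function.update_of_ne]
  rintro rfl
  exact mem_vars_iff_degreeOf_ne_zero.1 hi h

/-- `M` parametrizes a subset of the group `Γ` -/
structure PM (Γ : Subgroup (GL (Fin n) k)) (m : ℕ)
    (M : Matrix (Fin n) (Fin n) (MvPolynomial ℕ k)) : Prop where
  deg : ∀ i j l, degreeOf l (M i j) ≤ if l < m then n else 0
  mem : ∀ t : ℕ → k, ∃ g ∈ Γ, (g : Mn n k) = M.map (eval t)
  one : M.map (eval 0) = 1

lemma PM_one (Γ : Subgroup (GL (Fin n) k)) : PM Γ 0 1 := by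
  refine ⟨?_, ?_, ?_⟩
  · intro i j l
    by_cases h : i = j
    · subst h; rw [Matrix.one_apply_eq]; simp
    · rw [Matrix.one_apply_ne h]; simp
  · intro t
    refine ⟨1, Γ.one_mem, ?_⟩
    rw [Matrix.map_one _ (map_zero _) (map_one _)]
    rfl
  · rw [Matrix.map_one _ (map_zero _) (map_one _)]

noncomputable def extM (m : ℕ) (M : Matrix (Fin n) (Fin n) (MvPolynomial ℕ k)) (u : Mn n k) :
    Matrix (Fin n) (Fin n) (MvPolynomial ℕ k) :=
  M * (pwP u).map (Polynomial.aeval (X m : MvPolynomial ℕ k))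

lemma extM_eval (m : ℕ) (M : Matrix (Fin n) (Fin n) (MvPolynomial ℕ k)) (u : Mn n k) (t : ℕ → k) :
    (extM m M u).map (eval t) = M.map (eval t) * pwE u (t m) := by
  rw [extM, Matrix.map_mul, Matrix.map_map]
  congr 1
  ext i j
  simp only [Matrix.map_apply, Function.comp, pwE]
  rw [← aeval_eq_eval, ← Polynomial.aeval_algHom_apply]
  simp

lemma PM_ext {C Γ : Subgroup (GL (Fin n) k)} (hC : ZC (C : Set (GL (Fin n) k)))
    (hΓ : ∀ u ∈ C, IsUnipotent u → u ∈ Γ) {m : ℕ}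
    {M : Matrix (Fin n) (Fin n) (MvPolynomial ℕ k)} (hM : PM Γ m M) (u : GL (Fin n) k)
    (huC : u ∈ C) (hu : IsUnipotent u) : PM Γ (m + 1) (extM m M (u : Mn n k)) := by
  refine ⟨?_, ?_, ?_⟩
  · intro i j l
    rw [extM, Matrix.mul_apply]
    refine (degreeOf_sum_le _ _ _).trans ?_
    apply Finset.sup_le
    intro a _
    refine (degreeOf_mul_le _ _ _).trans ?_
    have h1 := hM.deg i a l
    have h2 := degreeOf_aeval_X (pwP (u : Mn n k) a j) m l
    have h3 := pwP_deg (u : Mn n k) a j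
    rw [Matrix.map_apply]
    split_ifs at * <;> omega
  · intro t
    obtain ⟨g, hg, hg'⟩ := hM.mem t
    obtain ⟨v, hv, hvu, hv'⟩ := pw_mem C hC u huC hu (t m)
    refine ⟨g * v, Γ.mul_mem hg (hΓ v hv hvu), ?_⟩
    rw [extM_eval, Units.val_mul, hg', hv']
  · rw [extM_eval, hM.one, one_mul]
    have := pwE_nat (u : Mn n k) hu 0
    simpa using this

lemma mem_ker_subst (M : Matrix (Fin n) (Fin n) (MvPolynomial ℕ k)) (f : Rn n k) :
    f ∈ RingHom.ker (subst M : Rn n k →ₐ[k] MvPolynomial ℕ k) ↔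
      ∀ t : ℕ → k, evm (M.map (eval t)) f = 0 := by
  have h1 : ∀ t : ℕ → k, evm (M.map (eval t)) f = eval t (subst M f) := by
    intro t
    rw [← aeval_eq_eval, algHom_comp_subst]
    rfl
  rw [RingHom.mem_ker]
  constructor
  · intro h t
    rw [h1, h, map_zero]
  · intro h
    apply MvPolynomial.funext
    intro t
    rw [← h1, h, map_zero]

/-- the subgroup generated by the unipotents of `C` -/
def uGrp (C : Subgroup (GL (Fin n) k)) : Subgroup (GL (Fin n) k) :=
  Subgroup.closure {u | u ∈ C ∧ IsUnipotent u}

lemma uGrp_le (C : Subgroup (GL (Fin n) k)) : uGrp C ≤ C := by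
  rw [uGrp, Subgroup.closure_le]
  exact fun u hu => hu.1

lemma unip_inv {u : GL (Fin n) k} (h : IsUnipotent u) : IsUnipotent u⁻¹ := by
  unfold IsUnipotent at h ⊢
  have h1 : ((u⁻¹ : GL (Fin n) k) : Mn n k) - 1
      = -((u⁻¹ : GL (Fin n) k) : Mn n k) * ((u : Mn n k) - 1) := by
    rw [mul_sub, mul_one, neg_mul, ← Units.val_mul]; simp [sub_eq_neg_add, add_comm]
  have hc : Commute (-((u⁻¹ : GL (Fin n) k) : Mn n k)) ((u : Mn n k) - 1) := by
    apply Commute.neg_left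
    apply Commute.sub_right _ (Commute.one_right _)
    change _ * _ = _ * _
    rw [← Units.val_mul, ← Units.val_mul]; simp
  rw [h1, hc.mul_pow, h, mul_zero]

theorem uGrp_ideal (C : Subgroup (GL (Fin n) k)) (hC : ZC (C : Set (GL (Fin n) k))) :
    (vI (uGrp C : Set (GL (Fin n) k))).IsPrime ∧ ∃ m, m ≤ n * n ∧
      TrGe (vI (uGrp C : Set (GL (Fin n) k))) m ∧
      ∀ s, HF (vI (uGrp C : Set (GL (Fin n) k))) s ≤ (n * s + 1) ^ m := by
  classical
  set Γ := uGrp C with hΓdef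
  have hΓ : ∀ u ∈ C, IsUnipotent u → u ∈ Γ := fun u h1 h2 => Subgroup.subset_closure ⟨h1, h2⟩
  let Pr : ℕ → Prop := fun m => ∃ M : Matrix (Fin n) (Fin n) (MvPolynomial ℕ k), PM Γ m M ∧
    TrGe (RingHom.ker (subst M : Rn n k →ₐ[k] MvPolynomial ℕ k)) m
  have hcard : Fintype.card (Fin n ×ₗ Fin n) = n * n := by simp [Lex]
  have hPr0 : Pr 0 := by
    refine ⟨1, PM_one Γ, fun i => i.elim0, fun h hh => ?_⟩
    rw [RingHom.mem_ker] at hh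
    have := MvPolynomial.eq_C_of_isEmpty h
    rw [this] at hh ⊢
    simp at hh
    simp [hh]
  have hbd : ∀ m, Pr m → m ≤ n * n := by
    rintro m ⟨M, _, h⟩
    rw [← hcard]
    exact TrGe_le_card h
  obtain ⟨M, hM, hTr⟩ : Pr (Nat.findGreatest Pr (n * n)) :=
    Nat.findGreatest_spec (P := Pr) (Nat.zero_le _) hPr0
  have hmax : ¬ Pr (Nat.findGreatest Pr (n * n) + 1) := by
    intro h
    have := Nat.le_findGreatest (hbd _ h) h
    omega
  have hle := Nat.findGreatest_le (P := Pr) (n * n)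
  generalize Nat.findGreatest Pr (n * n) = m at hM hTr hmax hle
  set K := RingHom.ker (subst M : Rn n k →ₐ[k] MvPolynomial ℕ k) with hK
  have hdeg0 : ∀ i j, degreeOf m (M i j) = 0 := by
    intro i j
    have := hM.deg i j m
    rw [if_neg (lt_irrefl m)] at this
    omega
  have hupd : ∀ t τ, M.map (eval (Function.update t m τ)) = M.map (eval t) := by
    intro t τ
    ext i j
    exact eval_update_of_degreeOf _ _ (hdeg0 i j) _ _
  have hstab : ∀ u ∈ C, IsUnipotent u → ∀ f ∈ K, rho (u : Mn n k) f ∈ K := by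
    intro u huC hu f hf
    have hext := PM_ext hC hΓ hM u huC hu
    have hle' : RingHom.ker (subst (extM m M (u : Mn n k)) : Rn n k →ₐ[k] MvPolynomial ℕ k) ≤ K := by
      intro g hg
      rw [mem_ker_subst] at hg ⊢
      intro t
      have := hg (Function.update t m ((0 : ℕ) : k))
      rw [extM_eval, hupd, Function.update_self, pwE_nat _ hu, pow_zero, mul_one] at this
      exact this
    have heq : RingHom.ker (subst (extM m M (u : Mn n k)) : Rn n k →ₐ[k] MvPolynomial ℕ k) = K := by
      by_contra hne
      exact hmax ⟨_, hext, TrGe_succ_of_lt (RingHom.ker_isPrime _) (lt_of_le_of_ne hle' hne) hTr⟩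
    rw [← heq, mem_ker_subst] at hf
    rw [hK, mem_ker_subst]
    intro t
    rw [evm_rho]
    have := hf (Function.update t m ((1 : ℕ) : k))
    rw [extM_eval, hupd, Function.update_self, pwE_nat _ hu, pow_one] at this
    exact this
  have hstabΓ : ∀ g ∈ Γ, ∀ f ∈ K, rho (g : Mn n k) f ∈ K := by
    intro g hg
    have hg' : g ∈ (Subgroup.closure {u | u ∈ C ∧ IsUnipotent u}).toSubmonoid := hg
    rw [Subgroup.closure_toSubmonoid] at hg'
    refine Submonoid.closure_induction (motive := fun (g : GL (Fin n) k) _ => ∀ f ∈ K, rho (g : Mn n k) f ∈ K) ?_ ?_ ?_ hg'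
    · rintro x (hx | hx)
      · exact hstab x hx.1 hx.2
      · rw [Set.mem_inv] at hx
        have h2 := unip_inv hx.2
        rw [inv_inv] at h2
        exact hstab x (by simpa using C.inv_mem hx.1) h2
    · intro f hf
      rw [Units.val_one, rho_one]; exact hf
    · intro x y _ _ hx hy f hf
      rw [Units.val_mul, ← rho_rho]
      exact hx _ (hy _ hf)
  have hKe : vI (Γ : Set (GL (Fin n) k)) = K := by
    apply le_antisymm
    · intro f hf
      rw [hK, mem_ker_subst]
      intro t
      obtain ⟨g, hg, hg'⟩ := hM.mem t
      rw [← hg']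
      exact hf g hg
    · intro f hf g hg
      have := hstabΓ g hg f hf
      rw [hK, mem_ker_subst] at this
      have := this 0
      rwa [evm_rho, hM.one, one_mul] at this
  rw [hKe]
  refine ⟨RingHom.ker_isPrime _, m, hle, hTr, fun s => ?_⟩
  apply HF_param K (subst M) hK m n
  intro p l
  have := degreeOf_subst M l _ (fun i j => hM.deg i j l) p
  split_ifs at this ⊢
  · exact this
  · simpa using this

end Param

open MvPolynomial Matrix Pointwise
set_option linter.unusedSectionVars false
set_option linter.deprecated false
set_option linter.unusedSimpArgs false

section Jordan
variable {k : Type*} [Field k] {n : ℕ}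

lemma sep_zero {V : Type*} [AddCommGroup V] [Module k V] (T : Module.End k V) (t : Finset k)
    (x : k → V) (hx : ∀ a ∈ t, x a ∈ T.maxGenEigenspace a) (hs : ∑ a ∈ t, x a = 0) :
    ∀ a ∈ t, x a = 0 := by
  have h := Module.End.independent_maxGenEigenspace T
  classical
  intro a ha
  have h1 := h a
  rw [Submodule.disjoint_def] at h1
  apply h1 _ (hx a ha)
  rw [← Finset.add_sum_erase t x ha, add_eq_zero_iff_eq_neg] at hs
  rw [hs]
  refine Submodule.neg_mem _ (Submodule.sum_mem _ fun b hb => ?_)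
  rw [Finset.mem_erase] at hb
  exact Submodule.mem_iSup_of_mem b (Submodule.mem_iSup_of_mem hb.1 (hx b hb.2))

lemma sep_mem {V : Type*} [AddCommGroup V] [Module k V] (T : Module.End k V) (p : Submodule k V)
    (hp : ∀ x ∈ p, T x ∈ p) (t : Finset k)
    (x : k → V) (hx : ∀ a ∈ t, x a ∈ T.maxGenEigenspace a) (hs : ∑ a ∈ t, x a ∈ p) :
    ∀ a ∈ t, x a ∈ p := by
  have hp' : p ≤ p.comap T := hp
  have h := sep_zero (p.mapQ p T hp') t (fun a => p.mkQ (x a)) ?_ ?_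
  · intro a ha
    have := h a ha
    simpa using this
  · intro a ha
    have := hx a ha
    rw [Module.End.mem_maxGenEigenspace] at this ⊢
    obtain ⟨m, hm⟩ := this
    refine ⟨m, ?_⟩
    have key : ∀ (m : ℕ) (y : V), ((p.mapQ p T hp' - a • (1 : Module.End k (V ⧸ p))) ^ m) (p.mkQ y)
        = p.mkQ (((T - a • (1 : Module.End k V)) ^ m) y) := by
      intro m
      induction m with
      | zero => intro y; simp
      | succ m ih =>
        intro y
        rw [pow_succ, pow_succ, Module.End.mul_apply, Module.End.mul_apply, ← ih]
        congr 1
    rw [key, hm, map_zero]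
  · rw [← map_sum]
    exact (Submodule.Quotient.mk_eq_zero p).2 hs

lemma eig_dec {V : Type*} [AddCommGroup V] [Module k V] (T : Module.End k V) (v : V)
    (hv : v ∈ ⨆ a, T.eigenspace a) : ∃ (t : Finset k) (x : k → V),
      (∀ a ∈ t, x a ∈ T.eigenspace a) ∧ ∑ a ∈ t, x a = v := by
  rw [Submodule.mem_iSup_iff_exists_finsupp] at hv
  obtain ⟨f, hf, hs⟩ := hv
  exact ⟨f.support, f, fun a _ => hf a, hs⟩

lemma eig_gen {V : Type*} [AddCommGroup V] [Module k V] (T : Module.End k V) (a : k) :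
    T.eigenspace a ≤ T.maxGenEigenspace a :=
  (T.genEigenspace a).monotone le_top

lemma maxGen_eq {V : Type*} [AddCommGroup V] [Module k V] (T : Module.End k V)
    (hT : ⨆ a, T.eigenspace a = ⊤) (a : k) (v : V) (hv : v ∈ T.maxGenEigenspace a) :
    T v = a • v := by
  classical
  obtain ⟨t, x, hx, hs⟩ := eig_dec T v (by rw [hT]; trivial)
  set y : k → V := fun b => if b ∈ t then x b else 0
  have hy : ∀ b, y b ∈ T.eigenspace b := by
    intro b
    by_cases hb : b ∈ t
    · simpa [y, hb] using hx b hb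
    · simp [y, hb]
  have hs' : ∑ b ∈ insert a t, y b = v := by
    rw [← hs]
    symm
    rw [← Finset.sum_subset (Finset.subset_insert a t)]
    · exact Finset.sum_congr rfl fun b hb => by simp [y, hb]
    · intro b _ hb; simp [y, hb]
  have h := sep_zero T (insert a t) (fun b => y b - if b = a then v else 0) ?_ ?_ a
    (Finset.mem_insert_self _ _)
  · simp only [if_true] at h
    rw [sub_eq_zero] at h
    have := hy a
    rw [h, Module.End.mem_eigenspace_iff] at this
    exact this
  · intro b _
    apply Submodule.sub_mem _ (eig_gen T b (hy b))
    by_cases h : b = a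
    · subst h; simpa using hv
    · simp [h]
  · rw [Finset.sum_sub_distrib, hs']
    simp

/-- subalgebra of sums of eigenvectors -/
lemma eig_mul (T : Rn n k →ₐ[k] Rn n k) (f g : Rn n k)
    (hf : f ∈ ⨆ a, Module.End.eigenspace T.toLinearMap a)
    (hg : g ∈ ⨆ a, Module.End.eigenspace T.toLinearMap a) :
    f * g ∈ ⨆ a, Module.End.eigenspace T.toLinearMap a := by
  obtain ⟨t, x, hx, rfl⟩ := eig_dec _ _ hf
  obtain ⟨t', x', hx', rfl⟩ := eig_dec _ _ hg
  rw [Finset.sum_mul_sum]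
  refine Submodule.sum_mem _ fun a ha => Submodule.sum_mem _ fun b hb => ?_
  apply Submodule.mem_iSup_of_mem (a * b)
  have h1 := Module.End.mem_eigenspace_iff.1 (hx a ha)
  have h2 := Module.End.mem_eigenspace_iff.1 (hx' b hb)
  rw [Module.End.mem_eigenspace_iff]
  simp only [AlgHom.toLinearMap_apply] at h1 h2 ⊢
  rw [map_mul, h1, h2]
  simp only [smul_eq_C_mul, C_mul]
  ring

/-- `rho s` is diagonalizable if `s` is. -/
lemma rho_diag (s : Mn n k) (hs : ⨆ a, Module.End.eigenspace (Matrix.toLin' s) a = ⊤) :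
    ⨆ a, Module.End.eigenspace (rho s).toLinearMap a = ⊤ := by
  rw [eq_top_iff]
  rintro f -
  induction f using MvPolynomial.induction_on with
  | C a =>
    apply Submodule.mem_iSup_of_mem 1
    rw [Module.End.mem_eigenspace_iff]
    simp only [AlgHom.toLinearMap_apply, one_smul]
    exact (rho s).commutes a
  | add p q hp hq => exact Submodule.add_mem _ hp hq
  | mul_X p q hp =>
    apply eig_mul _ _ _ hp
    obtain ⟨i, j⟩ := q
    change xv i j ∈ _
    let Y : (Fin n → k) →ₗ[k] Rn n k := ∑ l, (LinearMap.proj l).smulRight (xv i l)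
    have hY : ∀ w, Y w = ∑ l, w l • xv i l := by intro w; simp [Y]
    have h1 : xv i j = Y (Pi.single j 1) := by
      rw [hY, Finset.sum_eq_single j]
      · simp
      · intro b _ hb; simp [Pi.single_apply, hb]
      · simp
    rw [h1]
    obtain ⟨t, x, hx, h2⟩ := eig_dec (Matrix.toLin' s) (Pi.single j 1) (by rw [hs]; trivial)
    rw [← h2, map_sum]
    refine Submodule.sum_mem _ fun a ha => ?_
    apply Submodule.mem_iSup_of_mem a
    have h3 := Module.End.mem_eigenspace_iff.1 (hx a ha)
    rw [Module.End.mem_eigenspace_iff, ← map_smul, ← h3, hY, hY]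
    simp only [AlgHom.toLinearMap_apply, map_sum, map_smul, rho_xv, Finset.smul_sum,
      Matrix.toLin'_apply, Matrix.mulVec, dotProduct, Finset.sum_smul]
    rw [Finset.sum_comm]
    refine Finset.sum_congr rfl fun a _ => Finset.sum_congr rfl fun b _ => ?_
    simp only [smul_eq_C_mul, C_mul]
    ring

lemma nil_mul (T : Rn n k →ₐ[k] Rn n k) : ∀ (m a b : ℕ) (f g : Rn n k), a + b = m →
    ((T.toLinearMap - 1 : Module.End k (Rn n k)) ^ a) f = 0 →
    ((T.toLinearMap - 1 : Module.End k (Rn n k)) ^ b) g = 0 →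
    ((T.toLinearMap - 1 : Module.End k (Rn n k)) ^ m) (f * g) = 0 := by
  intro m
  induction m with
  | zero =>
    intro a b f g h hf hg
    obtain ⟨rfl, rfl⟩ : a = 0 ∧ b = 0 := by omega
    simp at hf; simp [hf]
  | succ m ih =>
    intro a b f g h hf hg
    have e1 : (T.toLinearMap - 1 : Module.End k (Rn n k)) (f * g)
        = (T.toLinearMap - 1 : Module.End k (Rn n k)) f * g
          + T f * (T.toLinearMap - 1 : Module.End k (Rn n k)) g := by
      simp only [LinearMap.sub_apply, AlgHom.toLinearMap_apply, map_mul, Module.End.one_apply]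
      ring
    have hcomm : ∀ (c : ℕ) (y : Rn n k), ((T.toLinearMap - 1 : Module.End k (Rn n k)) ^ c) (T y)
        = T (((T.toLinearMap - 1 : Module.End k (Rn n k)) ^ c) y) := by
      intro c y
      have : Commute ((T.toLinearMap - 1 : Module.End k (Rn n k)) ^ c) T.toLinearMap :=
        ((Commute.refl _).sub_left (Commute.one_left _)).pow_left c
      exact LinearMap.congr_fun this y
    rw [pow_succ, Module.End.mul_apply, e1, map_add]
    cases a with
    | zero =>
      simp at hf
      simp [hf]
    | succ a =>
      cases b with
      | zero =>
        simp at hg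
        simp [hg]
      | succ b =>
        rw [ih a (b + 1) _ _ (by omega) (by rwa [pow_succ, Module.End.mul_apply] at hf) hg,
          ih (a + 1) b _ _ (by omega) (by rw [hcomm, hf, map_zero])
            (by rwa [pow_succ, Module.End.mul_apply] at hg), add_zero]

lemma rho_lf (u w : Mn n k) (i j : Fin n) :
    ((rho u).toLinearMap - 1 : Module.End k (Rn n k)) (∑ l, xv i l * C (w l j))
      = ∑ l, xv i l * C (((u - 1) * w) l j) := by
  have h : ∀ a : k, rho u (C a) = C a := fun a => (rho u).commutes a
  rw [LinearMap.sub_apply, Module.End.one_apply, AlgHom.toLinearMap_apply, map_sum, sub_mul,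
    one_mul]
  simp only [map_mul, rho_xv, Matrix.sub_apply, Matrix.mul_apply, C_sub, mul_sub,
    Finset.sum_sub_distrib, map_sum, Finset.sum_mul, Finset.mul_sum, h]
  congr 1
  rw [Finset.sum_comm]
  refine Finset.sum_congr rfl fun a _ => Finset.sum_congr rfl fun b _ => ?_
  ring

lemma rho_nil (u : Mn n k) (hu : (u - 1) ^ n = 0) (f : Rn n k) :
    ∃ m, (((rho u).toLinearMap - 1 : Module.End k (Rn n k)) ^ m) f = 0 := by
  induction f using MvPolynomial.induction_on with
  | C a =>
    refine ⟨1, ?_⟩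
    rw [pow_one, LinearMap.sub_apply, sub_eq_zero]
    exact (rho u).commutes a
  | add p q hp hq =>
    obtain ⟨a, ha⟩ := hp
    obtain ⟨b, hb⟩ := hq
    refine ⟨a + b, ?_⟩
    rw [map_add]
    nth_rw 1 [add_comm a b]
    rw [pow_add, Module.End.mul_apply, ha, map_zero, pow_add, Module.End.mul_apply, hb, map_zero,
      add_zero]
  | mul_X p q hp =>
    obtain ⟨a, ha⟩ := hp
    refine ⟨a + n, nil_mul _ _ a n _ _ rfl ha ?_⟩
    obtain ⟨i, j⟩ := q
    change (((rho u).toLinearMap - 1 : Module.End k (Rn n k)) ^ n) (xv i j) = 0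
    have key : ∀ m, (((rho u).toLinearMap - 1 : Module.End k (Rn n k)) ^ m) (xv i j)
        = ∑ l, xv i l * C (((u - 1) ^ m) l j) := by
      intro m
      induction m with
      | zero => simp [Matrix.one_apply]
      | succ m ih =>
        rw [pow_succ' ((rho u).toLinearMap - 1), Module.End.mul_apply, ih, rho_lf, ← pow_succ']
    rw [key, hu]
    simp

lemma nil_pow (v : Mn n k) (h : IsNilpotent v) : v ^ n = 0 := by
  have h1 := (Matrix.isNilpotent_charpoly_sub_pow_of_isNilpotent h).eq_zero
  have h2 := Matrix.aeval_self_charpoly v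
  rw [sub_eq_zero] at h1
  rw [h1] at h2
  simpa using h2

variable [CharZero k] [IsAlgClosed k]

lemma mat_jordan (c : GL (Fin n) k) : ∃ s u : GL (Fin n) k, IsUnipotent u ∧ c = s * u ∧
    s * u = u * s ∧ ⨆ a, Module.End.eigenspace (Matrix.toLin' (s : Mn n k)) a = ⊤ := by
  obtain ⟨N, hN, S, hS, hnil, hss, hsum⟩ :=
    Module.End.exists_isNilpotent_isSemisimple (K := k) (f := Matrix.toLin' (c : Mn n k))
  have hcom : Commute S N := Algebra.commute_of_mem_adjoin_of_forall_mem_commute hN (by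
    intro b hb
    rw [Set.mem_singleton_iff] at hb
    subst hb
    exact (Algebra.commute_of_mem_adjoin_self hS).symm)
  set s := LinearMap.toMatrix' S
  set v := LinearMap.toMatrix' N
  have hc : (c : Mn n k) = v + s := by
    apply (Matrix.toLin' (R := k)).injective
    rw [hsum, map_add]; simp [s, v]
  have hsv : Commute s v := by
    have : LinearMap.toMatrix' (S * N) = LinearMap.toMatrix' (N * S) := by rw [hcom.eq]
    rwa [LinearMap.toMatrix'_mul, LinearMap.toMatrix'_mul] at this
  have hvn : IsNilpotent v := hnil.map LinearMap.toMatrixAlgEquiv'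
  have hcv : Commute (c : Mn n k) v := by rw [hc]; exact (Commute.refl _).add_left hsv
  have hsu : IsUnit s := by
    have h1 : s = c - v := by rw [hc]; abel
    rw [h1]
    have h3 : (c : Mn n k) - v = c * (1 - ((c⁻¹ : GL (Fin n) k) : Mn n k) * v) := by
      rw [mul_sub, mul_one, ← mul_assoc, ← Units.val_mul, mul_inv_cancel, Units.val_one, one_mul]
    rw [h3]
    apply c.isUnit.mul
    apply IsNilpotent.isUnit_one_sub
    apply Commute.isNilpotent_mul_left _ hvn
    exact hcv.units_inv_left
  obtain ⟨s', hs'⟩ := hsu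
  have hu : (((s'⁻¹ * c : GL (Fin n) k) : Mn n k)) - 1 = ((s'⁻¹ : GL (Fin n) k) : Mn n k) * v := by
    rw [Units.val_mul, hc, ← hs', mul_add, ← Units.val_mul s'⁻¹ s']
    simp
  have hs'v : Commute (s' : Mn n k) v := by rw [hs']; exact hsv
  refine ⟨s', s'⁻¹ * c, ?_, by group, ?_, ?_⟩
  · have h : IsNilpotent ((((s'⁻¹ * c : GL (Fin n) k) : Mn n k)) - 1) := by
      rw [hu]; exact Commute.isNilpotent_mul_left hs'v.units_inv_left hvn
    unfold IsUnipotent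
    exact nil_pow _ h
  · have : s' * c = c * s' := by
      ext1
      rw [Units.val_mul, Units.val_mul, hc, hs']
      exact hsv.add_right (Commute.refl _)
    rw [mul_assoc, ← this]; group
  · rw [hs', Matrix.toLin'_toMatrix']
    have := Module.End.iSup_maxGenEigenspace_eq_top S
    rw [← this]
    apply iSup_congr
    intro a
    exact (hss.isFinitelySemisimple.maxGenEigenspace_eq_eigenspace a).symm
end Jordan

open MvPolynomial Matrix Pointwise
set_option linter.unusedSectionVars false
set_option linter.deprecated false
set_option linter.unusedSimpArgs false

section JordanC
variable {k : Type*} [Field k] {n : ℕ}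

lemma vI_rho_mem (C : Subgroup (GL (Fin n) k)) {c : GL (Fin n) k} (hc : c ∈ C) {f : Rn n k}
    (hf : f ∈ vI (C : Set (GL (Fin n) k))) : rho (c : Mn n k) f ∈ vI (C : Set (GL (Fin n) k)) := by
  intro g hg
  rw [evm_rho, ← Units.val_mul]
  exact hf _ (C.mul_mem hg hc)

lemma vI_lam_mem (C : Subgroup (GL (Fin n) k)) {c : GL (Fin n) k} (hc : c ∈ C) {f : Rn n k}
    (hf : f ∈ vI (C : Set (GL (Fin n) k))) : lam (c : Mn n k) f ∈ vI (C : Set (GL (Fin n) k)) := by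
  intro g hg
  rw [evm_lam, ← Units.val_mul]
  exact hf _ (C.mul_mem hc hg)

lemma gen_of_eig [Infinite k] (s u : Mn n k) (hu : (u - 1) ^ n = 0) (hsu : s * u = u * s) (a : k)
    (f : Rn n k) (hf : rho s f = a • f) :
    f ∈ Module.End.maxGenEigenspace (rho (s * u)).toLinearMap a := by
  obtain ⟨m, hm⟩ := rho_nil u hu f
  rw [Module.End.mem_maxGenEigenspace]
  refine ⟨m, ?_⟩
  have key : ∀ (m : ℕ), (((rho (s * u)).toLinearMap - a • (1 : Module.End k (Rn n k))) ^ m) f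
      = a ^ m • (((rho u).toLinearMap - 1 : Module.End k (Rn n k)) ^ m) f ∧
        rho s ((((rho u).toLinearMap - 1 : Module.End k (Rn n k)) ^ m) f)
         = a • (((rho u).toLinearMap - 1 : Module.End k (Rn n k)) ^ m) f := by
    intro m
    induction m with
    | zero => simp [hf]
    | succ m ih =>
      obtain ⟨h1, h2⟩ := ih
      rw [pow_succ' ((rho (s * u)).toLinearMap - _), Module.End.mul_apply, h1,
        pow_succ' ((rho u).toLinearMap - _), Module.End.mul_apply]
      set g := (((rho u).toLinearMap - 1 : Module.End k (Rn n k)) ^ m) f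
      simp only [LinearMap.sub_apply, LinearMap.smul_apply, Module.End.one_apply,
        AlgHom.toLinearMap_apply, map_smul, map_sub]
      constructor
      · rw [hsu, ← rho_rho, h2, map_smul, pow_succ, mul_smul]; simp only [smul_sub]
      · rw [rho_rho, hsu, ← rho_rho, h2, map_smul, smul_sub]
  rw [(key m).1, hm, smul_zero]

variable [CharZero k] [IsAlgClosed k]

lemma jordan (C : Subgroup (GL (Fin n) k)) (hC : ZC (C : Set (GL (Fin n) k)))
    (c : GL (Fin n) k) (hc : c ∈ C) : ∃ s u : GL (Fin n) k, s ∈ C ∧ u ∈ C ∧ IsUnipotent u ∧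
      c = s * u ∧ ⨆ a, Module.End.eigenspace (Matrix.toLin' (s : Mn n k)) a = ⊤ := by
  obtain ⟨s, u, hu, hsu, hcomm, hs⟩ := mat_jordan c
  have hsC : s ∈ C := by
    apply hC
    intro f hf
    obtain ⟨t, x, hx, hsum⟩ := eig_dec (rho (s : Mn n k)).toLinearMap f
      (by rw [rho_diag _ hs]; trivial)
    have hmem := sep_mem (rho (c : Mn n k)).toLinearMap
      ((vI (C : Set (GL (Fin n) k))).restrictScalars k) (fun y hy => vI_rho_mem C hc hy) t x ?_ ?_
    · have h1 : rho (s : Mn n k) f ∈ vI (C : Set (GL (Fin n) k)) := by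
        rw [← hsum, map_sum]
        refine Ideal.sum_mem _ fun a ha => ?_
        have h2 := Module.End.mem_eigenspace_iff.1 (hx a ha)
        rw [AlgHom.toLinearMap_apply] at h2
        rw [h2, smul_eq_C_mul]
        exact Ideal.mul_mem_left _ _ (hmem a ha)
      have h2 := h1 1 C.one_mem
      rw [evm_rho] at h2
      simpa using h2
    · intro a ha
      rw [hsu, Units.val_mul]
      apply gen_of_eig _ _ hu
      · rw [← Units.val_mul, ← Units.val_mul, hcomm]
      · exact Module.End.mem_eigenspace_iff.1 (hx a ha)
    · rw [hsum]; exact hf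
  refine ⟨s, u, hsC, ?_, hu, hsu, hs⟩
  have : u = s⁻¹ * c := by rw [hsu]; group
  rw [this]
  exact C.mul_mem (C.inv_mem hsC) hc
end JordanC

section Lie
variable {k : Type*} [Field k] {n : ℕ}

/-- left-invariant derivation -/
noncomputable def der (v : Mn n k) : Derivation k (Rn n k) (Rn n k) :=
  mkDerivation k (fun p => ∑ l, xv (ofLex p).1 l * C (v l (ofLex p).2))

@[simp] lemma der_xv (v : Mn n k) (i j : Fin n) : der v (xv i j) = ∑ l, xv i l * C (v l j) := by
  rw [der, xv, mkDerivation_X]; rfl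

lemma der_C (v : Mn n k) (a : k) : der v (C a) = 0 := by
  exact (der v).map_algebraMap a

lemma der_ext {S : Type*} [CommRing S] [Algebra k S] (φ : Rn n k →ₐ[k] S)
    (D E : Rn n k →ₗ[k] S) (hD : ∀ f g, D (f * g) = φ f * D g + φ g * D f)
    (hE : ∀ f g, E (f * g) = φ f * E g + φ g * E f)
    (h : ∀ i j, D (xv i j) = E (xv i j)) (f : Rn n k) : D f = E f := by
  have h1 : D 1 = 0 := by
    have := hD 1 1
    simpa using this
  have h2 : E 1 = 0 := by
    have := hE 1 1
    simpa using this
  induction f using MvPolynomial.induction_on with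
  | C a =>
    have : (C a : Rn n k) = a • 1 := by rw [smul_eq_C_mul, mul_one]
    rw [this, map_smul, map_smul, h1, h2]
  | add p q hp hq => rw [map_add, map_add, hp, hq]
  | mul_X p q hp =>
    have := h (ofLex q).1 (ofLex q).2
    change D (X q) = E (X q) at this
    rw [hD, hE, hp, this]

lemma der_mul (v : Mn n k) (f g : Rn n k) : der v (f * g) = f * der v g + g * der v f := by
  rw [Derivation.leibniz]; simp

lemma der_add (v w : Mn n k) (f : Rn n k) : der (v + w) f = der v f + der w f := by
  refine der_ext (AlgHom.id k _) (der (v + w)).toLinearMap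
    ((der v).toLinearMap + (der w).toLinearMap) ?_ ?_ ?_ f
  · intro f g; exact der_mul _ _ _
  · intro f g
    change der v (f * g) + der w (f * g) = f * (der v g + der w g) + g * (der v f + der w f)
    rw [der_mul, der_mul]; ring
  · intro i j
    change der (v + w) (xv i j) = der v (xv i j) + der w (xv i j)
    simp [mul_add, Finset.sum_add_distrib]

lemma der_smul (a : k) (v : Mn n k) (f : Rn n k) : der (a • v) f = a • der v f := by
  refine der_ext (AlgHom.id k _) (der (a • v)).toLinearMap
    (a • (der v).toLinearMap) ?_ ?_ ?_ f
  · intro f g; exact der_mul _ _ _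
  · intro f g
    change a • der v (f * g) = f * (a • der v g) + g * (a • der v f)
    rw [der_mul, smul_add]; simp
  · intro i j
    change der (a • v) (xv i j) = a • der v (xv i j)
    simp only [der_xv, Finset.smul_sum, smul_eq_C_mul, Matrix.smul_apply, smul_eq_mul, C_mul]
    exact Finset.sum_congr rfl fun _ _ => by ring

lemma rho_C (g : Mn n k) (a : k) : rho g (C a) = C a := (rho g).commutes a
lemma lam_C (g : Mn n k) (a : k) : lam g (C a) = C a := (lam g).commutes a

lemma der_lam (v g : Mn n k) (f : Rn n k) : der v (lam g f) = lam g (der v f) := by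
  refine der_ext (lam g) ((der v).toLinearMap ∘ₗ (lam g).toLinearMap)
    ((lam g).toLinearMap ∘ₗ (der v).toLinearMap) ?_ ?_ ?_ f
  · intro f h
    change der v (lam g (f * h)) = lam g f * der v (lam g h) + lam g h * der v (lam g f)
    rw [map_mul, der_mul]
  · intro f h
    change lam g (der v (f * h)) = lam g f * lam g (der v h) + lam g h * lam g (der v f)
    rw [der_mul, map_add, map_mul, map_mul]
  · intro i j
    change der v (lam g (xv i j)) = lam g (der v (xv i j))
    simp only [lam_xv, der_xv, map_sum, map_mul, der_mul, der_C, lam_C, mul_zero, add_zero,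
      Finset.mul_sum, Finset.sum_mul]
    rw [Finset.sum_comm]
    exact Finset.sum_congr rfl fun _ _ => Finset.sum_congr rfl fun _ _ => by ring

/-- `der v ∘ rho g = rho g ∘ der w` when `v g = g w`. -/
lemma der_rho (v w g : Mn n k) (hvw : v * g = g * w) (f : Rn n k) :
    der v (rho g f) = rho g (der w f) := by
  refine der_ext (rho g) ((der v).toLinearMap ∘ₗ (rho g).toLinearMap)
    ((rho g).toLinearMap ∘ₗ (der w).toLinearMap) ?_ ?_ ?_ f
  · intro f h
    change der v (rho g (f * h)) = rho g f * der v (rho g h) + rho g h * der v (rho g f)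
    rw [map_mul, der_mul]
  · intro f h
    change rho g (der w (f * h)) = rho g f * rho g (der w h) + rho g h * rho g (der w f)
    rw [der_mul, map_add, map_mul, map_mul]
  · intro i j
    change der v (rho g (xv i j)) = rho g (der w (xv i j))
    have h1 : der v (rho g (xv i j)) = ∑ m, xv i m * C ((v * g) m j) := by
      simp only [rho_xv, der_xv, map_sum, map_mul, der_mul, der_C, rho_C, mul_zero, zero_add,
        Finset.mul_sum, Finset.sum_mul, Matrix.mul_apply]
      rw [Finset.sum_comm]
      exact Finset.sum_congr rfl fun _ _ => Finset.sum_congr rfl fun _ _ => by ring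
    have h2 : rho g (der w (xv i j)) = ∑ m, xv i m * C ((g * w) m j) := by
      simp only [rho_xv, der_xv, map_sum, map_mul, der_mul, der_C, rho_C, mul_zero, zero_add,
        Finset.mul_sum, Finset.sum_mul, Matrix.mul_apply]
      rw [Finset.sum_comm]
      exact Finset.sum_congr rfl fun _ _ => Finset.sum_congr rfl fun _ _ => by ring
    rw [h1, h2, hvw]

/-- Lie algebra of `C` -/
noncomputable def lie (C : Subgroup (GL (Fin n) k)) : Submodule k (Mn n k) where
  carrier := {v | ∀ f ∈ vI (C : Set (GL (Fin n) k)), evm 1 (der v f) = 0}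
  add_mem' := by
    intro a b ha hb f hf
    rw [der_add, map_add, ha f hf, hb f hf, add_zero]
  zero_mem' := by
    intro f _
    rw [← zero_smul k (0 : Mn n k), der_smul, zero_smul, map_zero]
  smul_mem' := by
    intro c a ha f hf
    rw [der_smul, map_smul, ha f hf, smul_zero]

lemma mem_lie {C : Subgroup (GL (Fin n) k)} {v : Mn n k} :
    v ∈ lie C ↔ ∀ f ∈ vI (C : Set (GL (Fin n) k)), evm 1 (der v f) = 0 := Iff.rfl

lemma lie_der {C : Subgroup (GL (Fin n) k)} {v : Mn n k} (hv : v ∈ lie C) {f : Rn n k}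
    (hf : f ∈ vI (C : Set (GL (Fin n) k))) : der v f ∈ vI (C : Set (GL (Fin n) k)) := by
  intro c hc
  have := hv _ (vI_lam_mem C hc hf)
  rw [der_lam, evm_lam, mul_one] at this
  exact this

lemma lie_Ad [Infinite k] {C : Subgroup (GL (Fin n) k)} {v : Mn n k} (hv : v ∈ lie C)
    {c : GL (Fin n) k} (hc : c ∈ C) :
    (c : Mn n k) * v * ((c⁻¹ : GL (Fin n) k) : Mn n k) ∈ lie C := by
  intro f hf
  have h1 : rho (c : Mn n k) (rho ((c⁻¹ : GL (Fin n) k) : Mn n k) f) = f := by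
    rw [rho_rho, ← Units.val_mul]; simp
  rw [← h1, der_rho _ v]
  · rw [evm_rho, one_mul]
    exact lie_der hv (vI_rho_mem C (C.inv_mem hc) hf) c hc
  · rw [mul_assoc, ← Units.val_mul]; simp
end Lie

open MvPolynomial Matrix Pointwise
set_option linter.unusedSectionVars false
set_option linter.deprecated false
set_option linter.unusedSimpArgs false

section LieLemma
variable {k : Type*} [Field k] {n : ℕ}

noncomputable def yv (p q : Fin n) : Rn n k := xv p q - C ((1 : Mn n k) p q)

noncomputable def mI (n : ℕ) (k : Type*) [Field k] : Ideal (Rn n k) :=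
  Ideal.span (Set.range fun pq : Fin n × Fin n => yv pq.1 pq.2)

lemma yv_mem (p q : Fin n) : (yv p q : Rn n k) ∈ mI n k := Ideal.subset_span ⟨(p, q), rfl⟩

/-- linear form in `y` attached to a functional -/
noncomputable def lf (φ : Mn n k →ₗ[k] k) : Rn n k :=
  ∑ p, ∑ q, yv p q * C (φ (Matrix.single p q 1))

lemma lf_mem (φ : Mn n k →ₗ[k] k) : lf φ ∈ mI n k :=
  Ideal.sum_mem _ fun p _ => Ideal.sum_mem _ fun q _ => Ideal.mul_mem_right _ _ (yv_mem p q)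

lemma lf_sub (φ ψ : Mn n k →ₗ[k] k) : lf (φ - ψ) = lf φ - lf ψ := by
  simp [lf, mul_sub, Finset.sum_sub_distrib]
lemma lf_add (φ ψ : Mn n k →ₗ[k] k) : lf (φ + ψ) = lf φ + lf ψ := by
  simp [lf, mul_add, Finset.sum_add_distrib]
lemma lf_smul (a : k) (φ : Mn n k →ₗ[k] k) : lf (a • φ) = C a * lf φ := by
  simp only [lf, Finset.mul_sum, LinearMap.smul_apply, smul_eq_mul, C_mul]
  exact Finset.sum_congr rfl fun _ _ => Finset.sum_congr rfl fun _ _ => by ring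
lemma lf_entry (i j : Fin n) :
    lf (Matrix.entryLinearMap k k i j : Mn n k →ₗ[k] k) = yv i j := by
  classical
  simp only [lf, Matrix.entryLinearMap_apply]
  rw [Finset.sum_eq_single i, Finset.sum_eq_single j]
  · simp
  · intro b _ hb; simp [Matrix.single_apply, hb]
  · simp
  · intro b _ hb
    apply Finset.sum_eq_zero
    intro c _
    simp [Matrix.single_apply, hb]
  · simp

/-- differential at 1 -/
noncomputable def dif (f : Rn n k) : Mn n k →ₗ[k] k where
  toFun v := evm 1 (der v f)
  map_add' := by intro v w; rw [der_add, map_add]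
  map_smul' := by intro a v; rw [der_smul, map_smul]; rfl

lemma dif_apply (f : Rn n k) (v : Mn n k) : dif f v = evm 1 (der v f) := rfl

lemma dif_add (f g : Rn n k) : dif (f + g) = dif f + dif g := by
  ext1 v; simp [dif_apply]
lemma dif_C (a : k) : dif (C a : Rn n k) = 0 := by
  ext1 v; simp [dif_apply, der_C]
lemma dif_mul (f g : Rn n k) : dif (f * g) = evm 1 f • dif g + evm 1 g • dif f := by
  ext1 v; simp [dif_apply, der_mul]
lemma dif_xv (i j : Fin n) :
    dif (xv i j : Rn n k) = Matrix.entryLinearMap k k i j := by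
  ext1 v
  simp [dif_apply, evm_C, Matrix.one_apply]

lemma taylor (f : Rn n k) : f - C (evm 1 f) - lf (dif f) ∈ mI n k ^ 2 := by
  induction f using MvPolynomial.induction_on with
  | C a => rw [evm_C, dif_C]; simp [lf]
  | add p q hp hq =>
    rw [dif_add, lf_add, map_add, C_add]
    have := Ideal.add_mem _ hp hq
    convert this using 1; ring
  | mul_X p q hp =>
    have hx : (X q : Rn n k) = C (evm 1 (X q : Rn n k)) + lf (dif (X q)) := by
      change xv (ofLex q).1 (ofLex q).2 = C (evm 1 (xv (ofLex q).1 (ofLex q).2))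
        + lf (dif (xv (ofLex q).1 (ofLex q).2))
      rw [dif_xv, lf_entry, evm_xv, yv]; ring
    rw [dif_mul, lf_add, lf_smul, lf_smul, map_mul, C_mul]
    have h1 := Ideal.mul_mem_right (X q) _ hp
    have h2 : lf (dif p) * lf (dif (X q)) ∈ mI n k ^ 2 := by
      rw [pow_two]; exact Ideal.mul_mem_mul (lf_mem _) (lf_mem _)
    have := Ideal.add_mem _ h1 h2
    convert this using 1
    linear_combination (lf (dif p) + C (evm 1 p)) * hx

lemma mem_mI {f : Rn n k} (hf : evm 1 f = 0) : f ∈ mI n k := by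
  have h1 := Ideal.pow_le_self two_ne_zero (taylor f)
  have h2 := Ideal.add_mem _ h1 (lf_mem (dif f))
  rw [hf] at h2
  simpa using h2

lemma evm_mI {f : Rn n k} (hf : f ∈ mI n k) : evm 1 f = 0 := by
  have : mI n k ≤ RingHom.ker (evm (1 : Mn n k)) := by
    rw [mI, Ideal.span_le]
    rintro _ ⟨⟨p, q⟩, rfl⟩
    rw [SetLike.mem_coe, RingHom.mem_ker]
    simp [yv, evm_C]
  exact this hf

/-- functionals vanishing on the Lie algebra are differentials of elements of the ideal -/
lemma lie_dual (C : Subgroup (GL (Fin n) k)) (φ : Mn n k →ₗ[k] k) (hφ : ∀ v ∈ lie C, φ v = 0) :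
    ∃ f ∈ vI (C : Set (GL (Fin n) k)), dif f = φ := by
  let Φ : Rn n k →ₗ[k] Module.Dual k (Mn n k) :=
    { toFun := dif
      map_add' := dif_add
      map_smul' := by
        intro a f
        ext1 v
        simp [dif_apply] }
  let W : Subspace k (Module.Dual k (Mn n k)) :=
    ((vI (C : Set (GL (Fin n) k))).restrictScalars k).map Φ
  have h1 : φ ∈ W.dualCoannihilator.dualAnnihilator := by
    rw [Submodule.mem_dualAnnihilator]
    intro v hv
    apply hφ
    intro f hf
    rw [Submodule.mem_dualCoannihilator] at hv
    exact hv (Φ f) ⟨f, hf, rfl⟩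
  rw [Subspace.dualCoannihilator_dualAnnihilator_eq] at h1
  obtain ⟨f, hf, h2⟩ := h1
  exact ⟨f, hf, h2⟩

lemma lf_mem_of_lie (C : Subgroup (GL (Fin n) k)) (φ : Mn n k →ₗ[k] k)
    (hφ : ∀ v ∈ lie C, φ v = 0) : lf φ ∈ mI n k ^ 2 ⊔ vI (C : Set (GL (Fin n) k)) := by
  obtain ⟨f, hf, rfl⟩ := lie_dual C φ hφ
  have h1 := taylor f
  have h2 : evm 1 f = 0 := by simpa using hf 1 C.one_mem
  rw [h2, C_0, sub_zero] at h1
  have : lf (dif f) = - (f - lf (dif f)) + f := by ring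
  rw [this]
  exact Ideal.add_mem _ (Ideal.mem_sup_left ((Ideal.neg_mem_iff _).2 h1)) (Ideal.mem_sup_right hf)

/-- Euler operator -/
noncomputable def eul (pr : Mn n k →ₗ[k] Mn n k) (f : Rn n k) : Rn n k :=
  ∑ p, ∑ q, yv p q * der (pr (Matrix.single p q 1)) f

lemma eul_add (pr : Mn n k →ₗ[k] Mn n k) (f g : Rn n k) :
    eul pr (f + g) = eul pr f + eul pr g := by
  simp [eul, mul_add, Finset.sum_add_distrib]

lemma eul_mul (pr : Mn n k →ₗ[k] Mn n k) (f g : Rn n k) :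
    eul pr (f * g) = f * eul pr g + g * eul pr f := by
  simp only [eul, Finset.mul_sum, ← Finset.sum_add_distrib, der_mul]
  exact Finset.sum_congr rfl fun _ _ => Finset.sum_congr rfl fun _ _ => by ring

lemma eul_mem (pr : Mn n k →ₗ[k] Mn n k) (f : Rn n k) : eul pr f ∈ mI n k :=
  Ideal.sum_mem _ fun p _ => Ideal.sum_mem _ fun q _ => Ideal.mul_mem_right _ _ (yv_mem p q)

variable (C : Subgroup (GL (Fin n) k))

lemma eul_vI (pr : Mn n k →ₗ[k] Mn n k) (hpr : ∀ v, pr v ∈ lie C)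
    {f : Rn n k} (hf : f ∈ vI (C : Set (GL (Fin n) k))) :
    eul pr f ∈ vI (C : Set (GL (Fin n) k)) :=
  Ideal.sum_mem _ fun _ _ => Ideal.sum_mem _ fun _ _ =>
    Ideal.mul_mem_left _ _ (lie_der (hpr _) hf)

lemma eul_yv (pr : Mn n k →ₗ[k] Mn n k) (hpr1 : ∀ v ∈ lie C, pr v = v)
    (i j : Fin n) :
    eul pr (yv i j) - yv i j ∈ mI n k ^ 2 ⊔ vI (C : Set (GL (Fin n) k)) := by
  have h1 : eul pr (yv i j) = lf (Matrix.entryLinearMap k k i j ∘ₗ pr)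
      + ∑ p, ∑ q, yv p q * ∑ l, yv i l * MvPolynomial.C ((pr (Matrix.single p q 1)) l j) := by
    simp only [eul, lf, ← Finset.sum_add_distrib, ← mul_add]
    refine Finset.sum_congr rfl fun p _ => Finset.sum_congr rfl fun q _ => ?_
    congr 1
    rw [yv, map_sub, der_C, sub_zero, der_xv]
    simp only [yv, sub_mul, Finset.sum_sub_distrib, LinearMap.comp_apply,
      Matrix.entryLinearMap_apply]
    rw [← sub_eq_iff_eq_add, sub_sub_cancel]
    simp only [← MvPolynomial.C_mul, ← map_sum, Matrix.one_apply, ite_mul, one_mul, zero_mul]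
    simp
  rw [h1, ← lf_entry i j, add_sub_right_comm, ← lf_sub]
  apply Ideal.add_mem
  · apply lf_mem_of_lie
    intro v hv
    simp [hpr1 v hv]
  · apply Ideal.mem_sup_left
    refine Ideal.sum_mem _ fun p _ => Ideal.sum_mem _ fun q _ => ?_
    rw [pow_two]
    refine Ideal.mul_mem_mul (yv_mem _ _) (Ideal.sum_mem _ fun l _ => ?_)
    exact Ideal.mul_mem_right _ _ (yv_mem _ _)

lemma eul_mI (pr : Mn n k →ₗ[k] Mn n k) (hpr1 : ∀ v ∈ lie C, pr v = v)
    {f : Rn n k} (hf : f ∈ mI n k) :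
    eul pr f - f ∈ mI n k ^ 2 ⊔ vI (C : Set (GL (Fin n) k)) := by
  unfold mI at hf
  induction hf using Submodule.span_induction with
  | mem x hx =>
    obtain ⟨⟨p, q⟩, rfl⟩ := hx
    exact eul_yv C pr hpr1 p q
  | zero => simp [eul]
  | add x y _ _ hx hy =>
    rw [eul_add]
    have := Ideal.add_mem _ hx hy
    convert this using 1; ring
  | smul a x hxm hx =>
    rw [smul_eq_mul, eul_mul]
    have h1 : x * eul pr a ∈ mI n k ^ 2 ⊔ vI (C : Set (GL (Fin n) k)) := by
      apply Ideal.mem_sup_left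
      rw [pow_two]
      exact Ideal.mul_mem_mul hxm (eul_mem _ _)
    have := Ideal.add_mem _ (Ideal.mul_mem_left _ a hx) h1
    convert this using 1; ring

lemma eul_pow (pr : Mn n k →ₗ[k] Mn n k) (hpr1 : ∀ v ∈ lie C, pr v = v)
    (i : ℕ) : ∀ f ∈ mI n k ^ i,
    eul pr f - (i : Rn n k) * f ∈ mI n k ^ (i + 1) ⊔ vI (C : Set (GL (Fin n) k)) := by
  induction i with
  | zero =>
    intro f _
    apply Ideal.mem_sup_left
    simpa using eul_mem pr f
  | succ i ih =>
    intro f hf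
    rw [pow_succ'] at hf
    induction hf using Submodule.mul_induction_on' with
    | mem_mul_mem m hm g hg =>
      rw [eul_mul]
      have h1 := ih g hg
      have h2 := eul_mI C pr hpr1 hm
      obtain ⟨a, ha, b, hb, hab⟩ := Submodule.mem_sup.1 h1
      obtain ⟨a', ha', b', hb', hab'⟩ := Submodule.mem_sup.1 h2
      have e : m * eul pr g + g * eul pr m - ((i + 1 : ℕ) : Rn n k) * (m * g)
          = (m * a + a' * g) + (m * b + b' * g) := by
        push_cast
        linear_combination (-m) * hab - g * hab'
      rw [e]
      apply Ideal.add_mem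
      · apply Ideal.mem_sup_left
        apply Ideal.add_mem
        · rw [pow_succ']; exact Ideal.mul_mem_mul hm ha
        · rw [show i + 1 + 1 = 2 + i by ring, pow_add]; exact Ideal.mul_mem_mul ha' hg
      · exact Ideal.mem_sup_right
          (Ideal.add_mem _ (Ideal.mul_mem_left _ _ hb) (Ideal.mul_mem_right _ _ hb'))
    | add x _ y _ hx hy =>
      rw [eul_add]
      have := Ideal.add_mem _ hx hy
      convert this using 1; ring

lemma eul_sup (pr : Mn n k →ₗ[k] Mn n k) (hpr : ∀ v, pr v ∈ lie C) (hpr1 : ∀ v ∈ lie C, pr v = v)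
    (i : ℕ) : ∀ f ∈ mI n k ^ i ⊔ vI (C : Set (GL (Fin n) k)),
    eul pr f - (i : Rn n k) * f ∈ mI n k ^ (i + 1) ⊔ vI (C : Set (GL (Fin n) k)) := by
  intro f hf
  obtain ⟨a, ha, b, hb, rfl⟩ := Submodule.mem_sup.1 hf
  have h1 := eul_pow C pr hpr1 i a ha
  have h2 : eul pr b - (i : Rn n k) * b ∈ mI n k ^ (i + 1) ⊔ vI (C : Set (GL (Fin n) k)) :=
    Ideal.mem_sup_right (Ideal.sub_mem _ (eul_vI C pr hpr hb) (Ideal.mul_mem_left _ _ hb))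
  rw [eul_add]
  have := Ideal.add_mem _ h1 h2
  convert this using 1; ring

theorem lie_lemma [CharZero k] (hP : (vI (C : Set (GL (Fin n) k))).IsPrime) (J : Set (Rn n k))
    (hJ1 : ∀ f ∈ J, evm 1 f = 0) (hJ : ∀ v ∈ lie C, ∀ f ∈ J, der v f ∈ J) :
    J ⊆ vI (C : Set (GL (Fin n) k)) := by
  obtain ⟨q, hq⟩ := (lie C).exists_isCompl
  let pr : Mn n k →ₗ[k] Mn n k := (lie C).subtype ∘ₗ Submodule.linearProjOfIsCompl _ _ hq
  have hpr : ∀ v, pr v ∈ lie C := fun v => Submodule.coe_mem _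
  have hpr1 : ∀ v ∈ lie C, pr v = v := by
    intro v hv
    exact congrArg Subtype.val (Submodule.linearProjOfIsCompl_apply_left hq ⟨v, hv⟩)
  have key : ∀ i : ℕ, ∀ f ∈ J, f ∈ mI n k ^ (i + 1) ⊔ vI (C : Set (GL (Fin n) k)) := by
    intro i
    induction i with
    | zero =>
      intro f hf
      apply Ideal.mem_sup_left
      rw [zero_add, pow_one]
      exact mem_mI (hJ1 f hf)
    | succ i ih =>
      intro f hf
      have h1 := eul_sup C pr hpr hpr1 (i + 1) f (ih f hf)
      have h2 : eul pr f ∈ mI n k ^ (i + 1 + 1) ⊔ vI (C : Set (GL (Fin n) k)) := by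
        refine Ideal.sum_mem _ fun p _ => Ideal.sum_mem _ fun q _ => ?_
        obtain ⟨a, ha, b, hb, hab⟩ := Submodule.mem_sup.1 (ih _ (hJ _ (hpr (Matrix.single p q 1)) f hf))
        rw [← hab, mul_add]
        refine Ideal.add_mem _ (Ideal.mem_sup_left ?_) (Ideal.mem_sup_right (Ideal.mul_mem_left _ _ hb))
        rw [pow_succ']
        exact Ideal.mul_mem_mul (yv_mem _ _) ha
      have h3 := Ideal.sub_mem _ h2 h1
      rw [sub_sub_cancel] at h3
      have h4 := Ideal.mul_mem_left _ (MvPolynomial.C (((i + 1 : ℕ) : k)⁻¹)) h3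
      rw [← mul_assoc] at h4
      have h5 : MvPolynomial.C (((i + 1 : ℕ) : k)⁻¹) * ((i + 1 : ℕ) : Rn n k) = 1 := by
        rw [← map_natCast (MvPolynomial.C : k →+* Rn n k), ← C_mul, inv_mul_cancel₀, C_1]
        exact Nat.cast_ne_zero.2 (Nat.succ_ne_zero _)
      rwa [h5, one_mul] at h4
  intro f hf
  have hle : vI (C : Set (GL (Fin n) k)) ≤ mI n k := by
    intro g hg
    exact mem_mI (by simpa using hg 1 C.one_mem)
  have hne : (mI n k).map (Ideal.Quotient.mk (vI (C : Set (GL (Fin n) k)))) ≠ ⊤ := by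
    intro h
    rw [Ideal.eq_top_iff_one, Ideal.mem_map_iff_of_surjective _ Ideal.Quotient.mk_surjective] at h
    obtain ⟨g, hg, h⟩ := h
    rw [← map_one (Ideal.Quotient.mk _), Ideal.Quotient.eq] at h
    have h1 := evm_mI (hle h)
    rw [map_sub, evm_mI hg] at h1
    simp at h1
  have h0 := Ideal.iInf_pow_eq_bot_of_isDomain _ hne
  have : Ideal.Quotient.mk (vI (C : Set (GL (Fin n) k))) f = 0 := by
    rw [← Ideal.mem_bot, ← h0, Ideal.mem_iInf]
    intro i
    have h1 := Ideal.mem_map_of_mem (Ideal.Quotient.mk (vI (C : Set (GL (Fin n) k)))) (key i f hf)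
    rw [Ideal.map_sup, Ideal.map_quotient_self, sup_bot_eq, Ideal.map_pow] at h1
    exact Ideal.pow_le_pow_right (Nat.le_succ i) h1
  exact Ideal.Quotient.eq_zero_iff_mem.1 this
end LieLemma

open MvPolynomial Matrix Pointwise
set_option linter.unusedSectionVars false
set_option linter.deprecated false
set_option linter.unusedSimpArgs false

section Exp
variable {k : Type*} [Field k] {n : ℕ}

noncomputable def exP (v : Mn n k) : Matrix (Fin n) (Fin n) (Polynomial k) :=
  Matrix.of fun i j => ∑ m ∈ Finset.range (n + 1),
    Polynomial.monomial m ((v ^ m) i j / (m.factorial : k))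

lemma exP_coeff (v : Mn n k) (hv : v ^ n = 0) (i j : Fin n) (m : ℕ) :
    (exP v i j).coeff m = (v ^ m) i j / (m.factorial : k) := by
  simp only [exP, Matrix.of_apply, Polynomial.finsetSum_coeff, Polynomial.coeff_monomial]
  rw [Finset.sum_ite_eq']
  split_ifs with h
  · rfl
  · have : v ^ m = 0 := pow_eq_zero_of_le (by simp at h; omega) hv
    simp [this]

lemma exP_eval (v : Mn n k) (τ : k) : (exP v).map (Polynomial.eval τ)
    = ∑ m ∈ Finset.range (n + 1), (τ ^ m / (m.factorial : k)) • v ^ m := by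
  ext i j
  simp only [exP, Matrix.map_apply, Matrix.of_apply, Polynomial.eval_finset_sum,
    Polynomial.eval_monomial, Matrix.sum_apply, Matrix.smul_apply, smul_eq_mul]
  exact Finset.sum_congr rfl fun _ _ => by ring

lemma evm_exP (v : Mn n k) (τ : k) (f : Rn n k) :
    evm ((exP v).map (Polynomial.eval τ)) f = (subst (exP v) f).eval τ := by
  exact (algHom_comp_subst (Polynomial.aeval τ : Polynomial k →ₐ[k] k) (exP v) f).symm

lemma exP_unip (v : Mn n k) (hv : v ^ n = 0) (τ : k) :
    ((exP v).map (Polynomial.eval τ) - 1) ^ n = 0 := by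
  apply nil_pow
  rw [exP_eval, Finset.sum_range_succ']
  simp only [pow_zero, Nat.factorial_zero, Nat.cast_one, div_one, one_smul, add_sub_cancel_right]
  have : ∑ m ∈ Finset.range n, (τ ^ (m + 1) / ((m + 1).factorial : k)) • v ^ (m + 1)
      = v * ∑ m ∈ Finset.range n, (τ ^ (m + 1) / ((m + 1).factorial : k)) • v ^ m := by
    rw [Finset.mul_sum]
    exact Finset.sum_congr rfl fun m _ => by rw [pow_succ' v, mul_smul_comm]
  rw [this]
  apply Commute.isNilpotent_mul_right _ ⟨n, hv⟩
  apply Commute.sum_right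
  intro m _
  exact ((Commute.refl v).pow_right m).smul_right _

variable [CharZero k]

lemma exP_der (v : Mn n k) (hv : v ^ n = 0) (f : Rn n k) :
    Polynomial.derivative (subst (exP v) f) = subst (exP v) (der v f) := by
  refine der_ext (subst (exP v)) (Polynomial.derivative ∘ₗ (subst (exP v)).toLinearMap)
    ((subst (exP v)).toLinearMap ∘ₗ (der v).toLinearMap) ?_ ?_ ?_ f
  · intro f g
    change Polynomial.derivative (subst (exP v) (f * g)) = subst (exP v) f *
      Polynomial.derivative (subst (exP v) g) + subst (exP v) g *
      Polynomial.derivative (subst (exP v) f)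
    rw [map_mul, Polynomial.derivative_mul]; ring
  · intro f g
    change subst (exP v) (der v (f * g)) = subst (exP v) f * subst (exP v) (der v g)
      + subst (exP v) g * subst (exP v) (der v f)
    rw [der_mul, map_add, map_mul, map_mul]
  · intro i j
    change Polynomial.derivative (subst (exP v) (xv i j)) = subst (exP v) (der v (xv i j))
    have hC : ∀ a : k, subst (exP v) (C a) = Polynomial.C a := fun a => (subst (exP v)).commutes a
    simp only [der_xv, map_sum, map_mul, subst_xv, hC]
    ext m
    rw [Polynomial.coeff_derivative, exP_coeff v hv, Polynomial.finsetSum_coeff]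
    simp only [Polynomial.coeff_mul_C, exP_coeff v hv]
    rw [pow_succ, Matrix.mul_apply, Nat.factorial_succ]
    have h1 : (m.factorial : k) ≠ 0 := Nat.cast_ne_zero.2 (Nat.factorial_ne_zero m)
    have h2 : ((m : k) + 1) ≠ 0 := Nat.cast_add_one_ne_zero m
    push_cast
    rw [Finset.sum_div, Finset.sum_mul]
    refine Finset.sum_congr rfl fun l _ => ?_
    field_simp

lemma exP_zero (v : Mn n k) (hv : v ^ n = 0) (f : Rn n k) :
    (subst (exP v) f).eval 0 = evm 1 f := by
  rw [← evm_exP]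
  congr 2
  ext i j
  rw [Matrix.map_apply, ← Polynomial.coeff_zero_eq_eval_zero, exP_coeff v hv]
  simp

lemma exp_mem (C : Subgroup (GL (Fin n) k)) (hC : ZC (C : Set (GL (Fin n) k)))
    (v : Mn n k) (hv : v ^ n = 0) (hvC : v ∈ lie C) (τ : k) :
    ∃ g ∈ uGrp C, (g : Mn n k) = (exP v).map (Polynomial.eval τ) := by
  obtain ⟨g, hg⟩ := unip_isUnit _ (exP_unip v hv τ)
  have hu : IsUnipotent g := by unfold IsUnipotent; rw [hg]; exact exP_unip v hv τ
  refine ⟨g, Subgroup.subset_closure ⟨?_, hu⟩, hg⟩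
  apply hC
  intro f hf
  rw [hg, evm_exP]
  have h0 : subst (exP v) f = 0 := by
    have hit : ∀ m : ℕ, Polynomial.derivative^[m] (subst (exP v) f)
        = subst (exP v) ((der v)^[m] f) ∧ (der v)^[m] f ∈ vI (C : Set (GL (Fin n) k)) := by
      intro m
      induction m with
      | zero => exact ⟨rfl, hf⟩
      | succ m ih =>
        rw [Function.iterate_succ_apply', Function.iterate_succ_apply', ih.1, exP_der v hv]
        exact ⟨rfl, lie_der hvC ih.2⟩
    ext m
    have h1 : (Polynomial.derivative^[m] (subst (exP v) f)).coeff 0 = 0 := by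
      rw [(hit m).1, Polynomial.coeff_zero_eq_eval_zero, exP_zero v hv]
      simpa using (hit m).2 1 C.one_mem
    rw [Polynomial.coeff_iterate_derivative, zero_add, Nat.descFactorial_self] at h1
    rw [Polynomial.coeff_zero]
    rcases smul_eq_zero.1 h1 with h | h
    · exact absurd h (Nat.factorial_ne_zero m)
    · exact h
  rw [h0, Polynomial.eval_zero]

lemma nil_kills (C : Subgroup (GL (Fin n) k)) (hC : ZC (C : Set (GL (Fin n) k)))
    (v : Mn n k) (hv : v ^ n = 0) (hvC : v ∈ lie C) (f : Rn n k)
    (hf : ∀ g ∈ uGrp C, rho (g : Mn n k) f = f) : der v f = 0 := by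
  apply evm_ext
  intro A
  have h1 : subst (exP v) (lam A f) = Polynomial.C (evm A f) := by
    apply Polynomial.funext
    intro τ
    obtain ⟨g, hg, hge⟩ := exp_mem C hC v hv hvC τ
    rw [← evm_exP, ← hge, evm_lam, ← evm_rho, hf g hg, Polynomial.eval_C]
  have h2 := exP_der v hv (lam A f)
  rw [h1, Polynomial.derivative_C, der_lam] at h2
  have h3 := exP_zero v hv (lam A (der v f))
  rw [← h2, Polynomial.eval_zero, evm_lam, mul_one] at h3
  rw [← h3, map_zero]

/-- `s v = a v s` with `a` not a root of unity of order `≤ n` implies `v` nilpotent. -/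
lemma nil_of_conj [IsAlgClosed k] (s v : Mn n k) (hs : IsUnit s) (a : k) (hsv : s * v = a • (v * s))
    (ha : ∀ i, 1 ≤ i → i ≤ n → a ^ i ≠ 1) : v ^ n = 0 := by
  classical
  rcases Nat.eq_zero_or_pos n with hn | hn
  · subst hn
    exact Subsingleton.elim _ _
  have hroot : ∀ μ : k, v.charpoly.IsRoot μ → v.charpoly.IsRoot (a⁻¹ * μ) ∨ v = 0 := by
    intro μ hμ
    by_cases ha0 : a = 0
    · right
      rw [ha0, zero_smul] at hsv
      obtain ⟨t, rfl⟩ := hs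
      have := congrArg (fun w => ((t⁻¹ : (Mn n k)ˣ) : Mn n k) * w) hsv
      simpa using this
    · left
      rw [Polynomial.IsRoot.def, Matrix.eval_charpoly] at hμ ⊢
      have e : s * (Matrix.scalar (Fin n) μ - v)
          = (a • (Matrix.scalar (Fin n) (a⁻¹ * μ) - v)) * s := by
        rw [mul_sub, hsv, smul_sub, sub_mul, smul_mul_assoc, smul_mul_assoc]
        congr 1
        rw [← smul_mul_assoc]
        have : a • (Matrix.scalar (Fin n) (a⁻¹ * μ)) = Matrix.scalar (Fin n) μ := by
          ext i j
          by_cases h : i = j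
          · subst h; simp [ha0]
          · simp [h]
        rw [this]
        exact ((Matrix.scalar_commute μ (fun r => Commute.all _ _) s).eq).symm
      have e2 := congrArg Matrix.det e
      rw [det_mul, hμ, mul_zero, det_mul, det_smul] at e2
      have hsd : s.det ≠ 0 := (Matrix.isUnit_iff_isUnit_det s).1 hs |>.ne_zero
      symm at e2
      rcases mul_eq_zero.1 e2 with h | h
      · rcases mul_eq_zero.1 h with h | h
        · exact absurd h (pow_ne_zero _ ha0)
        · exact h
      · exact absurd h hsd
  by_cases hv0 : v = 0
  · rw [hv0, zero_pow hn.ne']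
  have hr0 : ∀ μ ∈ v.charpoly.roots, μ = 0 := by
    intro μ hμ
    rw [Polynomial.mem_roots v.charpoly_monic.ne_zero] at hμ
    by_contra hne
    have ha0 : a ≠ 0 := by
      rintro rfl
      rw [zero_smul] at hsv
      obtain ⟨t, rfl⟩ := hs
      have := congrArg (fun w => ((t⁻¹ : (Mn n k)ˣ) : Mn n k) * w) hsv
      simp at this
      exact hv0 this
    have hall : ∀ i : ℕ, v.charpoly.IsRoot ((a⁻¹) ^ i * μ) := by
      intro i
      induction i with
      | zero => simpa using hμ
      | succ i ih =>
        rcases hroot _ ih with h | h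
        · rwa [← mul_assoc, ← pow_succ'] at h
        · exact absurd h hv0
    have hinj : Function.Injective (fun i : Fin (n + 1) => (a⁻¹) ^ (i : ℕ) * μ) := by
      have key : ∀ i j : ℕ, i < j → j ≤ n → (a⁻¹) ^ i * μ ≠ (a⁻¹) ^ j * μ := by
        intro i j hij hj h
        have h1 := mul_right_cancel₀ hne h
        rw [inv_pow, inv_pow, _root_.inv_inj] at h1
        apply ha (j - i) (by omega) (by omega)
        have h2 : a ^ j = a ^ i * a ^ (j - i) := by rw [← pow_add]; congr 1; omega
        rw [h2] at h1
        exact (mul_eq_left₀ (pow_ne_zero i ha0)).1 h1.symm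
      intro i j h
      rcases lt_trichotomy (i : ℕ) (j : ℕ) with hlt | heq | hlt
      · exact absurd h (key i j hlt (by omega))
      · exact Fin.ext heq
      · exact absurd h.symm (key j i hlt (by omega))
    have hcard : (n + 1) ≤ v.charpoly.roots.toFinset.card := by
      have : (Finset.univ.image (fun i : Fin (n + 1) => (a⁻¹) ^ (i : ℕ) * μ)) ⊆
          v.charpoly.roots.toFinset := by
        intro x hx
        simp only [Finset.mem_image, Finset.mem_univ, true_and] at hx
        obtain ⟨i, rfl⟩ := hx
        rw [Multiset.mem_toFinset, Polynomial.mem_roots v.charpoly_monic.ne_zero]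
        exact hall i
      have h2 := Finset.card_le_card this
      rwa [Finset.card_image_of_injective _ hinj, Finset.card_univ, Fintype.card_fin] at h2
    have h3 := (Multiset.toFinset_card_le v.charpoly.roots).trans (Polynomial.card_roots' _)
    rw [Matrix.charpoly_natDegree_eq_dim, Fintype.card_fin] at h3
    omega
  have hcp : v.charpoly = Polynomial.X ^ n := by
    have h1 := (IsAlgClosed.splits v.charpoly).eq_prod_roots_of_monic v.charpoly_monic
    have hc := (IsAlgClosed.splits v.charpoly).natDegree_eq_card_roots
    rw [Multiset.eq_replicate_of_mem hr0, Multiset.map_replicate, Multiset.prod_replicate, ← hc,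
      Matrix.charpoly_natDegree_eq_dim, Fintype.card_fin] at h1
    simpa using h1
  have h2 := Matrix.aeval_self_charpoly v
  rw [hcp] at h2
  simpa using h2
end Exp

open MvPolynomial Matrix Pointwise
set_option linter.unusedSectionVars false
set_option linter.deprecated false
set_option linter.unusedSimpArgs false

section WW
variable {k : Type*} [Field k] {n : ℕ}

/-- the space of `uGrp C`-invariants of degree at most `e`. -/
noncomputable def Wf (C : Subgroup (GL (Fin n) k)) (e : ℕ) : Submodule k (Rn n k) where
  carrier := {f | f.totalDegree ≤ e ∧ ∀ g ∈ uGrp C, rho (g : Mn n k) f = f}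
  add_mem' := by
    rintro a b ⟨ha, ha'⟩ ⟨hb, hb'⟩
    refine ⟨(totalDegree_add _ _).trans (max_le ha hb), ?_⟩
    intro g hg
    rw [map_add, ha' g hg, hb' g hg]
  zero_mem' := by
    refine ⟨by simp, ?_⟩
    intro g _; rw [map_zero]
  smul_mem' := by
    rintro c a ⟨ha, ha'⟩
    refine ⟨(totalDegree_smul_le _ _).trans ha, ?_⟩
    intro g hg
    rw [map_smul, ha' g hg]

lemma mem_Wf {C : Subgroup (GL (Fin n) k)} {e : ℕ} {f : Rn n k} :
    f ∈ Wf C e ↔ f.totalDegree ≤ e ∧ ∀ g ∈ uGrp C, rho (g : Mn n k) f = f := Iff.rfl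

lemma Wf_fin (C : Subgroup (GL (Fin n) k)) (e : ℕ) : FiniteDimensional k (Wf C e) := by
  have : Wf C e ≤ restrictTotalDegree (Fin n ×ₗ Fin n) k e := by
    intro f hf
    rw [mem_restrictTotalDegree]; exact hf.1
  have h : FiniteDimensional k (restrictTotalDegree (Fin n ×ₗ Fin n) k e) := inferInstance
  exact Submodule.finiteDimensional_of_le this

lemma unip_conj {u g : GL (Fin n) k} (h : IsUnipotent u) : IsUnipotent (g * u * g⁻¹) := by
  unfold IsUnipotent at h ⊢
  have h1 : ((g * u * g⁻¹ : GL (Fin n) k) : Mn n k) - 1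
      = (g : Mn n k) * ((u : Mn n k) - 1) * ((g⁻¹ : GL (Fin n) k) : Mn n k) := by
    rw [mul_sub, sub_mul, mul_one, ← Units.val_mul g g⁻¹, mul_inv_cancel]; simp
  rw [h1]
  have h2 : ∀ m, ((g : Mn n k) * ((u : Mn n k) - 1) * ((g⁻¹ : GL (Fin n) k) : Mn n k)) ^ m
      = (g : Mn n k) * ((u : Mn n k) - 1) ^ m * ((g⁻¹ : GL (Fin n) k) : Mn n k) := by
    intro m
    exact Units.conj_pow g _ m
  rw [h2, h]; simp

lemma uGrp_conj (C : Subgroup (GL (Fin n) k)) {c : GL (Fin n) k} (hc : ∀ x ∈ C, c * x * c⁻¹ ∈ C)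
    {g : GL (Fin n) k} (hg : g ∈ uGrp C) : c * g * c⁻¹ ∈ uGrp C := by
  induction hg using Subgroup.closure_induction with
  | mem x hx => exact Subgroup.subset_closure ⟨hc x hx.1, unip_conj hx.2⟩
  | one => simpa using (uGrp C).one_mem
  | mul x y _ _ hx hy =>
    have : c * (x * y) * c⁻¹ = (c * x * c⁻¹) * (c * y * c⁻¹) := by group
    rw [this]; exact (uGrp C).mul_mem hx hy
  | inv x _ hx =>
    have : c * x⁻¹ * c⁻¹ = (c * x * c⁻¹)⁻¹ := by group
    rw [this]; exact (uGrp C).inv_mem hx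

lemma Wf_rho [Infinite k] (C : Subgroup (GL (Fin n) k)) (e : ℕ) {c : GL (Fin n) k} (hc : c ∈ C)
    {f : Rn n k} (hf : f ∈ Wf C e) : rho (c : Mn n k) f ∈ Wf C e := by
  refine ⟨(totalDegree_rho_le _ _).trans hf.1, ?_⟩
  intro g hg
  have h1 : c⁻¹ * g * c⁻¹⁻¹ ∈ uGrp C :=
    uGrp_conj C (fun x hx => C.mul_mem (C.mul_mem (C.inv_mem hc) hx) (C.inv_mem (C.inv_mem hc))) hg
  have h2 := hf.2 _ h1
  have h3 : rho (c : Mn n k) (rho ((c⁻¹ * g * c⁻¹⁻¹ : GL (Fin n) k) : Mn n k) f)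
      = rho (g : Mn n k) (rho (c : Mn n k) f) := by
    rw [rho_rho, rho_rho, ← Units.val_mul, ← Units.val_mul]
    congr 3
    group
  rw [← h3, h2]

/-- matrix coefficients are polynomial -/
lemma coef (f : Rn n k) : ∀ φ : Rn n k →ₗ[k] k, ∃ q : Rn n k,
    (∀ c : Mn n k, evm c q = φ (rho c f)) ∧
    ∀ c v : Mn n k, evm c (der v q) = φ (rho c (der v f)) := by
  induction f using MvPolynomial.induction_on with
  | C a =>
    intro φ
    refine ⟨C (φ (C a)), ?_, ?_⟩
    · intro c; rw [evm_C, rho_C]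
    · intro c v; simp [der_C]
  | add p q hp hq =>
    intro φ
    obtain ⟨p', h1, h2⟩ := hp φ
    obtain ⟨q', h3, h4⟩ := hq φ
    refine ⟨p' + q', ?_, ?_⟩
    · intro c; simp only [map_add, h1, h3]
    · intro c v; simp only [map_add, h2, h4]
  | mul_X f ij hf =>
    intro φ
    obtain ⟨i, j⟩ := ij
    have hm : ∀ l, ∃ q : Rn n k, (∀ c : Mn n k, evm c q = φ (rho c f * xv i l)) ∧
        ∀ c v : Mn n k, evm c (der v q) = φ (rho c (der v f) * xv i l) := by
      intro l
      exact hf (φ ∘ₗ LinearMap.mulRight k (xv i l))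
    choose q hq1 hq2 using hm
    have hC : ∀ (a : k) (g : Rn n k), φ (g * C a) = φ g * a := by
      intro a g; rw [mul_comm g, ← smul_eq_C_mul, map_smul, smul_eq_mul, mul_comm]
    refine ⟨∑ l, xv l j * q l, ?_, ?_⟩
    · intro c
      change _ = φ (rho c (f * xv i j))
      rw [map_mul, rho_xv, Finset.mul_sum, map_sum, map_sum]
      refine Finset.sum_congr rfl fun l _ => ?_
      rw [map_mul, evm_xv, hq1, ← mul_assoc, hC, mul_comm]
    · intro c v
      change _ = φ (rho c (der v (f * xv i j)))
      rw [der_mul, map_add, map_mul, map_mul, rho_xv, map_sum, map_sum]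
      have e1 : φ ((∑ l, xv i l * C (c l j)) * rho c (der v f))
          = ∑ l, c l j * φ (rho c (der v f) * xv i l) := by
        rw [Finset.sum_mul, map_sum]
        refine Finset.sum_congr rfl fun l _ => ?_
        rw [mul_right_comm, hC, mul_comm, mul_comm (xv i l)]
      have e2 : φ (rho c f * rho c (der v (xv i j)))
          = ∑ l, (∑ m, c l m * v m j) * φ (rho c f * xv i l) := by
        rw [der_xv, map_sum]
        simp only [map_mul, rho_xv, rho_C, Finset.sum_mul, Finset.mul_sum, map_sum]
        rw [Finset.sum_comm]
        refine Finset.sum_congr rfl fun l _ => Finset.sum_congr rfl fun m _ => ?_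
        rw [← mul_assoc, ← mul_assoc, hC, hC]; ring
      rw [map_add, e1, e2, ← Finset.sum_add_distrib]
      refine Finset.sum_congr rfl fun l _ => ?_
      rw [der_mul, map_add, map_mul, map_mul, evm_xv, hq1, hq2, der_xv, map_sum]
      simp only [map_mul, evm_xv, evm_C]
      ring

lemma Wf_der [Infinite k] (C : Subgroup (GL (Fin n) k)) (e : ℕ) {v : Mn n k} (hv : v ∈ lie C)
    {f : Rn n k} (hf : f ∈ Wf C e) : der v f ∈ Wf C e := by
  by_contra hne
  obtain ⟨φ, hφ1, hφ2⟩ := Submodule.exists_le_ker_of_notMem hne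
  obtain ⟨q, hq1, hq2⟩ := coef f φ
  have hq : q ∈ vI (C : Set (GL (Fin n) k)) := by
    intro c hc
    rw [hq1]
    exact hφ2 (Wf_rho C e hc hf)
  have := hv q hq
  rw [hq2, rho_one] at this
  exact hφ1 this

lemma conj_proj (s : Mn n k) (hs : ⨆ a, Module.End.eigenspace (Matrix.toLin' s) a = ⊤) :
    ∃ (t : Finset k) (p : k → Mn n k), ∑ a ∈ t, p a = 1 ∧
      ∀ a ∈ t, s * p a = a • p a ∧ p a * s = a • p a := by
  classical
  choose t x hx hsum using fun j : Fin n =>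
    eig_dec (Matrix.toLin' s) (Pi.single j 1) (by rw [hs]; trivial)
  set T : Finset k := insert 0 (Finset.univ.biUnion t)
  have hkill : Polynomial.aeval s (∏ a ∈ T, (Polynomial.X - Polynomial.C a)) = 0 := by
    apply (Matrix.toLinAlgEquiv' (R := k)).injective
    rw [map_zero, ← Polynomial.aeval_algHom_apply]
    change Polynomial.aeval (Matrix.toLin' s) _ = 0
    apply (Pi.basisFun k (Fin n)).ext
    intro j
    rw [Pi.basisFun_apply, ← hsum j, map_sum, LinearMap.zero_apply]
    apply Finset.sum_eq_zero
    intro a ha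
    by_cases h0 : x j a = 0
    · rw [h0, map_zero]
    · rw [Module.End.aeval_apply_of_hasEigenvector ⟨hx j a ha, h0⟩]
      have : (∏ b ∈ T, (Polynomial.X - Polynomial.C b)).eval a = 0 := by
        rw [Polynomial.eval_prod]
        apply Finset.prod_eq_zero (i := a)
        · exact Finset.mem_insert_of_mem (Finset.mem_biUnion.2 ⟨j, Finset.mem_univ _, ha⟩)
        · simp
      rw [this, zero_smul]
  refine ⟨T, fun a => Polynomial.aeval s (Lagrange.basis T id a), ?_, ?_⟩
  · rw [← map_sum, Lagrange.sum_basis Function.injective_id.injOn (by simp [T]), map_one]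
  · intro a ha
    have h1 : Polynomial.aeval s ((Polynomial.X - Polynomial.C a) * Lagrange.basis T id a) = 0 := by
      have : (Polynomial.X - Polynomial.C a) * Lagrange.basis T id a
          = (∏ b ∈ T.erase a, Polynomial.C ((a - b)⁻¹)) *
            ∏ a ∈ T, (Polynomial.X - Polynomial.C a) := by
        rw [← Finset.mul_prod_erase T _ ha, Lagrange.basis]
        simp only [Lagrange.basisDivisor, id]
        rw [Finset.prod_mul_distrib]; ring
      rw [this, map_mul, hkill, mul_zero]
    have h2 : s * Polynomial.aeval s (Lagrange.basis T id a)
        = a • Polynomial.aeval s (Lagrange.basis T id a) := by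
      rw [map_mul, map_sub, Polynomial.aeval_X, Polynomial.aeval_C, sub_mul, sub_eq_zero] at h1
      rw [h1, Algebra.smul_def]
    refine ⟨h2, ?_⟩
    rw [← h2]
    have h3 := congrArg (Polynomial.aeval s)
      (mul_comm (Lagrange.basis T id a) (Polynomial.X : Polynomial k))
    rwa [map_mul, map_mul, Polynomial.aeval_X] at h3
end WW

open MvPolynomial Matrix Pointwise
set_option linter.unusedSectionVars false
set_option linter.deprecated false
set_option linter.unusedSimpArgs false

section AdS
variable {k : Type*} [Field k] {n : ℕ}

/-- conjugation -/
noncomputable def Adm (s : GL (Fin n) k) : Module.End k (Mn n k) where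
  toFun v := (s : Mn n k) * v * ((s⁻¹ : GL (Fin n) k) : Mn n k)
  map_add' := by intro a b; rw [mul_add, add_mul]
  map_smul' := by intro c a; simp

lemma Adm_apply (s : GL (Fin n) k) (v : Mn n k) :
    Adm s v = (s : Mn n k) * v * ((s⁻¹ : GL (Fin n) k) : Mn n k) := rfl

lemma Adm_diag (s : GL (Fin n) k)
    (hs : ⨆ a, Module.End.eigenspace (Matrix.toLin' (s : Mn n k)) a = ⊤) :
    ⨆ a, Module.End.eigenspace (Adm s) a = ⊤ := by
  obtain ⟨t, p, h1, hp⟩ := conj_proj _ hs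
  rw [eq_top_iff]
  intro v _
  have hv : v = ∑ a ∈ t, ∑ b ∈ t, p a * v * p b := by
    simp only [← Finset.mul_sum, h1, mul_one, ← Finset.sum_mul, one_mul]
  rw [hv]
  refine Submodule.sum_mem _ fun a ha => Submodule.sum_mem _ fun b hb => ?_
  refine Submodule.mem_iSup_of_mem (a * b⁻¹) ?_
  rw [Module.End.mem_eigenspace_iff, Adm_apply]
  have h2 : p b * ((s⁻¹ : GL (Fin n) k) : Mn n k) = b⁻¹ • p b := by
    have h3 := congrArg (· * ((s⁻¹ : GL (Fin n) k) : Mn n k)) (hp b hb).2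
    simp only [mul_assoc, Matrix.smul_mul] at h3
    rw [← Units.val_mul, mul_inv_cancel, Units.val_one, mul_one] at h3
    by_cases hb0 : b = 0
    · rw [h3, hb0]; simp
    · conv_rhs => rw [h3, smul_smul, inv_mul_cancel₀ hb0, one_smul]
  have h4 : (s : Mn n k) * (p a * v * p b) * ((s⁻¹ : GL (Fin n) k) : Mn n k)
      = ((s : Mn n k) * p a) * v * (p b * ((s⁻¹ : GL (Fin n) k) : Mn n k)) := by
    simp only [mul_assoc]
  rw [h4, h2, (hp a ha).1]
  simp [smul_smul, mul_comm]

variable [CharZero k] [IsAlgClosed k]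

lemma der_sum {ι : Type*} (t : Finset ι) (x : ι → Mn n k) (f : Rn n k) :
    der (∑ i ∈ t, x i) f = ∑ i ∈ t, der (x i) f := by
  classical
  induction t using Finset.induction_on with
  | empty => simpa using der_smul (0 : k) (0 : Mn n k) f
  | insert a t ha ih => rw [Finset.sum_insert ha, Finset.sum_insert ha, der_add, ih]

lemma der_rho_pow_s (C : Subgroup (GL (Fin n) k)) (hC : ZC (C : Set (GL (Fin n) k)))
    (e : ℕ) (s : GL (Fin n) k) (hsC : s ∈ C)
    (hs : ⨆ a, Module.End.eigenspace (Matrix.toLin' (s : Mn n k)) a = ⊤)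
    (v : Mn n k) (hv : v ∈ lie C) (f : Rn n k) (hf : f ∈ Wf C e) :
    der v (rho ((s ^ n.factorial : GL (Fin n) k) : Mn n k) f)
      = rho ((s ^ n.factorial : GL (Fin n) k) : Mn n k) (der v f) := by
  obtain ⟨t, x, hx, hsum⟩ := eig_dec (Adm s) v (by rw [Adm_diag s hs]; trivial)
  have hxl : ∀ a ∈ t, x a ∈ lie C := by
    apply sep_mem (Adm s) (lie C) (fun y hy => lie_Ad hy hsC) t x
    · intro a ha; exact eig_gen _ _ (hx a ha)
    · rw [hsum]; exact hv
  have hxs : ∀ a ∈ t, (s : Mn n k) * x a = a • (x a * s) := by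
    intro a ha
    have h1 := Module.End.mem_eigenspace_iff.1 (hx a ha)
    rw [Adm_apply] at h1
    have h2 := congrArg (· * (s : Mn n k)) h1
    simp only [mul_assoc, Matrix.smul_mul] at h2
    rw [← Units.val_mul, inv_mul_cancel, Units.val_one, mul_one] at h2
    exact h2
  have hpow : ∀ a ∈ t, ∀ m, (s : Mn n k) ^ m * x a = a ^ m • (x a * (s : Mn n k) ^ m) := by
    intro a ha m
    induction m with
    | zero => simp
    | succ m ih =>
      rw [pow_succ, mul_assoc, hxs a ha, Matrix.mul_smul, ← mul_assoc, ih, Matrix.smul_mul,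
        smul_smul, mul_assoc, ← pow_succ, pow_succ' a]
  have hterm : ∀ g ∈ Wf C e, ∀ a ∈ t, a ^ n.factorial • der (x a) g = der (x a) g := by
    intro g hg a ha
    by_cases h1 : a ^ n.factorial = 1
    · rw [h1, one_smul]
    · have : (x a) ^ n = 0 := by
        refine nil_of_conj (s : Mn n k) (x a) s.isUnit a (hxs a ha) ?_
        intro i hi hin h2
        obtain ⟨d, hd⟩ := Nat.dvd_factorial hi hin
        exact h1 (by rw [hd, pow_mul, h2, one_pow])
      rw [nil_kills C hC (x a) this (hxl a ha) g hg.2, smul_zero]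
  have hw : (∑ a ∈ t, a ^ n.factorial • x a) * ((s ^ n.factorial : GL (Fin n) k) : Mn n k)
      = ((s ^ n.factorial : GL (Fin n) k) : Mn n k) * v := by
    rw [← hsum, Finset.sum_mul, Finset.mul_sum]
    refine Finset.sum_congr rfl fun a ha => ?_
    rw [Units.val_pow_eq_pow_val, hpow a ha, Matrix.smul_mul]
  rw [← der_rho _ _ _ hw]
  have hg := Wf_rho C e (C.pow_mem hsC n.factorial) hf
  conv_lhs => rw [← hsum]
  rw [der_sum, der_sum]
  refine Finset.sum_congr rfl fun a ha => ?_
  rw [der_smul, hterm _ hg a ha]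

lemma Wf_jordan (C : Subgroup (GL (Fin n) k)) (hC : ZC (C : Set (GL (Fin n) k)))
    (e : ℕ) (c : GL (Fin n) k) (hc : c ∈ C) : ∃ s : GL (Fin n) k, s ∈ C ∧
      ⨆ a, Module.End.eigenspace (Matrix.toLin' (s : Mn n k)) a = ⊤ ∧
      ∀ (m : ℕ), ∀ f ∈ Wf C e, rho ((c ^ m : GL (Fin n) k) : Mn n k) f
        = rho ((s ^ m : GL (Fin n) k) : Mn n k) f := by
  obtain ⟨s, u, hsC, huC, hu, rfl, hs⟩ := jordan C hC c hc
  refine ⟨s, hsC, hs, ?_⟩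
  have huf : u ∈ uGrp C := Subgroup.subset_closure ⟨huC, hu⟩
  intro m
  induction m with
  | zero => intro f _; simp
  | succ m ih =>
    intro f hf
    rw [pow_succ, Units.val_mul, ← rho_rho, Units.val_mul, ← rho_rho, hf.2 u huf,
      ih _ (Wf_rho C e hsC hf), rho_rho, ← Units.val_mul, ← pow_succ]

lemma comm_pow (C : Subgroup (GL (Fin n) k)) (hC : ZC (C : Set (GL (Fin n) k)))
    (hP : (vI (C : Set (GL (Fin n) k))).IsPrime)
    (e : ℕ) (c d : GL (Fin n) k) (hc : c ∈ C) (hd : d ∈ C) (f : Rn n k) (hf : f ∈ Wf C e) :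
    rho ((c ^ n.factorial : GL (Fin n) k) : Mn n k) (rho (d : Mn n k) f)
      = rho (d : Mn n k) (rho ((c ^ n.factorial : GL (Fin n) k) : Mn n k) f) := by
  obtain ⟨s, hsC, hs, hm⟩ := Wf_jordan C hC e c hc
  set b := c ^ n.factorial with hb
  have hder : ∀ v ∈ lie C, ∀ f ∈ Wf C e,
      der v (rho (b : Mn n k) f) = rho (b : Mn n k) (der v f) := by
    intro v hv f hf
    rw [hm _ f hf, hm _ _ (Wf_der C e hv hf)]
    exact der_rho_pow_s C hC e s hsC hs v hv f hf
  have key := lie_lemma C hP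
    {h | ∃ (z : Mn n k) (f : Rn n k), f ∈ Wf C e ∧
      h = lam (z * (b : Mn n k)) f - lam z (rho (b : Mn n k) f)} ?_ ?_
  · apply evm_ext
    intro z
    have h1 := key ⟨z, f, hf, rfl⟩ d hd
    rw [map_sub, evm_lam, evm_lam, evm_rho, sub_eq_zero] at h1
    rw [evm_rho, evm_rho, evm_rho, evm_rho]
    exact h1
  · rintro _ ⟨z, f, _, rfl⟩
    simp
  · rintro v hv _ ⟨z, f, hf, rfl⟩
    refine ⟨z, der v f, Wf_der C e hv hf, ?_⟩
    rw [map_sub, der_lam, der_lam, hder v hv f hf]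
end AdS

open MvPolynomial Matrix Pointwise
set_option linter.unusedSectionVars false
set_option linter.deprecated false
set_option linter.unusedSimpArgs false

section Psi
open scoped Kronecker

/-- Kronecker form of `X ↦ ∑ a^i X a^(N-1-i)` -/
noncomputable def KK {R ι : Type*} [CommRing R] [Fintype ι] [DecidableEq ι] (N : ℕ)
    (a : Matrix ι ι R) : Matrix (ι × ι) (ι × ι) R :=
  ∑ i ∈ Finset.range N, ((a ^ (N - 1 - i))ᵀ ⊗ₖ (a ^ i))

lemma KK_map {R S ι : Type*} [CommRing R] [CommRing S] [Fintype ι] [DecidableEq ι] (N : ℕ)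
    (φ : R →+* S) (a : Matrix ι ι R) : φ.mapMatrix (KK N a) = KK N (φ.mapMatrix a) := by
  unfold KK
  rw [map_sum]
  refine Finset.sum_congr rfl fun i _ => ?_
  rw [← map_pow, ← map_pow]
  ext p q
  simp [Matrix.kroneckerMap_apply, -Matrix.transpose_pow, -map_pow, Matrix.transpose_apply]

lemma KK_one {R ι : Type*} [CommRing R] [Fintype ι] [DecidableEq ι] (N : ℕ) :
    KK N (1 : Matrix ι ι R) = (N : R) • 1 := by
  unfold KK
  simp [Nat.cast_smul_eq_nsmul]

lemma KK_comm {R ι : Type*} [CommRing R] [Fintype ι] [DecidableEq ι] (N : ℕ)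
    (a b : Matrix ι ι R) (h : a ^ N * b = b * a ^ N) (i j : ι) :
    (KK N a).det * (a * b - b * a) i j = 0 := by
  have h1 : KK N a *ᵥ vec (a * b - b * a) = 0 := by
    have h2 : KK N a *ᵥ vec (a * b - b * a) = ∑ i ∈ Finset.range N,
        vec (a ^ (i + 1) * b * a ^ (N - (i + 1)) - a ^ i * b * a ^ (N - i)) := by
      unfold KK
      rw [Matrix.sum_mulVec]
      refine Finset.sum_congr rfl fun i hi => ?_
      rw [Matrix.kronecker_mulVec_vec, Matrix.transpose_transpose]
      congr 1
      have h3 : N - i = (N - 1 - i) + 1 := by have := Finset.mem_range.1 hi; omega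
      have h4 : N - (i + 1) = N - 1 - i := by omega
      rw [h3, h4, pow_succ a i, pow_succ' a (N - 1 - i)]
      noncomm_ring
    rw [h2]
    have h5 : ∀ f : ℕ → Matrix ι ι R, ∑ i ∈ Finset.range N, vec (f i)
        = vec (∑ i ∈ Finset.range N, f i) := by
      intro f
      ext p
      simp [vec, Matrix.sum_apply]
    rw [h5, Finset.sum_range_sub (fun i => a ^ i * b * a ^ (N - i))]
    simp [h]
  have h6 := congrArg ((KK N a).adjugate *ᵥ ·) h1
  simp only [Matrix.mulVec_mulVec, Matrix.adjugate_mul, Matrix.mulVec_zero, Matrix.smul_mulVec,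
    Matrix.one_mulVec] at h6
  have h7 := congrFun h6 (j, i)
  simpa [vec] using h7

variable {k : Type*} [Field k] {n : ℕ} [CharZero k] [IsAlgClosed k]

lemma Wf_comm (C : Subgroup (GL (Fin n) k)) (hC : ZC (C : Set (GL (Fin n) k)))
    (hP : (vI (C : Set (GL (Fin n) k))).IsPrime)
    (e : ℕ) (c d : GL (Fin n) k) (hc : c ∈ C) (hd : d ∈ C) (f : Rn n k) (hf : f ∈ Wf C e) :
    rho (c : Mn n k) (rho (d : Mn n k) f) = rho (d : Mn n k) (rho (c : Mn n k) f) := by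
  classical
  have := Wf_fin C e
  let b := Module.finBasis k (Wf C e)
  have hext : ∀ i, ∃ φ : Rn n k →ₗ[k] k, φ ∘ₗ (Wf C e).subtype = b.coord i :=
    fun i => LinearMap.exists_extend _
  choose φ hφ using hext
  have hφ' : ∀ i (w : Rn n k) (hw : w ∈ Wf C e), φ i w = b.repr ⟨w, hw⟩ i := by
    intro i w hw
    have := DFunLike.congr_fun (hφ i) ⟨w, hw⟩
    simpa using this
  have hexp : ∀ w ∈ Wf C e, w = ∑ i, φ i w • (b i : Rn n k) := by
    intro w hw
    have h1 := congrArg (Wf C e).subtype (b.sum_repr ⟨w, hw⟩)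
    rw [map_sum] at h1
    conv_lhs => rw [show w = (Wf C e).subtype ⟨w, hw⟩ from rfl, ← h1]
    refine Finset.sum_congr rfl fun i _ => ?_
    rw [hφ' i w hw]; rfl
  let Mt : Mn n k → Matrix _ _ k := fun x => Matrix.of fun i j => φ i (rho x (b j : Rn n k))
  have hexp2 : ∀ x ∈ C, ∀ j, rho (x : Mn n k) (b j : Rn n k)
      = ∑ i, Mt (x : Mn n k) i j • (b i : Rn n k) := by
    intro x hx j
    exact hexp _ (Wf_rho C e hx (b j).2)
  have hmul : ∀ x y : GL (Fin n) k, x ∈ C → y ∈ C →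
      Mt ((x * y : GL (Fin n) k) : Mn n k) = Mt (x : Mn n k) * Mt (y : Mn n k) := by
    intro x y hx hy
    ext i j
    rw [Matrix.mul_apply]
    simp only [Mt, Matrix.of_apply]
    rw [Units.val_mul, ← rho_rho]
    conv_lhs => rw [hexp2 y hy j, map_sum, map_sum]
    refine Finset.sum_congr rfl fun l _ => ?_
    rw [map_smul, map_smul, smul_eq_mul, mul_comm]; rfl
  have hone : Mt 1 = 1 := by
    ext i j
    simp only [Mt, Matrix.of_apply, rho_one]
    rw [hφ' i _ (b j).2]
    simp [Matrix.one_apply, Finsupp.single_apply, eq_comm]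
  have hpow : ∀ m : ℕ, ∀ x ∈ C, Mt ((x ^ m : GL (Fin n) k) : Mn n k) = Mt (x : Mn n k) ^ m := by
    intro m x hx
    induction m with
    | zero => simpa using hone
    | succ m ih => rw [pow_succ, hmul _ _ (C.pow_mem hx m) hx, ih, pow_succ]
  have hq : ∀ i j, ∃ q : Rn n k, ∀ x : Mn n k, evm x q = Mt x i j := by
    intro i j
    obtain ⟨q, hq, _⟩ := coef (b j : Rn n k) (φ i)
    exact ⟨q, hq⟩
  choose q hq using hq
  let Mp : Matrix _ _ (Rn n k) := Matrix.of q
  have hMp : ∀ x : Mn n k, ((evm x : Rn n k →ₐ[k] k) : Rn n k →+* k).mapMatrix Mp = Mt x := by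
    intro x
    ext i j
    simp [Mp, hq]
  set N := n.factorial
  have hdet : ∀ x : Mn n k, evm x (KK N Mp).det = (KK N (Mt x)).det := by
    intro x
    rw [← hMp, ← KK_map]
    exact RingHom.map_det ((evm x : Rn n k →ₐ[k] k) : Rn n k →+* k) _
  have hD : (KK N Mp).det ∉ vI (C : Set (GL (Fin n) k)) := by
    intro h
    have h1 := h 1 C.one_mem
    rw [hdet, Units.val_one, hone, KK_one, Matrix.det_smul, Matrix.det_one, mul_one] at h1
    exact (pow_ne_zero _ (Nat.cast_ne_zero.2 n.factorial_ne_zero)) h1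
  have hcomm : Mt (c : Mn n k) * Mt (d : Mn n k) = Mt (d : Mn n k) * Mt (c : Mn n k) := by
    ext i j
    let g : Rn n k := ∑ l, q i l * MvPolynomial.C (Mt (d : Mn n k) l j) - ∑ l, MvPolynomial.C (Mt (d : Mn n k) i l) * q l j
    have hg : ∀ x : Mn n k, evm x g = (Mt x * Mt (d : Mn n k) - Mt (d : Mn n k) * Mt x) i j := by
      intro x
      simp only [g, map_sub, map_sum, map_mul, evm_C, hq, Matrix.sub_apply, Matrix.mul_apply]
    have h1 : (KK N Mp).det * g ∈ vI (C : Set (GL (Fin n) k)) := by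
      intro x hx
      rw [map_mul, hdet, hg]
      apply KK_comm
      rw [← hpow _ x hx, ← hmul _ _ (C.pow_mem hx N) hd, ← hmul _ _ hd (C.pow_mem hx N)]
      ext i j
      simp only [Mt, Matrix.of_apply]
      rw [Units.val_mul, Units.val_mul, ← rho_rho, ← rho_rho,
        comm_pow C hC hP e x d hx hd _ (b j).2]
    have h2 := (hP.mem_or_mem h1).resolve_left hD c hc
    rw [hg, Matrix.sub_apply, sub_eq_zero] at h2
    exact h2
  have hb : ∀ j, rho (c : Mn n k) (rho (d : Mn n k) (b j : Rn n k))
      = rho (d : Mn n k) (rho (c : Mn n k) (b j : Rn n k)) := by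
    intro j
    rw [rho_rho, rho_rho, ← Units.val_mul, ← Units.val_mul, hexp2 _ (C.mul_mem hc hd),
      hexp2 _ (C.mul_mem hd hc), hmul _ _ hc hd, hmul _ _ hd hc, hcomm]
  rw [hexp f hf]
  simp only [map_sum, map_smul, hb]
end Psi

open MvPolynomial Matrix Pointwise
set_option linter.unusedSectionVars false
set_option linter.deprecated false
set_option linter.unusedSimpArgs false

section Semi
variable {k : Type*} [Field k] {n : ℕ}

lemma maxGen_sub {V : Type*} [AddCommGroup V] [Module k V] (p : Submodule k V)
    (S : Module.End k V) (T : Module.End k p) (h : ∀ w : p, ((T w : p) : V) = S w) (a : k) (w : p)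
    (hw : w ∈ T.maxGenEigenspace a) : (w : V) ∈ S.maxGenEigenspace a := by
  rw [Module.End.mem_maxGenEigenspace] at hw ⊢
  obtain ⟨m, h1⟩ := hw
  refine ⟨m, ?_⟩
  have h2 : ∀ m : ℕ, ∀ w : p, ((S - a • (1 : Module.End k V)) ^ m) (w : V)
      = ((((T - a • (1 : Module.End k p)) ^ m) w : p) : V) := by
    intro m
    induction m with
    | zero => intro w; rfl
    | succ m ih =>
      intro w
      rw [pow_succ, pow_succ, Module.End.mul_apply, Module.End.mul_apply, ← ih]
      congr 1
      simp [h]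
  rw [h2, h1]; rfl

/-- semi-invariants -/
def Semi (C : Subgroup (GL (Fin n) k)) (f : Rn n k) : Prop :=
  ∀ c ∈ C, ∃ a : k, rho (c : Mn n k) f = a • f

variable [CharZero k] [IsAlgClosed k]

lemma Wf_semi (C : Subgroup (GL (Fin n) k)) (hC : ZC (C : Set (GL (Fin n) k)))
    (hP : (vI (C : Set (GL (Fin n) k))).IsPrime) (e : ℕ) (f : Rn n k) (hf : f ∈ Wf C e) :
    f ∈ Submodule.span k {h : Rn n k | h.totalDegree ≤ e ∧ Semi C h} := by
  have := Wf_fin C e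
  let T : C → Module.End k (Wf C e) := fun c =>
    (rho ((c : GL (Fin n) k) : Mn n k)).toLinearMap.restrict (fun f hf => Wf_rho C e c.2 hf)
  have hT : ∀ (c : C) (w : Wf C e), ((T c w : Wf C e) : Rn n k)
      = rho ((c : GL (Fin n) k) : Mn n k) (w : Rn n k) := fun c w => rfl
  have hcomm : Pairwise fun i j => Commute (T i) (T j) := by
    intro c d _
    apply LinearMap.ext
    intro w
    apply Subtype.ext
    change ((T c (T d w) : Wf C e) : Rn n k) = ((T d (T c w) : Wf C e) : Rn n k)
    rw [hT, hT, hT, hT]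
    exact Wf_comm C hC hP e c d c.2 d.2 w w.2
  have htop := Module.End.iSup_iInf_maxGenEigenspace_eq_top_of_iSup_maxGenEigenspace_eq_top_of_commute
    T hcomm (fun c => Module.End.iSup_maxGenEigenspace_eq_top (T c))
  have hle : ⨆ χ : C → k, ⨅ c, (T c).maxGenEigenspace (χ c)
      ≤ (Submodule.span k {h : Rn n k | h.totalDegree ≤ e ∧ Semi C h}).comap
        (Wf C e).subtype := by
    apply iSup_le
    intro χ w hw
    apply Submodule.subset_span
    refine ⟨w.2.1, ?_⟩
    intro c hc
    refine ⟨χ ⟨c, hc⟩, ?_⟩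
    obtain ⟨s, hsC, hs, hm⟩ := Wf_jordan C hC e c hc
    have hm1 : ∀ w : Wf C e, rho (c : Mn n k) (w : Rn n k) = rho (s : Mn n k) (w : Rn n k) := by
      intro w
      have := hm 1 w w.2
      rwa [pow_one, pow_one] at this
    change rho (c : Mn n k) (w : Rn n k) = χ ⟨c, hc⟩ • (w : Rn n k)
    rw [hm1]
    apply maxGen_eq (rho (s : Mn n k)).toLinearMap (rho_diag _ hs)
    rw [Submodule.mem_iInf] at hw
    refine maxGen_sub (Wf C e) (rho (s : Mn n k)).toLinearMap (T ⟨c, hc⟩) ?_ _ w (hw ⟨c, hc⟩)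
    intro w
    rw [hT]
    exact hm1 w
  rw [htop] at hle
  exact hle (x := ⟨f, hf⟩) trivial
end Semi

open MvPolynomial Matrix Pointwise
set_option linter.unusedSectionVars false
set_option linter.deprecated false
set_option linter.unusedSimpArgs false

section Chev
variable {k : Type*} [Field k] {n : ℕ}

lemma exists_frame [Infinite k] {s : ℕ} (f : Fin s → Rn n k) (hf : LinearIndependent k f)
    (g : Mn n k) (hg : ∃ i, evm g (f i) ≠ 0) : ∃ B : Fin s → Mn n k, (∃ j, B j = g) ∧
      (Matrix.of fun j i => evm (B j) (f i)).det ≠ 0 := by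
  classical
  let v : Mn n k → (Fin s → k) := fun B i => evm B (f i)
  have hv : LinearIndepOn k v {g} := by
    rw [linearIndepOn_singleton_iff]
    intro h
    obtain ⟨i, hi⟩ := hg
    exact hi (congrFun h i)
  obtain ⟨b, -, hgb, hspan, hli⟩ := exists_linearIndepOn_extension hv (Set.subset_univ _)
  have htop : ⊤ ≤ Submodule.span k (Set.range fun x : b => v x) := by
    have h0 : Set.range (fun x : b => v x) = v '' b := by
      ext; simp
    rw [h0]
    by_contra hne
    obtain ⟨φ, hφ0, hφ⟩ := Submodule.exists_le_ker_of_lt_top _ (lt_top_iff_ne_top.2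
      (fun h => hne (le_of_eq h.symm)))
    apply hφ0
    have h1 : ∀ B, ∑ i, evm B (f i) * φ (Pi.single i 1) = 0 := by
      intro B
      have h2 : φ (v B) = 0 := hφ (hspan ⟨B, trivial, rfl⟩)
      rw [LinearMap.pi_apply_eq_sum_univ] at h2
      rw [← h2]
      refine Finset.sum_congr rfl fun i _ => ?_
      rw [smul_eq_mul]
      congr 2
      ext j; simp [Pi.single_apply, eq_comm]
    have h3 : ∑ i, φ (Pi.single i 1) • f i = 0 := by
      apply evm_ext
      intro B
      rw [map_sum, map_zero, ← h1 B]
      refine Finset.sum_congr rfl fun i _ => ?_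
      rw [map_smul, smul_eq_mul, mul_comm]
    have h4 := Fintype.linearIndependent_iff.1 hf _ h3
    apply LinearMap.pi_ext'
    intro i
    apply LinearMap.ext_ring
    simpa using h4 i
  let bb := Module.Basis.mk hli htop
  let e : b ≃ Fin s := bb.indexEquiv (Pi.basisFun k (Fin s))
  refine ⟨fun j => (e.symm j : Mn n k), ⟨e ⟨g, hgb rfl⟩, by simp⟩, ?_⟩
  have h5 : LinearIndependent k (fun j => v (e.symm j)) :=
    LinearIndependent.comp hli e.symm e.symm.injective
  have h6 := (Matrix.linearIndependent_rows_iff_isUnit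
    (A := Matrix.of fun j i => evm (e.symm j : Mn n k) (f i))).1 h5
  exact ((Matrix.isUnit_iff_isUnit_det _).1 h6).ne_zero

lemma scalar_unip (u : Mn n k) (hu : (u - 1) ^ n = 0) (h : Rn n k) (a : k)
    (ha : rho u h = a • h) : rho u h = h := by
  obtain ⟨m, hm⟩ := rho_nil u hu h
  have h1 : ∀ m : ℕ, (((rho u).toLinearMap - 1 : Module.End k (Rn n k)) ^ m) h = (a - 1) ^ m • h := by
    intro m
    induction m with
    | zero => simp
    | succ m ih =>
      rw [pow_succ', Module.End.mul_apply, ih, map_smul, LinearMap.sub_apply,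
        AlgHom.toLinearMap_apply, ha, Module.End.one_apply, pow_succ, mul_smul, sub_smul a, one_smul]
  rw [h1] at hm
  rcases smul_eq_zero.1 hm with h2 | h2
  · have := sub_eq_zero.1 (by by_contra h3; exact pow_ne_zero m h3 h2)
    rw [ha, this, one_smul]
  · rw [h2, map_zero]

end Chev

open MvPolynomial Matrix Pointwise
set_option linter.unusedSectionVars false
set_option linter.deprecated false
set_option linter.unusedSimpArgs false

section Chev2
variable {k : Type*} [Field k] {n : ℕ}

/-- elements of bounded degree in the ideal -/
noncomputable def IT (G : Set (GL (Fin n) k)) (T : ℕ) : Submodule k (Rn n k) :=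
  (vI G).restrictScalars k ⊓ restrictTotalDegree (Fin n ×ₗ Fin n) k T

lemma mem_IT {G : Set (GL (Fin n) k)} {T : ℕ} {f : Rn n k} :
    f ∈ IT G T ↔ f ∈ vI G ∧ f.totalDegree ≤ T := by
  rw [IT, Submodule.mem_inf, mem_restrictTotalDegree]; rfl

lemma IT_fin (G : Set (GL (Fin n) k)) (T : ℕ) : FiniteDimensional k (IT G T) :=
  Submodule.finiteDimensional_of_le (inf_le_right :
    IT G T ≤ restrictTotalDegree (Fin n ×ₗ Fin n) k T)

lemma inv_gen [Infinite k] (C : Subgroup (GL (Fin n) k)) (h : Rn n k)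
    (hh : ∀ u ∈ C, IsUnipotent u → rho (u : Mn n k) h = h) :
    ∀ g ∈ uGrp C, rho (g : Mn n k) h = h := by
  intro g hg
  induction hg using Subgroup.closure_induction with
  | mem x hx => exact hh x hx.1 hx.2
  | one => simp
  | mul x y _ _ hx hy => rw [Units.val_mul, ← rho_rho, hy, hx]
  | inv x _ hx =>
    conv_lhs => rw [← hx]
    rw [rho_rho, ← Units.val_mul]; simp

lemma delta_mem [Infinite k] (C : Subgroup (GL (Fin n) k)) (T s : ℕ)
    (b : Module.Basis (Fin s) k (IT (uGrp C : Set (GL (Fin n) k)) T)) (A : Fin s → Mn n k) :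
    (Matrix.of fun j i => lam (A j) (b i : Rn n k)).det ∈ Wf C (s * T) := by
  refine ⟨?_, ?_⟩
  · refine (totalDegree_det_le _ T ?_).trans (by simp)
    intro i j
    exact (totalDegree_lam_le _ _).trans (mem_IT.1 (b j).2).2
  · apply inv_gen
    intro u hu huu
    have huG : u ∈ uGrp C := Subgroup.subset_closure ⟨hu, huu⟩
    have hst : ∀ i, rho (u : Mn n k) (b i : Rn n k) ∈ IT (uGrp C : Set (GL (Fin n) k)) T := by
      intro i
      have := mem_IT.1 (b i).2
      exact mem_IT.2 ⟨vI_rho_mem _ huG this.1, (totalDegree_rho_le _ _).trans this.2⟩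
    let m : Matrix (Fin s) (Fin s) k := Matrix.of fun l i => b.repr ⟨_, hst i⟩ l
    have hm : ∀ i, rho (u : Mn n k) (b i : Rn n k) = ∑ l, m l i • (b l : Rn n k) := by
      intro i
      have h1 := congrArg (Submodule.subtype _) (b.sum_repr ⟨_, hst i⟩)
      rw [map_sum] at h1
      exact h1.symm
    apply scalar_unip _ huu _ m.det
    have h2 : ((rho (u : Mn n k) : Rn n k →ₐ[k] Rn n k) : Rn n k →+* Rn n k).mapMatrix
        (Matrix.of fun j i => lam (A j) (b i : Rn n k))
        = (Matrix.of fun j i => lam (A j) (b i : Rn n k)) * (MvPolynomial.C : k →+* Rn n k).mapMatrix m := by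
      ext1 j i
      rw [Matrix.mul_apply]
      simp only [RingHom.mapMatrix_apply, Matrix.map_apply, Matrix.of_apply, RingHom.coe_coe]
      rw [rho_lam, hm, map_sum]
      refine Finset.sum_congr rfl fun l _ => ?_
      rw [map_smul, smul_eq_C_mul, mul_comm]
    have h3 := RingHom.map_det ((rho (u : Mn n k) : Rn n k →ₐ[k] Rn n k) : Rn n k →+* Rn n k)
      (Matrix.of fun j i => lam (A j) (b i : Rn n k))
    rw [h2, Matrix.det_mul, ← RingHom.map_det] at h3
    rw [smul_eq_C_mul, mul_comm]
    exact h3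

/-- elements fixing all the invariants kill the ideal -/
lemma chev_zero [Infinite k] (C : Subgroup (GL (Fin n) k)) (T : ℕ) (g : GL (Fin n) k)
    (hg : ∀ h ∈ Wf C (Module.finrank k (IT (uGrp C : Set (GL (Fin n) k)) T) * T),
      rho (g : Mn n k) h = h)
    (f : Rn n k) (hf : f ∈ IT (uGrp C : Set (GL (Fin n) k)) T) : evm (g : Mn n k) f = 0 := by
  classical
  have := IT_fin (uGrp C : Set (GL (Fin n) k)) T
  let b := Module.finBasis k (IT (uGrp C : Set (GL (Fin n) k)) T)
  by_cases hall : ∀ i, evm (g : Mn n k) (b i : Rn n k) = 0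
  · have h1 := congrArg (Submodule.subtype _) (b.sum_repr ⟨f, hf⟩)
    rw [map_sum] at h1
    have h2 : ∑ i, b.repr ⟨f, hf⟩ i • (b i : Rn n k) = f := h1
    rw [← h2, map_sum]
    refine Finset.sum_eq_zero fun i _ => ?_
    rw [map_smul, hall i, smul_zero]
  · exfalso
    push Not at hall
    obtain ⟨B, ⟨j, hj⟩, hB⟩ := exists_frame (fun i => (b i : Rn n k))
      (b.linearIndependent.map' (Submodule.subtype _) (Submodule.ker_subtype _)) g hall
    let A : _ → Mn n k := fun j => B j * ((g⁻¹ : GL (Fin n) k) : Mn n k)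
    have hA : A j = 1 := by
      simp only [A]
      rw [hj, ← Units.val_mul, mul_inv_cancel, Units.val_one]
    have h1 := hg _ (delta_mem C T _ b A)
    have h2 := congrArg (evm (1 : Mn n k)) h1
    rw [evm_rho, one_mul] at h2
    have h3 : ∀ x : Mn n k, evm x (Matrix.of fun j i => lam (A j) (b i : Rn n k)).det
        = (Matrix.of fun j i => evm (A j * x) (b i : Rn n k)).det := by
      intro x
      have := RingHom.map_det ((evm x : Rn n k →ₐ[k] k) : Rn n k →+* k)
        (Matrix.of fun j i => lam (A j) (b i : Rn n k))
      refine this.trans ?_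
      congr 1
      ext p q
      simp
    rw [h3, h3] at h2
    apply hB
    have h4 : (Matrix.of fun j i => evm (A j * (g : Mn n k)) (b i : Rn n k))
        = Matrix.of fun j i => evm (B j) (b i : Rn n k) := by
      ext p q
      simp only [A, Matrix.of_apply]
      rw [mul_assoc, ← Units.val_mul, inv_mul_cancel, Units.val_one, mul_one]
    rw [h4] at h2
    rw [h2]
    apply Matrix.det_eq_zero_of_row_eq_zero j
    intro i
    simp only [Matrix.of_apply]
    rw [hA, mul_one]
    exact (mem_IT.1 (b i).2).1 1 (uGrp C).one_mem

lemma leadCoeff_deg {σ : Type*} [LinearOrder σ] (c : σ) (g : MvPolynomial σ k) :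
    (leadCoeff c g).totalDegree ≤ g.totalDegree := by
  unfold leadCoeff
  apply totalDegree_finsetSum_le
  intro m hm
  have h1 := (Finset.mem_filter.1 hm).1
  refine (totalDegree_monomial_le _ _).trans (le_trans ?_ (le_totalDegree h1))
  change (Finsupp.erase c m).sum (fun _ e => e) ≤ m.sum fun _ e => e
  rw [Finsupp.sum, Finsupp.sum, Finsupp.support_erase]
  refine le_trans (Finset.sum_le_sum fun i hi => ?_)
    (Finset.sum_le_sum_of_subset (Finset.erase_subset c _))
  rw [Finsupp.erase_ne (Finset.ne_of_mem_erase hi)]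

variable [CharZero k] [IsAlgClosed k]

/-- `T n` : the bound for the unipotent part -/
def T1 (n : ℕ) : ℕ := TB ((n + 1) ^ (n * n)) (n * n)

lemma chev (C : Subgroup (GL (Fin n) k)) (hC : ZC (C : Set (GL (Fin n) k)))
    (hP : (vI (C : Set (GL (Fin n) k))).IsPrime) (e : ℕ)
    (he : Module.finrank k (IT (uGrp C : Set (GL (Fin n) k)) (T1 n)) * T1 n ≤ e)
    (g : GL (Fin n) k)
    (hg : ∀ h : Rn n k, h.totalDegree ≤ e → Semi C h → rho (g : Mn n k) h = h) : g ∈ C := by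
  classical
  set Γ : Set (GL (Fin n) k) := (uGrp C : Set (GL (Fin n) k)) with hΓ
  set T := T1 n with hT
  -- the group fixing Wf
  have hcard : Fintype.card (Fin n ×ₗ Fin n) = n * n := by simp [Lex]
  have hW : ∀ h ∈ Wf C (Module.finrank k (IT Γ T) * T), rho (g : Mn n k) h = h := by
    intro h hh
    have h1 : h ∈ Wf C e := ⟨hh.1.trans he, hh.2⟩
    have h2 := Wf_semi C hC hP e h h1
    have h3 : Submodule.span k {h : Rn n k | h.totalDegree ≤ e ∧ Semi C h}
        ≤ LinearMap.eqLocus (rho (g : Mn n k)).toLinearMap LinearMap.id := by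
      rw [Submodule.span_le]
      intro x hx
      exact hg x hx.1 hx.2
    exact h3 h2
  have hW' : ∀ h ∈ Wf C (Module.finrank k (IT Γ T) * T),
      rho ((g⁻¹ : GL (Fin n) k) : Mn n k) h = h := by
    intro h hh
    conv_lhs => rw [← hW h hh]
    rw [rho_rho, ← Units.val_mul]; simp
  have hst : ∀ x : GL (Fin n) k, (∀ h ∈ Wf C (Module.finrank k (IT Γ T) * T),
      rho (x : Mn n k) h = h) → ∀ f ∈ IT Γ T, rho (x : Mn n k) f ∈ IT Γ T := by
    intro x hx f hf
    refine mem_IT.2 ⟨?_, (totalDegree_rho_le _ _).trans (mem_IT.1 hf).2⟩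
    intro γ hγ
    rw [evm_rho, ← Units.val_mul]
    apply chev_zero C T (γ * x) _ f hf
    intro h hh
    rw [Units.val_mul, ← rho_rho, hx h hh, hh.2 γ hγ]
  obtain ⟨hprime, m, hm, htr, hHF⟩ := uGrp_ideal C hC
  obtain ⟨y, hy⟩ := htr.indep
  obtain ⟨A, G, -, htrep, hG⟩ := thmB (vI Γ) m ((n + 1) ^ (n * n)) (by positivity) (by
    intro s hs
    refine (hHF s).trans ?_
    calc (n * s + 1) ^ m ≤ ((n + 1) * s) ^ m := Nat.pow_le_pow_left (by nlinarith) m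
      _ = (n + 1) ^ m * s ^ m := mul_pow _ _ _
      _ ≤ (n + 1) ^ (n * n) * s ^ m :=
        Nat.mul_le_mul_right _ (Nat.pow_le_pow_right (by omega) hm)) y hy
  rw [hcard] at hG
  have hmem : ∀ f ∈ vI Γ, rho (g : Mn n k) f ∈ vI Γ := by
    intro f hf
    have hf' : f ∈ trep (A.sort.map G) := by rw [htrep]; exact hf
    obtain ⟨c, α, q, hc, hq, -⟩ := hf'
    have hget : ∀ i, ∃ j ∈ A, (A.sort.map G).get i = G j := by
      intro i
      have := List.get_mem (A.sort.map G) i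
      obtain ⟨j, hj, hj'⟩ := List.mem_map.1 this
      exact ⟨j, (Finset.mem_sort _).1 hj, hj'.symm⟩
    have h1 := congrArg (rho (g : Mn n k)) hq
    rw [map_mul, add_zero, map_sum, map_prod] at h1
    have h2 : (∏ i, rho (g : Mn n k) (leadCoeff (c i) ((A.sort.map G).get i) ^ α i))
        * rho (g : Mn n k) f ∈ vI Γ := by
      rw [h1]
      refine Ideal.sum_mem _ fun i _ => ?_
      rw [map_mul]
      apply Ideal.mul_mem_left
      obtain ⟨j, hj, hj'⟩ := hget i
      rw [hj']
      exact (mem_IT.1 (hst g hW _ (mem_IT.2 ⟨(hG j hj).1, (hG j hj).2.1⟩))).1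
    rcases hprime.mem_or_mem h2 with h3 | h3
    · exfalso
      obtain ⟨i, -, hi⟩ := hprime.prod_mem_iff.1 h3
      rw [map_pow] at hi
      have h4 := hprime.mem_of_pow_mem _ hi
      obtain ⟨j, hj, hj'⟩ := hget i
      have hci : c i = j := by
        have h5 := hc i
        rw [hj', (hG j hj).2.2.1] at h5
        exact (WithBot.coe_injective h5).symm
      rw [hj', hci] at h4
      have h6 : leadCoeff j (G j) ∈ vI Γ := by
        have h7 := hst g⁻¹ hW' _ (mem_IT.2 ⟨h4, (totalDegree_rho_le _ _).trans
          ((leadCoeff_deg _ _).trans (hG j hj).2.1)⟩)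
        rw [rho_rho, ← Units.val_mul, inv_mul_cancel, Units.val_one, rho_one] at h7
        exact (mem_IT.1 h7).1
      exact (hG j hj).2.2.2 h6
    · exact h3
  apply hC
  intro f hf
  have h8 : f ∈ vI Γ := fun x hx => hf x (uGrp_le C hx)
  have h9 := hmem f h8 1 (uGrp C).one_mem
  rwa [evm_rho, Units.val_one, one_mul] at h9

lemma IT_finrank (G : Set (GL (Fin n) k)) (T : ℕ) :
    Module.finrank k (IT G T) ≤ (T + 1) ^ (n * n) := by
  have hcard : Fintype.card (Fin n ×ₗ Fin n) = n * n := by simp [Lex]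
  have h1 := HF_le_monomials (⊥ : Ideal (Rn n k)) T
  rw [hcard] at h1
  refine le_trans ?_ h1
  refine (Submodule.finrank_mono (inf_le_right :
    IT G T ≤ restrictTotalDegree (Fin n ×ₗ Fin n) k T)).trans ?_
  unfold HF
  have hinj : Function.Injective (Ideal.Quotient.mkₐ k (⊥ : Ideal (Rn n k))).toLinearMap := by
    rw [injective_iff_map_eq_zero]
    intro a ha
    have h2 : Ideal.Quotient.mk (⊥ : Ideal (Rn n k)) a = 0 := ha
    rw [Ideal.Quotient.eq_zero_iff_mem] at h2
    exact h2
  exact le_of_eq (Submodule.equivMapOfInjective _ hinj _).finrank_eq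
end Chev2

open MvPolynomial Matrix Pointwise
set_option linter.unusedSectionVars false
set_option linter.deprecated false
set_option linter.unusedSimpArgs false

section Hb
variable {k : Type*} [Field k] {n : ℕ}

lemma sub_comp (M0 M' : Subgroup (GL (Fin n) k)) (hM0 : ZC (M0 : Set (GL (Fin n) k)))
    (hfi : FinIdx (M0 : Set (GL (Fin n) k)) M') (Y : Set (GL (Fin n) k)) (hY : Y ⊆ M')
    (hP : (vI Y).IsPrime) (h1 : 1 ∈ Y) : Y ⊆ M0 := by
  obtain ⟨t, -, ht⟩ := hfi
  obtain ⟨x, -, hx⟩ := irr_union hP t (fun x => ltr x (M0 : Set (GL (Fin n) k)))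
    (fun x _ => ZC_ltr x hM0) (by
      intro y hy
      obtain ⟨x, hx, hxy⟩ := ht y (hY hy)
      exact Set.mem_biUnion hx hxy)
  intro y hy
  have h2 : x⁻¹ * 1 ∈ M0 := hx h1
  have h3 : x⁻¹ * y ∈ M0 := hx hy
  have h4 : y = (x⁻¹ * 1)⁻¹ * (x⁻¹ * y) := by group
  rw [h4]
  exact M0.mul_mem (M0.inv_mem h2) h3

/-- stabilizer of all the lines spanned by semi-invariants of degree at most `e` -/
def lineStab [Infinite k] (C : Subgroup (GL (Fin n) k)) (e : ℕ) : Subgroup (GL (Fin n) k) where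
  carrier := {g | ∀ f : Rn n k, f.totalDegree ≤ e → Semi C f → ∃ a : k, rho (g : Mn n k) f = a • f}
  mul_mem' := by
    intro g h hg hh f hf hs
    obtain ⟨a, ha⟩ := hg f hf hs
    obtain ⟨b, hb⟩ := hh f hf hs
    exact ⟨b * a, by rw [Units.val_mul, ← rho_rho, hb, map_smul, ha, smul_smul]⟩
  one_mem' := by
    intro f _ _
    exact ⟨1, by simp⟩
  inv_mem' := by
    intro g hg f hf hs
    obtain ⟨a, ha⟩ := hg f hf hs
    have h1 := congrArg (rho ((g⁻¹ : GL (Fin n) k) : Mn n k)) ha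
    rw [rho_rho, ← Units.val_mul, inv_mul_cancel, Units.val_one, rho_one, map_smul] at h1
    by_cases h0 : a = 0
    · rw [h0, zero_smul] at h1
      exact ⟨0, by rw [h1]; simp⟩
    · refine ⟨a⁻¹, ?_⟩
      conv_rhs => rw [h1, smul_smul, inv_mul_cancel₀ h0, one_smul]

/-- the equations of `lineStab` -/
def lineEqs (C : Subgroup (GL (Fin n) k)) (e : ℕ) : Set (Rn n k) :=
  {q | ∃ (f : Rn n k) (A B : Mn n k), f.totalDegree ≤ e ∧ Semi C f ∧
    q = evm B f • lam A f - evm A f • lam B f}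

lemma lineEqs_deg (C : Subgroup (GL (Fin n) k)) (e : ℕ) {q : Rn n k} (hq : q ∈ lineEqs C e) :
    q.totalDegree ≤ e := by
  obtain ⟨f, A, B, hf, -, rfl⟩ := hq
  refine (totalDegree_sub _ _).trans (max_le ?_ ?_) <;>
  exact (totalDegree_smul_le _ _).trans ((totalDegree_lam_le _ _).trans hf)

lemma mem_lineStab_iff [Infinite k] (C : Subgroup (GL (Fin n) k)) (e : ℕ) (g : GL (Fin n) k) :
    g ∈ (lineStab C e : Set (GL (Fin n) k)) ↔ ∀ q ∈ lineEqs C e, evm (g : Mn n k) q = 0 := by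
  constructor
  · rintro hg _ ⟨f, A, B, hf, hs, rfl⟩
    obtain ⟨a, ha⟩ := hg f hf hs
    have h1 : ∀ A : Mn n k, evm (A * (g : Mn n k)) f = a * evm A f := by
      intro A
      rw [← evm_rho, ha, map_smul, smul_eq_mul]
    rw [map_sub, map_smul, map_smul, evm_lam, evm_lam, h1, h1, smul_eq_mul, smul_eq_mul]
    ring
  · intro h f hf hs
    by_cases h0 : ∃ B : Mn n k, evm B f ≠ 0
    · obtain ⟨B, hB⟩ := h0
      refine ⟨evm (B * (g : Mn n k)) f / evm B f, ?_⟩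
      apply evm_ext
      intro A
      have h1 := h _ ⟨f, A, B, hf, hs, rfl⟩
      rw [map_sub, map_smul, map_smul, evm_lam, evm_lam, smul_eq_mul, smul_eq_mul,
        sub_eq_zero] at h1
      rw [evm_rho, map_smul, smul_eq_mul]
      field_simp
      linear_combination h1
    · push Not at h0
      have : f = 0 := evm_ext (by intro A; rw [h0, map_zero])
      exact ⟨0, by rw [this]; simp⟩

lemma ZC_lineStab [Infinite k] (C : Subgroup (GL (Fin n) k)) (e : ℕ) :
    ZC (lineStab C e : Set (GL (Fin n) k)) := ZC_of _ _ (mem_lineStab_iff C e)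

/-- Nullstellensatz on `GL_n` -/
lemma vI_zero [IsAlgClosed k] (Q : Ideal (Rn n k)) (hQ : Q.IsPrime) (hdt : dt n k ∉ Q) :
    vI {g : GL (Fin n) k | ∀ q ∈ Q, evm (g : Mn n k) q = 0} = Q := by
  apply le_antisymm
  · intro f hf
    have h1 : f * dt n k ∈ Q := by
      have h2 : f * dt n k ∈ Q.radical := by
        rw [← MvPolynomial.vanishingIdeal_zeroLocus_eq_radical (K := k) Q, mem_vanishingIdeal_iff]
        intro x hx
        rw [mem_zeroLocus_iff] at hx
        let A : Mn n k := Matrix.of fun i j => x (toLex (i, j))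
        have hA : ∀ q : Rn n k, aeval x q = evm A q := by
          intro q
          have : aeval x = (evm A : Rn n k →ₐ[k] k) := by
            apply Rn_algHom_ext
            intro i j
            rw [evm_xv]
            simp [xv, A]
          rw [this]
        rw [hA, map_mul, evm_dt]
        by_cases hd : A.det = 0
        · rw [hd, mul_zero]
        · have h3 := hf (Matrix.GeneralLinearGroup.mkOfDetNeZero A hd) (by
            intro q hq
            have := hx q hq
            rw [hA] at this
            exact this)
          have h4 : evm A f = 0 := h3
          rw [h4, zero_mul]
      rwa [hQ.radical] at h2
    exact (hQ.mem_or_mem h1).resolve_right hdt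
  · intro f hf g hg
    exact hg f hf

lemma dt_notMem {Y : Set (GL (Fin n) k)} (h1 : 1 ∈ Y) : dt n k ∉ vI Y := by
  intro h
  have := h 1 h1
  rw [evm_dt] at this
  simp at this

lemma lineEqs_min [IsAlgClosed k] (C M0 : Subgroup (GL (Fin n) k)) (e : ℕ)
    (hM0 : ZC (M0 : Set (GL (Fin n) k)))
    (hfi : FinIdx (M0 : Set (GL (Fin n) k)) (lineStab C e))
    (Q : Ideal (Rn n k)) (hQ : Q.IsPrime) (hIQ : lineEqs C e ⊆ Q)
    (hQM : Q ≤ vI (M0 : Set (GL (Fin n) k))) : Q = vI (M0 : Set (GL (Fin n) k)) := by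
  apply le_antisymm hQM
  have h0 := vI_zero Q hQ (fun h => dt_notMem M0.one_mem (hQM h))
  set Y := {g : GL (Fin n) k | ∀ q ∈ Q, evm (g : Mn n k) q = 0} with hY
  have h1 : Y ⊆ M0 := by
    apply sub_comp M0 (lineStab C e) hM0 hfi
    · intro y hy
      rw [mem_lineStab_iff]
      intro q hq
      exact hy q (hIQ hq)
    · rw [h0]; exact hQ
    · intro q hq
      exact hQM hq 1 M0.one_mem
  rw [← h0]
  exact vI_anti h1

end Hb

open MvPolynomial Matrix Pointwise
set_option linter.unusedSectionVars false
set_option linter.deprecated false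
set_option linter.unusedSimpArgs false

section Hb2
variable {k : Type*} [Field k] {n : ℕ} [CharZero k] [IsAlgClosed k]

/-- the degree of the semi-invariants -/
def E1 (n : ℕ) : ℕ := (T1 n + 1) ^ (n * n) * T1 n
/-- the final degree bound -/
def FB (n : ℕ) : ℕ := TB (2 ^ (n * n) * (1 + E1 n) ^ (n * n * (n * n))) (n * n)

lemma coset_tri (C M0 : Subgroup (GL (Fin n) k)) (e : ℕ)
    (hM0 : ZC (M0 : Set (GL (Fin n) k))) (hP : (vI (M0 : Set (GL (Fin n) k))).IsPrime)
    (hle : M0 ≤ lineStab C e)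
    (hfi : FinIdx (M0 : Set (GL (Fin n) k)) (lineStab C e)) (t : GL (Fin n) k) :
    ∃ G : List (Rn n k), IsTriangularSet G ∧ (∀ g ∈ G, g.totalDegree ≤ TB (2 ^ (n * n) * (1 + e) ^ (n * n * (n * n))) (n * n)) ∧
      trep G = vI (ltr t (M0 : Set (GL (Fin n) k))) := by
  classical
  have hcard : Fintype.card (Fin n ×ₗ Fin n) = n * n := by simp [Lex]
  have hlam1 : ∀ f : Rn n k, lam (t : Mn n k) (lam ((t⁻¹ : GL (Fin n) k) : Mn n k) f) = f := by
    intro f; rw [lam_lam, ← Units.val_mul]; simp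
  have hlam2 : ∀ f : Rn n k, lam ((t⁻¹ : GL (Fin n) k) : Mn n k) (lam (t : Mn n k) f) = f := by
    intro f; rw [lam_lam, ← Units.val_mul]; simp
  rw [vI_ltr]
  have hprime : ((vI (M0 : Set (GL (Fin n) k))).comap (lam (t : Mn n k))).IsPrime :=
    Ideal.comap_isPrime (lam (t : Mn n k)) _
  have hmin : ∀ Q : Ideal (Rn n k), Q.IsPrime →
      {f : Rn n k | lam (t : Mn n k) f ∈ lineEqs C e} ⊆ Q →
      Q ≤ (vI (M0 : Set (GL (Fin n) k))).comap (lam (t : Mn n k)) →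
      Q = (vI (M0 : Set (GL (Fin n) k))).comap (lam (t : Mn n k)) := by
      intro Q hQ hIQ hQP
      apply le_antisymm hQP
      have h1 := lineEqs_min C M0 e hM0 hfi
        (Q.comap (lam ((t⁻¹ : GL (Fin n) k) : Mn n k)))
        (Ideal.comap_isPrime (lam ((t⁻¹ : GL (Fin n) k) : Mn n k)) _)
        (by
          intro q hq
          rw [SetLike.mem_coe, Ideal.mem_comap]
          have h5 : lam ((t⁻¹ : GL (Fin n) k) : Mn n k) q
              ∈ {f : Rn n k | lam (t : Mn n k) f ∈ lineEqs C e} := by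
            rw [Set.mem_setOf_eq, hlam1]; exact hq
          exact hIQ h5)
        (by
          intro f hf
          have h3 := Ideal.mem_comap.1 (hQP (Ideal.mem_comap.1 hf))
          rwa [hlam1] at h3)
      intro f hf
      have h2 := Ideal.mem_comap.1 hf
      rw [← h1] at h2
      have h3 := Ideal.mem_comap.1 h2
      rwa [hlam2] at h3
  have hdeg : ∀ f ∈ {f : Rn n k | lam (t : Mn n k) f ∈ lineEqs C e}, f.totalDegree ≤ e := by
    intro f hf
    rw [← hlam2 f]
    exact (totalDegree_lam_le _ _).trans (lineEqs_deg C _ hf)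
  have hsub : {f : Rn n k | lam (t : Mn n k) f ∈ lineEqs C e} ⊆
      ((vI (M0 : Set (GL (Fin n) k))).comap (lam (t : Mn n k)) : Ideal (Rn n k)) := by
    intro f hf
    rw [SetLike.mem_coe, Ideal.mem_comap]
    intro g hg
    exact (mem_lineStab_iff C _ g).1 (hle hg) _ hf
  generalize (vI (M0 : Set (GL (Fin n) k))).comap (lam (t : Mn n k)) = P at *
  generalize {f : Rn n k | lam (t : Mn n k) f ∈ lineEqs C e} = I at *
  obtain ⟨r, htr, hHF⟩ := bezout I e hdeg P hsub hmin
  obtain ⟨y, hy⟩ := htr.indep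
  rw [hcard] at hHF
  obtain ⟨A, G, hG1, hG2, hG3⟩ := thmB _ r _ (by positivity) hHF y hy
  refine ⟨A.sort.map G, hG1, ?_, hG2⟩
  intro g hg
  obtain ⟨j, hj, rfl⟩ := List.mem_map.1 hg
  have := (hG3 j ((Finset.mem_sort _).1 hj)).2.1
  rw [hcard] at this
  exact this

lemma tri_union (H M0 : Subgroup (GL (Fin n) k)) (D : ℕ) (D' : ℝ) (hD : (D : ℝ) ≤ D')
    (hM0H : M0 ≤ H) (hM0 : ZC (M0 : Set (GL (Fin n) k)))
    (hfi : FinIdx (M0 : Set (GL (Fin n) k)) H)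
    (htri : ∀ t : GL (Fin n) k, ∃ G : List (Rn n k), IsTriangularSet G ∧
      (∀ g ∈ G, g.totalDegree ≤ D) ∧ trep G = vI (ltr t (M0 : Set (GL (Fin n) k)))) :
    SubgroupTriRepBoundedBy H D' := by
  classical
  obtain ⟨t, htH, ht⟩ := hfi
  have hH : (H : Set (GL (Fin n) k)) = ⋃ x ∈ t, ltr x (M0 : Set (GL (Fin n) k)) := by
    ext y
    constructor
    · intro hy
      obtain ⟨x, hx, hxy⟩ := ht y hy
      exact Set.mem_biUnion hx hxy
    · intro hy
      obtain ⟨x, hx, hxy⟩ := Set.mem_iUnion₂.1 hy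
      have h1 : x * (x⁻¹ * y) ∈ H := H.mul_mem (htH x hx) (hM0H hxy)
      simpa using h1
  have hZ : ZC (H : Set (GL (Fin n) k)) := by
    rw [hH]
    exact ZC_biUnion t _ (fun x _ => ZC_ltr x hM0)
  have hvI : ∀ f, f ∈ vI (H : Set (GL (Fin n) k)) ↔
      ∀ x ∈ t, f ∈ vI (ltr x (M0 : Set (GL (Fin n) k))) := by
    intro f
    constructor
    · intro hf x hx
      exact vI_anti (by rw [hH]; exact Set.subset_biUnion_of_mem (u := fun x => ltr x (M0 : Set (GL (Fin n) k))) hx) hf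
    · intro hf g hg
      obtain ⟨x, hx, hxy⟩ := ht g hg
      exact hf x hx g hxy
  obtain ⟨S, hS⟩ := (isNoetherianRing_iff_ideal_fg (Rn n k)).1 inferInstance
    (vI (H : Set (GL (Fin n) k)))
  have hrad : ∀ Y : Set (GL (Fin n) k), (vI Y).IsRadical := by
    intro Y f ⟨m, hf⟩ g hg
    have := hf g hg
    rw [map_pow] at this
    by_contra h
    exact pow_ne_zero _ h this
  refine ⟨S, ?_, ?_⟩
  · intro g
    constructor
    · intro hg p hp
      rw [evalMat_eq]
      have : p ∈ vI (H : Set (GL (Fin n) k)) := by rw [← hS]; exact Ideal.subset_span hp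
      exact this g hg
    · intro h
      apply hZ
      have h2 : vI (H : Set (GL (Fin n) k)) ≤ RingHom.ker (evm (g : Mn n k)) := by
        rw [← hS, Ideal.span_le]
        intro p hp
        have := h p hp
        rw [evalMat_eq] at this
        exact this
      intro f hf
      exact h2 hf
  · rw [show Ideal.span (S : Set (Rn n k)) = vI (H : Set (GL (Fin n) k)) from hS]
    obtain ⟨x0, hx0, -⟩ := ht 1 H.one_mem
    obtain ⟨N, hN⟩ : ∃ N, t.card = N + 1 :=
      ⟨t.card - 1, by have := Finset.card_pos.2 ⟨x0, hx0⟩; omega⟩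
    let e : t ≃ Fin (N + 1) := t.equivFinOfCardEq hN
    choose G hG1 hG2 hG3 using htri
    refine ⟨N, fun i => G (e.symm i), fun i => hG1 _, ?_, ?_, ?_⟩
    · intro i g hg
      exact le_trans (by exact_mod_cast hG2 _ g hg) hD
    · intro i
      exact ⟨_, hrad _, (hG3 _).symm⟩
    · rw [(hrad _).radical]
      ext f
      rw [Set.mem_iInter]
      simp only [hG3]
      rw [SetLike.mem_coe, hvI]
      constructor
      · intro h i
        exact h _ (e.symm i).2
      · intro h x hx
        have := h (e ⟨x, hx⟩)
        rwa [Equiv.symm_apply_apply] at this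
end Hb2

open MvPolynomial Matrix Pointwise
set_option linter.unusedSectionVars false
set_option linter.deprecated false
set_option linter.unusedSimpArgs false

section Fin1
variable {k : Type*} [Field k] {n : ℕ} [CharZero k] [IsAlgClosed k]

lemma rho_ne {g : GL (Fin n) k} {f : Rn n k} (hf : f ≠ 0) : rho (g : Mn n k) f ≠ 0 := by
  intro h
  apply hf
  have h1 := congrArg (rho ((g⁻¹ : GL (Fin n) k) : Mn n k)) h
  rwa [rho_rho, ← Units.val_mul, inv_mul_cancel, Units.val_one, rho_one, map_zero] at h1

lemma charKer_fix (C M0 : Subgroup (GL (Fin n) k)) (e : ℕ) (hle : M0 ≤ lineStab C e)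
    (g : GL (Fin n) k) (hg : g ∈ charKernels (M0 : Set (GL (Fin n) k))) (f : Rn n k)
    (hf : f.totalDegree ≤ e) (hs : Semi C f) : rho (g : Mn n k) f = f := by
  by_cases h0 : ∃ A : Mn n k, evm A f ≠ 0
  · obtain ⟨A, hA⟩ := h0
    have hf0 : f ≠ 0 := by rintro rfl; exact hA (map_zero _)
    let χ : GL (Fin n) k → k := fun x => evm (A * (x : Mn n k)) f / evm A f
    have hχ : ∀ x ∈ M0, rho (x : Mn n k) f = χ x • f := by
      intro x hx
      obtain ⟨a, ha⟩ := hle hx f hf hs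
      have h1 : χ x = a := by
        simp only [χ]
        rw [← evm_rho, ha, map_smul, smul_eq_mul, mul_div_cancel_right₀ _ hA]
      rw [h1, ha]
    have hchar : IsCharacterOn (M0 : Set (GL (Fin n) k)) χ := by
      refine ⟨?_, ?_, MvPolynomial.C (evm A f)⁻¹ * lam A f, 0, ?_⟩
      · intro x hx h1
        have h2 := hχ x hx
        rw [h1, zero_smul] at h2
        exact rho_ne hf0 h2
      · intro x hx y hy
        have h1 := hχ (x * y) (M0.mul_mem hx hy)
        rw [Units.val_mul, ← rho_rho, hχ y hy, map_smul, hχ x hx, smul_smul] at h1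
        have h2 := smul_left_injective k hf0 h1
        rw [← h2, mul_comm]
      · intro x _
        rw [evalMat_eq, map_mul, evm_C, evm_lam, pow_zero, div_one]
        simp only [χ]
        rw [div_eq_inv_mul]
    rw [hχ g hg.1, hg.2 χ hchar, one_smul]
  · push Not at h0
    have : f = 0 := evm_ext (by intro A; rw [h0, map_zero])
    rw [this, map_zero]

lemma charKer_normal (M0 : Subgroup (GL (Fin n) k)) (g h : GL (Fin n) k) (hg : g ∈ M0)
    (hh : h ∈ charKernels (M0 : Set (GL (Fin n) k))) :
    g * h * g⁻¹ ∈ charKernels (M0 : Set (GL (Fin n) k)) := by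
  refine ⟨M0.mul_mem (M0.mul_mem hg hh.1) (M0.inv_mem hg), ?_⟩
  intro χ hχ
  have h1 : χ 1 = 1 := by
    have h2 := hχ.2.1 1 M0.one_mem 1 M0.one_mem
    rw [mul_one] at h2
    have h3 := hχ.1 1 M0.one_mem
    exact (mul_left_cancel₀ h3 (by rw [mul_one]; exact h2)).symm
  rw [hχ.2.1 _ (M0.mul_mem hg hh.1) _ (M0.inv_mem hg), hχ.2.1 _ hg _ hh.1, hh.2 χ hχ, mul_one,
    ← hχ.2.1 _ hg _ (M0.inv_mem hg), mul_inv_cancel, h1]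

lemma main_num (hnum : (FB n : ℝ) ≤ d3Bound n) :
    ∃ F : Set (Subgroup (GL (Fin n) k)),
      (∀ H ∈ F, SubgroupTriRepBoundedBy H (d3Bound n)) ∧
      ∀ H' : Subgroup (GL (Fin n) k), IsAlgebraicSubgroup H' →
        ∃ Hbar ∈ F,
          charKernels (idComponent Hbar) ⊆ idComponent H' ∧
          (∀ g ∈ idComponent H', ∀ h ∈ charKernels (idComponent Hbar),
            g * h * g⁻¹ ∈ charKernels (idComponent Hbar)) ∧
          idComponent H' ⊆ (H' : Set (GL (Fin n) k)) ∧
          (H' : Set (GL (Fin n) k)) ⊆ (Hbar : Set (GL (Fin n) k)) := by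
  classical
  refine ⟨{H | SubgroupTriRepBoundedBy H (d3Bound n)}, fun H hH => hH, ?_⟩
  rintro H ⟨S, hS⟩
  have hH : ZC (H : Set (GL (Fin n) k)) := by
    apply ZC_of _ (S : Set (Rn n k))
    intro g
    have := hS g
    simp only [evalMat_eq] at this
    exact this
  obtain ⟨C, hCH, hC, hP, hfi⟩ := exists_comp H hH
  set e := E1 n with he
  obtain ⟨M0, hM, hM0, hPM, hfiM⟩ := exists_comp (lineStab C e) (ZC_lineStab C e)
  have hCM : C ≤ M0 := by
    apply sub_comp M0 (lineStab C e) hM0 hfiM (C : Set (GL (Fin n) k)) _ hP C.one_mem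
    intro c hc f _ hs
    exact hs c hc
  have hnC : ∀ h ∈ H, ∀ c ∈ C, h * c * h⁻¹ ∈ C := by
    intro h hh
    apply comp_conj C H hCH hC hP hfi h
    · intro x hx; exact H.mul_mem (H.mul_mem hh hx) (H.inv_mem hh)
    · intro x hx; exact H.mul_mem (H.mul_mem (H.inv_mem hh) hx) hh
  have hsemi : ∀ h ∈ H, ∀ f : Rn n k, Semi C f → Semi C (rho (h : Mn n k) f) := by
    intro h hh f hf c hc
    have h1 := hnC h⁻¹ (H.inv_mem hh) c hc
    obtain ⟨a, ha⟩ := hf _ h1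
    refine ⟨a, ?_⟩
    rw [← map_smul, ← ha, rho_rho, rho_rho, ← Units.val_mul, ← Units.val_mul]
    congr 3
    group
  have hnM' : ∀ h ∈ H, ∀ g ∈ lineStab C e, h * g * h⁻¹ ∈ lineStab C e := by
    intro h hh g hg f hf hs
    obtain ⟨a, ha⟩ := hg (rho ((h⁻¹ : GL (Fin n) k) : Mn n k) f)
      ((totalDegree_rho_le _ _).trans hf) (hsemi _ (H.inv_mem hh) f hs)
    refine ⟨a, ?_⟩
    rw [Units.val_mul, Units.val_mul, ← rho_rho, ← rho_rho, ha, map_smul, rho_rho,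
      ← Units.val_mul, mul_inv_cancel, Units.val_one, rho_one]
  have hnM : ∀ h ∈ H, ∀ g ∈ M0, h * g * h⁻¹ ∈ M0 := by
    intro h hh
    apply comp_conj M0 (lineStab C e) hM hM0 hPM hfiM h
    · exact hnM' h hh
    · intro x hx
      have := hnM' h⁻¹ (H.inv_mem hh) x hx
      rwa [inv_inv] at this
  let Hb : Subgroup (GL (Fin n) k) :=
    { carrier := {x | ∃ h ∈ H, ∃ m ∈ M0, x = h * m}
      mul_mem' := by
        rintro _ _ ⟨h, hh, m, hm, rfl⟩ ⟨h', hh', m', hm', rfl⟩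
        refine ⟨h * h', H.mul_mem hh hh', (h'⁻¹ * m * h'⁻¹⁻¹) * m',
          M0.mul_mem (hnM _ (H.inv_mem hh') m hm) hm', by group⟩
      one_mem' := ⟨1, H.one_mem, 1, M0.one_mem, by simp⟩
      inv_mem' := by
        rintro _ ⟨h, hh, m, hm, rfl⟩
        exact ⟨h⁻¹, H.inv_mem hh, h * m⁻¹ * h⁻¹, hnM h hh _ (M0.inv_mem hm), by group⟩ }
  have hM0b : M0 ≤ Hb := fun m hm => ⟨1, H.one_mem, m, hm, by simp⟩
  have hHb : H ≤ Hb := fun h hh => ⟨h, hh, 1, M0.one_mem, by simp⟩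
  have hfib : FinIdx (M0 : Set (GL (Fin n) k)) Hb := by
    obtain ⟨t, ht1, ht2⟩ := hfi
    refine ⟨t, fun x hx => hHb (ht1 x hx), ?_⟩
    rintro _ ⟨h, hh, m, hm, rfl⟩
    obtain ⟨x, hx, hxc⟩ := ht2 h hh
    refine ⟨x, hx, ?_⟩
    rw [← mul_assoc]
    exact M0.mul_mem (hCM hxc) hm
  rw [idComponent_eq C H hCH hC hP hfi]
  refine ⟨Hb, ?_, ?_⟩
  · exact tri_union Hb M0 (FB n) _ hnum hM0b hM0 hfib
      (fun t => coset_tri C M0 e hM0 hPM hM hfiM t)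
  rw [idComponent_eq M0 Hb hM0b hM0 hPM hfib]
  refine ⟨?_, ?_, hCH, hHb⟩
  · intro g hg
    apply chev C hC hP e _ g
    · intro h hdeg hs
      exact charKer_fix C M0 e hM g hg h hdeg hs
    · exact Nat.mul_le_mul_right _ (IT_finrank _ _)
  · intro g hg h hh
    exact charKer_normal M0 g h (hCM hg) hh
end Fin1

open MvPolynomial Matrix Pointwise
set_option linter.unusedSectionVars false

lemma succ_le_two_pow (x : ℕ) : x + 1 ≤ 2 ^ x := Nat.lt_two_pow_self

lemma TB_le {B N b : ℕ} (hB : B ≤ 2 ^ b) (hN : 4 ≤ N) (hb : N ^ 2 ≤ b) :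
    TB B N ≤ 2 ^ (b * N ^ 4) := by
  obtain ⟨t, ht⟩ : ∃ t, t = tB B N := ⟨_, rfl⟩
  obtain ⟨c, hc⟩ : ∃ c, c = t2B B N := ⟨_, rfl⟩
  have hN1 := succ_le_two_pow N
  have h1 : t ≤ 2 ^ (b + N * N + N) := by
    rw [ht, tB, pow_add, pow_add, pow_mul]
    gcongr
  have hNb : N ≤ b := by nlinarith
  have h1' : t ≤ 2 ^ (3 * b) := h1.trans (Nat.pow_le_pow_right (by norm_num) (by nlinarith))
  have h2 : N + (2 * t * N + 1) ≤ 2 ^ (3 * b + 2 + N) := by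
    have hp : 1 ≤ 2 ^ (3 * b) := Nat.one_le_two_pow
    calc N + (2 * t * N + 1) ≤ (2 * t + 1) * (N + 1) := by nlinarith
      _ ≤ (2 ^ (3 * b) * 2 ^ 2) * 2 ^ N := by
        apply Nat.mul_le_mul _ hN1
        omega
      _ = _ := by rw [pow_add, pow_add]
  have h3 : c ≤ 2 ^ (b + (3 * b + 2 + N) * N + N) := by
    rw [hc, t2B, ← ht, pow_add, pow_add, pow_mul]
    gcongr
  have h4 : t ^ N ≤ 2 ^ (3 * b * N) := by
    rw [pow_mul]; gcongr
  have h5 : (t ^ N) ^ 2 + t ^ N + 1 ≤ 2 ^ (3 * b * N * 2 + 2) := by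
    have hp : 1 ≤ 2 ^ (3 * b * N) := Nat.one_le_two_pow
    rw [pow_add, pow_mul _ _ 2]
    generalize 2 ^ (3 * b * N) = y at *
    generalize t ^ N = x at *
    nlinarith
  have h6 : (N + 1) * t ≤ 2 ^ (N + 3 * b) := by
    rw [pow_add]; gcongr
  have h7 : TB B N ≤ 2 ^ (3 * b * N + ((3 * b * N * 2 + 2) + (b + (3 * b + 2 + N) * N + N)))
      + 2 ^ (N + 3 * b) := by
    rw [TB, ← ht, ← hc]
    refine Nat.add_le_add ?_ h6
    rw [pow_add, pow_add 2 (3 * b * N * 2 + 2)]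
    gcongr
  have h8 : ∀ x y : ℕ, 2 ^ x + 2 ^ y ≤ 2 ^ (x + y + 1) := by
    intro x y
    have hx : 1 ≤ 2 ^ x := Nat.one_le_two_pow
    have hy : 1 ≤ 2 ^ y := Nat.one_le_two_pow
    rw [pow_succ, pow_add]
    generalize 2 ^ x = p at *
    generalize 2 ^ y = q at *
    nlinarith
  refine (h7.trans (h8 _ _)).trans (Nat.pow_le_pow_right (by norm_num) ?_)
  have e1 : b * N * 64 ≤ b * N ^ 4 := by
    have : 4 ^ 3 ≤ N ^ 3 := Nat.pow_le_pow_left hN 3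
    calc b * N * 64 ≤ b * N * N ^ 3 := Nat.mul_le_mul_left _ (by simpa using this)
      _ = _ := by ring
  refine le_trans ?_ e1
  have e2 : N * N ≤ b * N := Nat.mul_le_mul_right _ hNb
  have e3 : b * 4 ≤ b * N := Nat.mul_le_mul_left _ hN
  nlinarith

lemma FB_le_two (n : ℕ) (hn : 1 < n) : FB n ≤ 2 ^ (n ^ 30) := by
  obtain ⟨N, hNn⟩ : ∃ N, N = n * n := ⟨_, rfl⟩
  have hN : 4 ≤ N := by nlinarith
  have hnN : n ≤ N := by nlinarith
  have hT : T1 n ≤ 2 ^ (N ^ 6) := by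
    rw [T1, ← hNn]
    have : (n + 1) ^ N ≤ 2 ^ (N ^ 2) := by
      rw [pow_two, pow_mul]
      exact Nat.pow_le_pow_left ((succ_le_two_pow n).trans
        (Nat.pow_le_pow_right (by norm_num) hnN)) _
    refine (TB_le this hN le_rfl).trans (le_of_eq ?_)
    congr 1; ring
  have hE : E1 n ≤ 2 ^ (N ^ 8) := by
    rw [E1, ← hNn]
    have h1 : T1 n + 1 ≤ 2 ^ (N ^ 6 + 1) := by
      rw [pow_succ]
      have : 1 ≤ 2 ^ (N ^ 6) := Nat.one_le_two_pow
      omega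
    calc (T1 n + 1) ^ N * T1 n ≤ (2 ^ (N ^ 6 + 1)) ^ N * 2 ^ (N ^ 6) := by gcongr
      _ = 2 ^ ((N ^ 6 + 1) * N + N ^ 6) := by rw [← pow_mul, ← pow_add]
      _ ≤ _ := by
        apply Nat.pow_le_pow_right (by norm_num)
        have h0 : 1 ≤ N ^ 6 := Nat.one_le_pow _ _ (by omega)
        have : N ^ 8 = N ^ 6 * (N * N) := by ring
        rw [this]
        generalize N ^ 6 = z at *
        have : z * (3 * N) ≤ z * (N * N) := Nat.mul_le_mul_left _ (by nlinarith)
        nlinarith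
  have hB : 2 ^ N * (1 + E1 n) ^ (N * N) ≤ 2 ^ (N ^ 11) := by
    have h1 : 1 + E1 n ≤ 2 ^ (N ^ 8 + 1) := by
      rw [pow_succ]
      have : 1 ≤ 2 ^ (N ^ 8) := Nat.one_le_two_pow
      omega
    calc 2 ^ N * (1 + E1 n) ^ (N * N) ≤ 2 ^ N * (2 ^ (N ^ 8 + 1)) ^ (N * N) := by gcongr
      _ = 2 ^ (N + (N ^ 8 + 1) * (N * N)) := by rw [← pow_mul, ← pow_add]
      _ ≤ _ := by
        apply Nat.pow_le_pow_right (by norm_num)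
        have h0 : 1 ≤ N ^ 8 := Nat.one_le_pow _ _ (by omega)
        have : N ^ 11 = N ^ 8 * (N * N) * N := by ring
        rw [this]
        generalize N ^ 8 = z at *
        have a1 : N * N ≤ z * (N * N) := Nat.le_mul_of_pos_left _ h0
        have a2 : z * (N * N) * 4 ≤ z * (N * N) * N := Nat.mul_le_mul_left _ hN
        have a3 : N ≤ N * N := Nat.le_mul_of_pos_left _ (by omega)
        nlinarith
  rw [FB, ← hNn]
  refine (TB_le hB hN (Nat.pow_le_pow_right (by omega) (by norm_num))).trans (le_of_eq ?_)
  congr 1; rw [hNn]; ring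

lemma FB_le (n : ℕ) (hn : 1 < n) : (FB n : ℝ) ≤ d3Bound n := by
  have h0 : (FB n : ℝ) ≤ (2 : ℝ) ^ ((n : ℝ) ^ 30) := by
    have : (FB n : ℝ) ≤ ((2 ^ (n ^ 30) : ℕ) : ℝ) := by exact_mod_cast FB_le_two n hn
    refine this.trans (le_of_eq ?_)
    rw [Nat.cast_pow, ← Real.rpow_natCast]
    push_cast
    rfl
  have hn1 : (1 : ℝ) ≤ n := by exact_mod_cast hn.le
  have hn3 : (1 : ℝ) ≤ (n : ℝ) ^ 3 := one_le_pow₀ hn1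
  have hn8 : (1 : ℝ) ≤ (n : ℝ) ^ 8 := one_le_pow₀ hn1
  have hnn3 : (n : ℝ) ≤ (n : ℝ) ^ 3 := le_self_pow₀ hn1 (by norm_num)
  unfold d3Bound
  obtain ⟨E, hE⟩ : ∃ E : ℝ, E = (2 * (n : ℝ) ^ 3) ^ (149 * (n : ℝ) ^ 8) := ⟨_, rfl⟩
  have hE1 : (n : ℝ) ^ 30 ≤ E := by
    rw [hE]
    calc (n : ℝ) ^ 30 ≤ (2 * (n : ℝ) ^ 3) ^ 30 := by gcongr; linarith
      _ = (2 * (n : ℝ) ^ 3) ^ (30 : ℝ) := by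
        rw [← Real.rpow_natCast]; norm_num
      _ ≤ _ := Real.rpow_le_rpow_of_exponent_le (by linarith) (by linarith)
  have hEp : 0 ≤ E := le_trans (by positivity) hE1
  rw [← hE]
  have h16 : E ≤ (16 : ℝ) ^ E := by
    have h := one_add_mul_self_le_rpow_one_add (s := 15) (p := max E 1) (by norm_num) (le_max_right _ _)
    rcases le_total 1 E with h1 | h1
    · rw [max_eq_left h1] at h
      have : (1 + 15 : ℝ) = 16 := by norm_num
      rw [this] at h
      linarith
    · exact h1.trans (Real.one_le_rpow (by norm_num) hEp)
  have hX : (n : ℝ) ^ 30 ≤ 5.5 * (n : ℝ) ^ 3 * (16 : ℝ) ^ E := by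
    have : 1 * (16 : ℝ) ^ E ≤ 5.5 * (n : ℝ) ^ 3 * (16 : ℝ) ^ E := by
      gcongr; linarith
    linarith
  have hXp : 0 ≤ 5.5 * (n : ℝ) ^ 3 * (16 : ℝ) ^ E := le_trans (by positivity) hX
  generalize 5.5 * (n : ℝ) ^ 3 * (16 : ℝ) ^ E = X at *
  calc (FB n : ℝ) ≤ (2 : ℝ) ^ ((n : ℝ) ^ 30) := h0
    _ ≤ (2 : ℝ) ^ X := Real.rpow_le_rpow_of_exponent_le (by norm_num) hX
    _ ≤ (8 : ℝ) ^ X := Real.rpow_le_rpow (by norm_num) (by norm_num) hXp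
    _ ≤ n * (8 : ℝ) ^ X := le_mul_of_one_le_left (by positivity) hn1

/-- For `n > 1` there is a family `𝓕̄` of algebraic subgroups of `GL_n(k)`,
each with a triangular representation bounded by `n·8^(5.5n³·16^((2n³)^(149n⁸)))`, such that
every algebraic subgroup `H' ⊆ GL_n(k)` admits `H̄ ∈ 𝓕̄` with `(H̄°)ᵗ` normal in `(H')°` and
`(H̄°)ᵗ ⊆ (H')° ⊆ H' ⊆ H̄`. -/
theorem protoGalois_from_family {k : Type*} [Field k] [IsAlgClosed k] [CharZero k]
    (n : ℕ) (hn : 1 < n) :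
    ∃ F : Set (Subgroup (GL (Fin n) k)),
      (∀ H ∈ F, SubgroupTriRepBoundedBy H (d3Bound n)) ∧
      ∀ H' : Subgroup (GL (Fin n) k), IsAlgebraicSubgroup H' →
        ∃ Hbar ∈ F,
          charKernels (idComponent Hbar) ⊆ idComponent H' ∧
          (∀ g ∈ idComponent H', ∀ h ∈ charKernels (idComponent Hbar),
            g * h * g⁻¹ ∈ charKernels (idComponent Hbar)) ∧
          idComponent H' ⊆ (H' : Set (GL (Fin n) k)) ∧
          (H' : Set (GL (Fin n) k)) ⊆ (Hbar : Set (GL (Fin n) k)) := by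
  exact main_num (FB_le n hn)
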